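/- For any ε ∈ (0, 1), 1 ≤ p ≤ 2, and positive integers n and m with m ≥ n/ε², there exists a linear map f : ℝ^n → ℝ^m such that for every x ∈ ℝ^n, (1−ε)·‖x‖₂ ≤ ‖f(x)‖_p ≤ (1+ε)·‖x‖₂. -/

import Mathlib

open Real BigOperators

/-- The ℓ_p "norm" (for a real exponent `p`) of a vector in `ℝ^m`. -/
noncomputable def lpNorm (p : ℝ) {m : ℕ} (x : Fin m → ℝ) : ℝ :=
  (∑ i, |x i| ^ p) ^ (1 / p)

open Filter

abbrev Eu (m : ℕ) := EuclideanSpace ℝ (Fin m)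

lemma taylor3_aux1 {E F : Type*} [NormedAddCommGroup E] [NormedSpace ℝ E]
    [NormedAddCommGroup F] [NormedSpace ℝ F] (f : E → F) (f' : E → E →L[ℝ] F)
    (hf : ∀ x, HasFDerivAt f (f' x) x) (C : ℝ) (hC0 : 0 ≤ C)
    (hC : ∀ x y, ‖f' x - f' y‖ ≤ C * ‖x - y‖) (y v : E) :
    ‖f (y + v) - f y - f' y v‖ ≤ C * ‖v‖^2 := by
  have hder : ∀ x ∈ Metric.closedBall (0 : E) ‖v‖, HasFDerivWithinAt
      (fun v => f (y + v) - f' y v) (f' (y + x) - f' y) (Metric.closedBall (0 : E) ‖v‖) x := by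
    intro x _
    apply HasFDerivAt.hasFDerivWithinAt
    apply HasFDerivAt.sub
    · exact ((hf (y + x)).comp x ((hasFDerivAt_id x).const_add y))
    · exact (f' y).hasFDerivAt
  have hb : ∀ x ∈ Metric.closedBall (0 : E) ‖v‖, ‖f' (y + x) - f' y‖ ≤ C * ‖v‖ := by
    intro x hx
    have := hC (y + x) y
    rw [add_sub_cancel_left] at this
    refine this.trans ?_
    have : ‖x‖ ≤ ‖v‖ := by simpa using hx
    gcongr
  have := (convex_closedBall (0 : E) ‖v‖).norm_image_sub_le_of_norm_hasFDerivWithin_le hder hb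
    (x := 0) (y := v) (by simp) (by simp)
  simp only [add_zero, map_zero, sub_zero] at this
  calc _ = ‖f (y + v) - f' y v - f y‖ := by congr 1; abel
    _ ≤ _ := this
    _ = _ := by ring

lemma taylor3_aux2 {E : Type*} [NormedAddCommGroup E] [NormedSpace ℝ E] (φ : E → ℝ)
    (f : E → E →L[ℝ] ℝ) (B : E → E →L[ℝ] E →L[ℝ] ℝ) (hf : ∀ x, HasFDerivAt φ (f x) x)
    (C : ℝ) (hC0 : 0 ≤ C)
    (e1 : ∀ y v, ‖f (y + v) - f y - B y v‖ ≤ C * ‖v‖^2) (y u : E) :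
    |φ (y + u) - φ y - f y u - (1/2) * B y u u| ≤ C * ‖u‖^3 := by
  have hder : ∀ t ∈ Set.Icc (0 : ℝ) 1, HasDerivWithinAt
      (fun t : ℝ => φ (y + t • u) - t * f y u - (1/2) * t^2 * B y u u)
      ((f (y + t • u) - f y - B y (t • u)) u) (Set.Icc 0 1) t := by
    intro t _
    apply HasDerivAt.hasDerivWithinAt
    have a1 : HasDerivAt (fun t : ℝ => φ (y + t • u)) (f (y + t • u) u) t := by
      have : HasDerivAt (fun t : ℝ => y + t • u) u t := by
        simpa using ((hasDerivAt_id t).smul_const u).const_add y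
      exact (hf (y + t • u)).comp_hasDerivAt t this
    have a2 : HasDerivAt (fun t : ℝ => t * f y u) (f y u) t := by
      simpa using (hasDerivAt_id t).mul_const (f y u)
    have a3 : HasDerivAt (fun t : ℝ => (1/2) * t^2 * B y u u) (t * B y u u) t := by
      have := ((hasDerivAt_pow 2 t).const_mul (1/2 : ℝ)).mul_const (B y u u)
      refine this.congr_deriv ?_
      simp only [Nat.cast_ofNat, Nat.add_one_sub_one, pow_one]
      ring
    refine ((a1.sub a2).sub a3).congr_deriv ?_
    simp only [sub_apply, map_smul, smul_apply, smul_eq_mul]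
  have hb : ∀ t ∈ Set.Icc (0 : ℝ) 1, ‖(f (y + t • u) - f y - B y (t • u)) u‖ ≤ C * ‖u‖^3 := by
    intro t ht
    refine (ContinuousLinearMap.le_opNorm _ _).trans ?_
    have := e1 y (t • u)
    have h3 : ‖t • u‖ ≤ ‖u‖ := by
      rw [norm_smul, Real.norm_of_nonneg ht.1]
      exact mul_le_of_le_one_left (norm_nonneg _) ht.2
    calc _ ≤ (C * ‖t • u‖^2) * ‖u‖ := by gcongr
      _ ≤ (C * ‖u‖^2) * ‖u‖ := by gcongr
      _ = _ := by ring
  have := (convex_Icc (0:ℝ) 1).norm_image_sub_le_of_norm_hasDerivWithin_le hder hb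
      (x := 0) (y := 1) (by simp) (by simp)
  simp only [one_smul, zero_smul, add_zero, zero_mul, sub_zero, one_mul, norm_one, mul_one] at this
  rw [← Real.norm_eq_abs]
  refine le_of_eq_of_le ?_ this
  congr 1
  ring

lemma lip_of_cs {E F : Type*} [NormedAddCommGroup E] [NormedSpace ℝ E]
    [NormedAddCommGroup F] [NormedSpace ℝ F] (f : E → F) (hc : HasCompactSupport f)
    (hf : ContDiff ℝ ((⊤ : ℕ∞) : WithTop ℕ∞) f) :
    ∃ C : ℝ, 0 ≤ C ∧ ∀ x y, ‖f x - f y‖ ≤ C * ‖x - y‖ := by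
  have c3 : HasCompactSupport (fderiv ℝ f) := hc.fderiv ℝ
  have k3 : Continuous (fderiv ℝ f) := hf.continuous_fderiv (by simp)
  obtain ⟨C, hC⟩ := c3.exists_bound_of_continuous k3
  refine ⟨C, (norm_nonneg _).trans (hC 0), fun x y => ?_⟩
  exact (convex_univ).norm_image_sub_le_of_norm_fderiv_le (𝕜 := ℝ)
    (fun z _ => hf.differentiable (by simp) z) (fun z _ => hC z)
      (Set.mem_univ y) (Set.mem_univ x)

lemma taylor3 {E : Type*} [NormedAddCommGroup E] [NormedSpace ℝ E] (φ : E → ℝ)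
    (hφ : ContDiff ℝ ((⊤ : ℕ∞) : WithTop ℕ∞) φ) (hc : HasCompactSupport φ) :
    ∃ C : ℝ, 0 ≤ C ∧ ∀ y u : E,
      |φ (y + u) - φ y - fderiv ℝ φ y u - (1/2) * fderiv ℝ (fderiv ℝ φ) y u u| ≤ C * ‖u‖^3 := by
  have h1 : ContDiff ℝ ((⊤ : ℕ∞) : WithTop ℕ∞) (fderiv ℝ φ) := hφ.fderiv_right (by simp)
  have h2 : ContDiff ℝ ((⊤ : ℕ∞) : WithTop ℕ∞) (fderiv ℝ (fderiv ℝ φ)) := h1.fderiv_right (by simp)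
  have c1 : HasCompactSupport (fderiv ℝ φ) := hc.fderiv ℝ
  have c2 := HasCompactSupport.fderiv (𝕜 := ℝ) (E := E) (F := E →L[ℝ] ℝ) (f := fderiv ℝ φ) c1
  have c3 := lip_of_cs (E := E) (F := E →L[ℝ] E →L[ℝ] ℝ) (fderiv ℝ (fderiv ℝ φ))
  have d0 : Differentiable ℝ φ := hφ.differentiable (by simp)
  have d1 : Differentiable ℝ (fderiv ℝ φ) := h1.differentiable (by simp)
  have hL : ∃ C : ℝ, 0 ≤ C ∧ ∀ x y, ‖fderiv ℝ (fderiv ℝ φ) x - fderiv ℝ (fderiv ℝ φ) y‖ ≤ C * ‖x - y‖ := by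
    exact c3 c2 h2
  obtain ⟨C, hC0, hC⟩ := hL
  exact ⟨C, hC0, taylor3_aux2 φ _ _ (fun x => (d0 x).hasFDerivAt) C hC0
    (taylor3_aux1 _ _ (fun x => (d1 x).hasFDerivAt) C hC0 hC)⟩

/-- quadratic form of a coefficient array -/
noncomputable def qf {m : ℕ} (c : Fin m → Fin m → ℝ) (u : Eu m) : ℝ := ∑ i, ∑ j, c i j * (u i * u j)

structure IsMoll {m : ℕ} (K η : ℝ) (f g : Eu m → ℝ) (D : Eu m → Eu m)
    (B : Eu m → Fin m → Fin m → ℝ) : Prop where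
  close : ∀ b, |g b - f b| ≤ η
  lip : ∀ a b, |g a - g b| ≤ ‖a - b‖
  grad : ∀ b, ‖D b‖ ≤ 1
  hess : ∀ b u, |qf (B b) u| ≤ K * ‖u‖^2
  tay : ∀ b u, ‖u‖ ≤ 1 → |g (b + u) - g b - inner ℝ (D b) u - (1/2) * qf (B b) u| ≤ K * ‖u‖^3
  hom : (∀ (c : ℝ) b, 0 ≤ c → f (c • b) = c * f b) → ∀ b, |inner ℝ (D b) b - g b| ≤ η

lemma le_of_small {a b c : ℝ} (hc : 0 ≤ c) (h : ∀ s : ℝ, 0 < s → s ≤ 1 → a ≤ b + c * s) : a ≤ b := by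
  apply le_of_forall_pos_le_add
  intro e he
  have h1 : 0 < min 1 (e / (c + 1)) := by positivity
  refine (h _ h1 (min_le_left _ _)).trans ?_
  have : c * min 1 (e / (c+1)) ≤ c * (e / (c+1)) := by gcongr; exact min_le_right _ _
  have h2 : c * (e / (c+1)) ≤ e := by
    rw [← mul_div_assoc, div_le_iff₀ (by positivity)]; nlinarith
  linarith


lemma eu_expand {m : ℕ} (u : Eu m) : u = ∑ i, u i • EuclideanSpace.single i (1:ℝ) := by
  ext j
  simp [Finset.sum_apply, Pi.single_apply]

lemma qf_eq {m : ℕ} (L : Eu m →L[ℝ] Eu m →L[ℝ] ℝ) (u : Eu m) :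
    L u u = qf (fun i j => L (EuclideanSpace.single i (1:ℝ)) (EuclideanSpace.single j (1:ℝ))) u := by
  conv_lhs => rw [eu_expand u]
  simp only [map_sum, map_smul, sum_apply, smul_apply, smul_eq_mul, qf]
  rw [Finset.sum_comm]
  refine Finset.sum_congr rfl fun i _ => ?_
  rw [Finset.mul_sum]
  refine Finset.sum_congr rfl fun j _ => ?_
  ring

lemma lin_eq {m : ℕ} (L : Eu m →L[ℝ] ℝ) (u : Eu m) :
    L u = ∑ i, L (EuclideanSpace.single i (1:ℝ)) * u i := by
  conv_lhs => rw [eu_expand u]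
  simp only [map_sum, map_smul, smul_eq_mul]
  refine Finset.sum_congr rfl fun i _ => ?_
  ring

lemma bnd_cs {m : ℕ} (h : Eu m → ℝ) (hc : Continuous h) (r : ℝ) (hz : ∀ y, r < ‖y‖ → h y = 0) :
    ∃ C : ℝ, 0 ≤ C ∧ ∀ y, |h y| ≤ C := by
  obtain ⟨C, hC⟩ := (isCompact_closedBall (0 : Eu m) r).exists_bound_of_continuousOn hc.continuousOn
  refine ⟨max C 0, le_max_right _ _, fun y => ?_⟩
  by_cases hy : ‖y‖ ≤ r
  · exact (hC y (by simpa using hy)).trans (le_max_left _ _)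
  · rw [hz y (not_le.1 hy), abs_zero]; exact le_max_right _ _

lemma int_bnd {m : ℕ} (c : ℝ) (H : Eu m → ℝ) (h1 : ∀ y, |H y| ≤ c)
    (h2 : ∀ y, 2 < ‖y‖ → H y = 0) :
    |∫ y, H y| ≤ c * (MeasureTheory.volume (Metric.closedBall (0 : Eu m) 2)).toReal := by
  have e : ∫ y, H y = ∫ y in Metric.closedBall (0 : Eu m) 2, H y := by
    rw [MeasureTheory.setIntegral_eq_integral_of_forall_compl_eq_zero]
    intro y hy
    apply h2
    simpa using hy
  rw [e]
  have := MeasureTheory.norm_setIntegral_le_of_norm_le_const (f := H) (C := c)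
    (μ := MeasureTheory.volume) (s := Metric.closedBall (0 : Eu m) 2)
    (MeasureTheory.measure_closedBall_lt_top) (fun y _ => h1 y)
  exact this

lemma int_cs {m : ℕ} (h F : Eu m → ℝ) (hc : Continuous h) (hF : Continuous F) (r : ℝ)
    (hz : ∀ y, r < ‖y‖ → h y = 0) : MeasureTheory.Integrable (fun y => F y * h y) := by
  apply (hF.mul hc).integrable_of_hasCompactSupport
  refine HasCompactSupport.intro (isCompact_closedBall (0 : Eu m) r) (fun y hy => ?_)
  rw [Pi.mul_apply, hz y (by simpa using hy), mul_zero]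

set_option maxHeartbeats 1000000 in
lemma moll_aux {m : ℕ} (φ : Eu m → ℝ) (hφ : ContDiff ℝ ((⊤ : ℕ∞) : WithTop ℕ∞) φ)
    (r : ℝ) (hr1 : r ≤ 1) (hs : ∀ y, r < ‖y‖ → φ y = 0)
    (hc : HasCompactSupport φ) :
    ∃ K : ℝ, 0 ≤ K ∧ ∀ F : Eu m → ℝ, Continuous F → (∀ y, |F y| ≤ ‖y‖) →
      ∃ (D : Eu m) (B : Fin m → Fin m → ℝ), 
       (∀ u, |qf B u| ≤ K * ‖u‖^2) ∧ 
       (∀ u, ‖u‖ ≤ 1 → |(∫ y, F y * φ (y + u)) - (∫ y, F y * φ y) - inner ℝ D u - (1/2) * qf B u|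
          ≤ K * ‖u‖^3) := by
  obtain ⟨C, hC0, hC⟩ := taylor3 φ hφ hc
  have h1 : ContDiff ℝ ((⊤ : ℕ∞) : WithTop ℕ∞) (fderiv ℝ φ) := hφ.fderiv_right (by simp)
  have h2 : ContDiff ℝ ((⊤ : ℕ∞) : WithTop ℕ∞) (fderiv ℝ (fderiv ℝ φ)) := h1.fderiv_right (by simp)
  have k2 : Continuous (fderiv ℝ (fderiv ℝ φ)) := h2.continuous
  have k1 : Continuous (fderiv ℝ φ) := h1.continuous
  have k0 : Continuous φ := hφ.continuous
  have z1 : ∀ y, r < ‖y‖ → fderiv ℝ φ y = 0 := by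
    intro y hy
    have : φ =ᶠ[nhds y] fun _ => 0 := by
      filter_upwards [(isOpen_lt continuous_const continuous_norm).mem_nhds hy] with z hz using hs z hz
    rw [this.fderiv_eq]; simp
  have z2 : ∀ y, r < ‖y‖ → fderiv ℝ (fderiv ℝ φ) y = 0 := by
    intro y hy
    have : fderiv ℝ φ =ᶠ[nhds y] fun _ => 0 := by
      filter_upwards [(isOpen_lt continuous_const continuous_norm).mem_nhds hy] with z hz using z1 z hz
    rw [this.fderiv_eq]; simp
  have kp : ∀ u, Continuous (fun y => fderiv ℝ φ y u) := fun u => k1.clm_apply continuous_const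
  have kq : ∀ u v, Continuous (fun y => fderiv ℝ (fderiv ℝ φ) y u v) := fun u v =>
    (k2.clm_apply continuous_const).clm_apply continuous_const
  have zp : ∀ u y, r < ‖y‖ → fderiv ℝ φ y u = 0 := fun u y hy => by rw [z1 y hy]; rfl
  have zq : ∀ u v y, r < ‖y‖ → fderiv ℝ (fderiv ℝ φ) y u v = 0 := fun u v y hy => by rw [z2 y hy]; rfl
  set e : Fin m → Eu m := fun i => EuclideanSpace.single i (1:ℝ) with he
  choose M hM0 hM using fun i j => bnd_cs _ (kq (e i) (e j)) r (zq (e i) (e j))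
  set V : ℝ := (MeasureTheory.volume (Metric.closedBall (0 : Eu m) 2)).toReal with hV
  have hV0 : 0 ≤ V := ENNReal.toReal_nonneg
  have hsum0 : 0 ≤ ∑ i, ∑ j, M i j := Finset.sum_nonneg fun i _ => Finset.sum_nonneg fun j _ => hM0 i j
  refine ⟨2 * C * V + 2 * V * ∑ i, ∑ j, M i j, by positivity, fun F hF hFb => ?_⟩
  refine ⟨WithLp.toLp 2 (fun i => ∫ y, F y * fderiv ℝ φ y (e i)),
    fun i j => ∫ y, F y * fderiv ℝ (fderiv ℝ φ) y (e i) (e j), fun u => ?_, fun u hu => ?_⟩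
  · unfold qf
    have hb : ∀ i j, |∫ y, F y * fderiv ℝ (fderiv ℝ φ) y (e i) (e j)| ≤ 2 * M i j * V := by
      intro i j
      apply int_bnd
      · intro y
        by_cases hy : ‖y‖ ≤ 2
        · rw [abs_mul]
          exact mul_le_mul ((hFb y).trans hy) (hM i j y) (abs_nonneg _) (by norm_num)
        · rw [zq _ _ y (by linarith), mul_zero, abs_zero]; have := hM0 i j; positivity
      · intro y hy
        rw [zq _ _ y (by linarith), mul_zero]
    have hui : ∀ i, |u i| ≤ ‖u‖ := fun i => by
      simpa using PiLp.norm_apply_le u i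
    calc _ ≤ ∑ i, ∑ j, (2 * M i j * V) * (‖u‖ * ‖u‖) := by
          refine (Finset.abs_sum_le_sum_abs _ _).trans (Finset.sum_le_sum fun i _ => ?_)
          refine (Finset.abs_sum_le_sum_abs _ _).trans (Finset.sum_le_sum fun j _ => ?_)
          rw [abs_mul, abs_mul]
          have := hM0 i j
          gcongr
          · exact hb i j
          · exact hui i
          · exact hui j
      _ = (2 * V * ∑ i, ∑ j, M i j) * ‖u‖^2 := by
          simp only [← Finset.sum_mul, ← Finset.mul_sum]; ring
      _ ≤ _ := by gcongr; nlinarith [mul_nonneg hC0 hV0]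
  · have hL : inner ℝ (WithLp.toLp 2 (fun i => ∫ y, F y * fderiv ℝ φ y (e i)) : Eu m) u
        = ∫ y, F y * fderiv ℝ φ y u := by
      have : ∀ y, F y * fderiv ℝ φ y u = ∑ i, (F y * fderiv ℝ φ y (e i)) * u i := by
        intro y
        rw [lin_eq, Finset.mul_sum]
        exact Finset.sum_congr rfl fun i _ => by ring
      simp_rw [this]
      rw [MeasureTheory.integral_finsetSum _ fun i _ => (int_cs _ F (kp (e i)) hF r (zp (e i))).mul_const _]
      simp_rw [MeasureTheory.integral_mul_const]
      simp [PiLp.inner_apply, mul_comm]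
    have hQ : qf (fun i j => ∫ y, F y * fderiv ℝ (fderiv ℝ φ) y (e i) (e j)) u
        = ∫ y, F y * fderiv ℝ (fderiv ℝ φ) y u u := by
      have : ∀ y, F y * fderiv ℝ (fderiv ℝ φ) y u u
          = ∑ i, ∑ j, (F y * fderiv ℝ (fderiv ℝ φ) y (e i) (e j)) * (u i * u j) := by
        intro y
        rw [qf_eq, qf, Finset.mul_sum]
        refine Finset.sum_congr rfl fun i _ => ?_
        rw [Finset.mul_sum]
        exact Finset.sum_congr rfl fun j _ => by ring
      have hi : ∀ i j, MeasureTheory.Integrable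
          (fun y => (F y * fderiv ℝ (fderiv ℝ φ) y (e i) (e j)) * (u i * u j)) :=
        fun i j => (int_cs _ F (kq (e i) (e j)) hF r (zq (e i) (e j))).mul_const _
      simp_rw [this]
      rw [MeasureTheory.integral_finsetSum _ fun i _ => MeasureTheory.integrable_finsetSum _ fun j _ => hi i j]
      unfold qf
      refine Finset.sum_congr rfl fun i _ => ?_
      rw [MeasureTheory.integral_finsetSum _ fun j _ => hi i j]
      refine Finset.sum_congr rfl fun j _ => ?_
      rw [MeasureTheory.integral_mul_const]
    rw [hL, hQ]
    have j0 : ∀ v : Eu m, MeasureTheory.Integrable (fun y => F y * φ (y + v)) := by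
      intro v
      refine int_cs _ F (k0.comp (continuous_add_const v)) hF (r + ‖v‖) (fun y h3 => ?_)
      have h4 : ‖y‖ ≤ ‖y + v‖ + ‖v‖ := norm_le_add_norm_add y v
      exact hs _ (by linarith)
    have j00 : MeasureTheory.Integrable (fun y => F y * φ y) := by simpa using j0 0
    have e : (∫ y, F y * φ (y + u)) - (∫ y, F y * φ y) - (∫ y, F y * fderiv ℝ φ y u)
        - (1/2) * (∫ y, F y * fderiv ℝ (fderiv ℝ φ) y u u) =
        ∫ y, F y * (φ (y + u) - φ y - fderiv ℝ φ y u - (1/2) * fderiv ℝ (fderiv ℝ φ) y u u) := by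
      have i1 := int_cs _ F (kp u) hF r (zp u)
      have i2 := int_cs _ F (kq u u) hF r (zq u u)
      have i3 : MeasureTheory.Integrable (fun y => F y * φ (y + u) - F y * φ y) := (j0 u).sub j00
      have i4 : MeasureTheory.Integrable (fun y => F y * φ (y + u) - F y * φ y - F y * fderiv ℝ φ y u) :=
        i3.sub i1
      rw [← MeasureTheory.integral_const_mul, ← MeasureTheory.integral_sub (j0 u) j00,
        ← MeasureTheory.integral_sub i3 i1,
        ← MeasureTheory.integral_sub i4 (i2.const_mul _)]
      congr 1; ext y; ring
    rw [e]
    have := int_bnd (2 * C * ‖u‖^3) (fun y => F y * (φ (y + u) - φ y - fderiv ℝ φ y u - (1/2) * fderiv ℝ (fderiv ℝ φ) y u u)) ?_ ?_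
    · refine this.trans ?_
      have h3 : 0 ≤ ‖u‖^3 := by positivity
      nlinarith [mul_nonneg (mul_nonneg hV0 hsum0) h3]
    · intro y
      rw [abs_mul]
      by_cases hy : ‖y‖ ≤ 2
      · calc _ ≤ 2 * (C * ‖u‖^3) := mul_le_mul ((hFb y).trans hy) (hC y u) (abs_nonneg _) (by positivity)
          _ = _ := by ring
      · have h3 : 2 < ‖y‖ := not_le.1 hy
        have h4 : ‖y‖ ≤ ‖y + u‖ + ‖u‖ := norm_le_add_norm_add y u
        rw [hs (y + u) (by linarith), hs y (by linarith), zp _ y (by linarith), zq _ _ y (by linarith)]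
        simp; positivity
    · intro y h3
      have h4 : ‖y‖ ≤ ‖y + u‖ + ‖u‖ := norm_le_add_norm_add y u
      simp only [hs (y + u) (by linarith), hs y (by linarith), zp _ y (by linarith), zq _ _ y (by linarith)]
      simp

set_option maxHeartbeats 1000000 in
lemma moll (m : ℕ) (η : ℝ) (hη : 0 < η) : ∃ K : ℝ, 0 ≤ K ∧ ∀ f : Eu m → ℝ, LipschitzWith 1 f →
    ∃ g D B, IsMoll K η f g D B := by
  set r := min η 1 with hr
  have hr0 : 0 < r := by positivity
  have hr1 : r ≤ 1 := min_le_right _ _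
  have hrη : r ≤ η := min_le_left _ _
  let bp : ContDiffBump (0 : Eu m) := ⟨r/2, r, by positivity, by linarith⟩
  set φ : Eu m → ℝ := bp.normed MeasureTheory.volume with hφd
  have hφ : ContDiff ℝ ((⊤ : ℕ∞) : WithTop ℕ∞) φ := bp.contDiff_normed
  have hφ0 : ∀ y, 0 ≤ φ y := fun y => bp.nonneg_normed y
  have hφ1 : ∫ y, φ y = 1 := bp.integral_normed
  have hφc : HasCompactSupport φ := bp.hasCompactSupport_normed
  have hs : ∀ y, r < ‖y‖ → φ y = 0 := by
    intro y hy
    have : y ∉ Function.support φ := by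
      rw [hφd, bp.support_normed_eq]
      simpa [bp] using hy.le
    simpa using this
  have k0 : Continuous φ := hφ.continuous
  have iφ : MeasureTheory.Integrable φ := k0.integrable_of_hasCompactSupport hφc
  obtain ⟨K, hK0, hK⟩ := moll_aux φ hφ r hr1 hs hφc
  refine ⟨K, hK0, fun f hf => ?_⟩
  have hfc : Continuous f := hf.continuous
  have hfl : ∀ a b, |f a - f b| ≤ ‖a - b‖ := fun a b => by
    simpa using hf.norm_sub_le a b
  choose D B hB hT using fun b => hK (fun y => f (b - y) - f b) (by fun_prop)
    (fun y => by simpa using hfl (b - y) b)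
  have ii : ∀ b, MeasureTheory.Integrable (fun y => f (b - y) * φ y) := fun b =>
    int_cs φ (fun y => f (b - y)) k0 (by fun_prop) r hs
  set g : Eu m → ℝ := fun b => ∫ y, f (b - y) * φ y with hg
  -- bounds on differences of integrals against φ
  have key : ∀ (H : Eu m → ℝ) (c : ℝ), (∀ y, ‖y‖ ≤ r → |H y| ≤ c) →
      |∫ y, H y * φ y| ≤ c := by
    intro H c h
    have : ‖∫ y, H y * φ y‖ ≤ ∫ y, c * φ y := by
      apply MeasureTheory.norm_integral_le_of_norm_le (iφ.const_mul c)
      filter_upwards with y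
      rw [norm_mul, Real.norm_eq_abs, Real.norm_of_nonneg (hφ0 y)]
      by_cases hy : ‖y‖ ≤ r
      · exact mul_le_mul_of_nonneg_right (h y hy) (hφ0 y)
      · rw [hs y (not_le.1 hy)]; simp
    rw [MeasureTheory.integral_const_mul, hφ1, mul_one] at this
    exact this
  have hgsub : ∀ b c, g b - c = ∫ y, (f (b - y) - c) * φ y := by
    intro b c
    simp only [sub_mul]
    rw [MeasureTheory.integral_sub (ii b) (iφ.const_mul c), MeasureTheory.integral_const_mul, hφ1, mul_one]
  have hclose : ∀ b, |g b - f b| ≤ η := by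
    intro b
    rw [hgsub]
    apply key
    intro y hy
    have := hfl (b - y) b
    simp at this
    linarith
  have hlip : ∀ a b, |g a - g b| ≤ ‖a - b‖ := by
    intro a b
    have : g a - g b = ∫ y, (f (a - y) - f (b - y)) * φ y := by
      simp only [sub_mul, hg]
      rw [MeasureTheory.integral_sub (ii a) (ii b)]
    rw [this]
    apply key
    intro y _
    have := hfl (a - y) (b - y)
    simpa using this
  have htay : ∀ b u, ‖u‖ ≤ 1 → |g (b + u) - g b - inner ℝ (D b) u - (1/2) * qf (B b) u| ≤ K * ‖u‖^3 := by
    intro b u hu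
    have e1 : g (b + u) - f b = ∫ y, (f (b - y) - f b) * φ (y + u) := by
      rw [hgsub, ← MeasureTheory.integral_add_right_eq_self _ u]
      congr 1; ext y
      congr 3
      abel
    have e2 := hgsub b (f b)
    have := hT b u hu
    rw [← e1, ← e2] at this
    convert this using 2
    ring
  have hhess : ∀ b u, |qf (B b) u| ≤ K * ‖u‖^2 := hB
  have hqs : ∀ b (s : ℝ) u, qf (B b) (s • u) = s^2 * qf (B b) u := by
    intro b s u
    simp only [qf, Finset.mul_sum]
    refine Finset.sum_congr rfl fun i _ => Finset.sum_congr rfl fun j _ => ?_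
    simp; ring
  -- first-order consequence
  have hfirst : ∀ b u (s : ℝ), 0 < s → s * ‖u‖ ≤ 1 →
      |g (b + s • u) - g b - s * inner ℝ (D b) u| ≤ (2 * K * ‖u‖^2) * s^2 := by
    intro b u s hs0 hsu
    have n1 : ‖s • u‖ = s * ‖u‖ := by rw [norm_smul, Real.norm_of_nonneg hs0.le]
    have h1 := htay b (s • u) (by rw [n1]; exact hsu)
    have h2 := hhess b (s • u)
    rw [n1] at h1 h2
    rw [inner_smul_right] at h1
    have h3 : (s * ‖u‖)^3 ≤ (s * ‖u‖)^2 := by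
      have : 0 ≤ s * ‖u‖ := by positivity
      calc (s * ‖u‖)^3 = (s * ‖u‖)^2 * (s * ‖u‖) := by ring
        _ ≤ (s * ‖u‖)^2 * 1 := by gcongr
        _ = _ := by ring
    have h4 : K * (s * ‖u‖)^3 ≤ K * (s * ‖u‖)^2 := by gcongr
    have h5 : 0 ≤ K * (s * ‖u‖)^2 := by positivity
    have h6 : 2 * K * ‖u‖^2 * s^2 = 2 * (K * (s * ‖u‖)^2) := by ring
    rw [h6]
    rw [abs_le] at *
    constructor <;> linarith [h1.1, h1.2, h2.1, h2.2]
  refine ⟨g, D, B, hclose, hlip, ?_, hhess, htay, ?_⟩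
  · intro b
    rcases eq_or_ne (D b) 0 with h0 | h0
    · rw [h0]; simp
    have hp : 0 < ‖D b‖ := norm_pos_iff.2 h0
    set d := ‖D b‖ with hd
    have : d ^ 2 ≤ d := by
      apply le_of_small (c := (2 * K * d^2) * (1 / (1 + d))) (by positivity)
      intro s hs0 hs1
      have hsd : 0 < s / (1 + d) := by positivity
      have := hfirst b (D b) (s / (1 + d)) hsd (by
        rw [div_mul_eq_mul_div, div_le_one (by positivity)]; nlinarith)
      have h2 := hlip (b + (s / (1+d)) • D b) b
      rw [add_sub_cancel_left, norm_smul, Real.norm_of_nonneg hsd.le] at h2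
      rw [real_inner_self_eq_norm_sq] at this
      have h7 : (s / (1+d)) * d^2 ≤ (s / (1+d)) * d + 2 * K * d^2 * (s / (1+d))^2 := by
        rw [abs_le] at *
        linarith [this.1, h2.2]
      have h8 : d^2 ≤ d + 2 * K * d^2 * (s / (1+d)) := by
        have : (s / (1+d)) * d^2 ≤ (s / (1+d)) * (d + 2 * K * d^2 * (s / (1+d))) := by
          calc _ ≤ _ := h7
            _ = _ := by ring
        exact le_of_mul_le_mul_left this hsd
      calc _ ≤ _ := h8
        _ = _ := by ring
    nlinarith
  · intro hhom b
    apply le_of_small (c := (2 * K * ‖b‖^2) * (1 / (1 + ‖b‖))) (by positivity)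
    intro s hs0 hs1
    set t := s / (1 + ‖b‖) with ht
    have ht0 : 0 < t := by positivity
    have h1 := hfirst b b t ht0 (by
        rw [ht, div_mul_eq_mul_div, div_le_one (by positivity)]; nlinarith [norm_nonneg b])
    have h2 : |g (b + t • b) - (1 + t) * g b| ≤ t * η := by
      have : g (b + t • b) - (1 + t) * g b = ∫ y, (f (b + t • b - y) - (1+t) * f (b - y)) * φ y := by
        simp only [sub_mul, hg]
        have i3 : MeasureTheory.Integrable (fun y => (1 + t) * f (b - y) * φ y) := by
          simpa [mul_assoc] using (ii b).const_mul (1+t)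
        rw [MeasureTheory.integral_sub (ii _) i3, ← MeasureTheory.integral_const_mul]
        simp only [mul_assoc]
      rw [this]
      apply key
      intro y hy
      rw [← hhom (1 + t) (b - y) (by positivity)]
      refine (hfl _ _).trans ?_
      have e : b + t • b - y - (1 + t) • (b - y) = t • y := by module
      rw [e, norm_smul, Real.norm_of_nonneg ht0.le]
      gcongr
      linarith
    have h3 : t * |inner ℝ (D b) b - g b| ≤ t * (η + 2 * K * ‖b‖^2 * t) := by
      rw [← abs_of_pos ht0, ← abs_mul, abs_of_pos ht0]
      have e : t * (inner ℝ (D b) b - g b) = (g (b + t • b) - (1 + t) * g b) - (g (b + t • b) - g b - t * inner ℝ (D b) b) := by ring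
      rw [e]
      refine (abs_sub _ _).trans ?_
      nlinarith
    have := le_of_mul_le_mul_left h3 ht0
    calc _ ≤ _ := this
      _ = _ := by rw [ht]; ring

/-- sign of a boolean -/
def sg (b : Bool) : ℝ := if b then 1 else -1

lemma sg_sq (b : Bool) : sg b * sg b = 1 := by cases b <;> simp [sg]
lemma sg_not (b : Bool) : sg (!b) = - sg b := by cases b <;> simp [sg]
lemma abs_sg (b : Bool) : |sg b| = 1 := by cases b <;> simp [sg]

/-- flip a coordinate -/
def flp {A : Type*} [DecidableEq A] (a : A) : (A → Bool) ≃ (A → Bool) where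
  toFun ω := Function.update ω a (!(ω a))
  invFun ω := Function.update ω a (!(ω a))
  left_inv ω := by ext b; by_cases h : b = a <;> simp [Function.update, h]
  right_inv ω := by ext b; by_cases h : b = a <;> simp [Function.update, h]

lemma flp_same {A : Type*} [DecidableEq A] (a : A) (ω : A → Bool) : flp a ω a = !(ω a) := by simp [flp]
lemma flp_ne {A : Type*} [DecidableEq A] {a b : A} (h : b ≠ a) (ω : A → Bool) : flp a ω b = ω b := by
  simp [flp, h]
lemma flp_flp {A : Type*} [DecidableEq A] (a : A) (ω : A → Bool) : flp a (flp a ω) = ω := 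
  (flp a).left_inv ω

lemma expect_flp {A : Type*} [Fintype A] [DecidableEq A] (a : A) (f : (A → Bool) → ℝ) :
    𝔼 ω, f (flp a ω) = 𝔼 ω, f ω :=
  Fintype.expect_equiv (flp a) _ _ (fun _ => rfl)

lemma expect_anti {A : Type*} [Fintype A] [DecidableEq A] (a : A) (f : (A → Bool) → ℝ)
    (h : ∀ ω, f (flp a ω) = - f ω) : 𝔼 ω, f ω = 0 := by
  have h1 := expect_flp a f
  simp_rw [h] at h1
  rw [Finset.expect_neg_distrib] at h1
  linarith

lemma expect_sg {A : Type*} [Fintype A] [DecidableEq A] (a : A) : 𝔼 ω : A → Bool, sg (ω a) = 0 :=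
  expect_anti a _ fun ω => by rw [flp_same, sg_not]

lemma expect_sg_sg {A : Type*} [Fintype A] [DecidableEq A] (a b : A) :
    𝔼 ω : A → Bool, sg (ω a) * sg (ω b) = if a = b then 1 else 0 := by
  split_ifs with h
  · subst h
    simp_rw [sg_sq]
    exact Fintype.expect_const 1
  · refine expect_anti a _ fun ω => ?_
    rw [flp_same, sg_not, flp_ne (Ne.symm h)]; ring

lemma expect_lin {A : Type*} [Fintype A] [DecidableEq A] (c : A → ℝ) :
    𝔼 ω : A → Bool, ∑ a, c a * sg (ω a) = 0 := by
  rw [Finset.expect_sum_comm]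
  refine Finset.sum_eq_zero fun a _ => ?_
  rw [← Finset.mul_expect, expect_sg, mul_zero]

lemma expect_lin_mul {A : Type*} [Fintype A] [DecidableEq A] (c d : A → ℝ) :
    𝔼 ω : A → Bool, (∑ a, c a * sg (ω a)) * (∑ a, d a * sg (ω a)) = ∑ a, c a * d a := by
  simp_rw [Finset.sum_mul_sum]
  rw [Finset.expect_sum_comm]
  refine Finset.sum_congr rfl fun a _ => ?_
  rw [Finset.expect_sum_comm]
  have : ∀ b, 𝔼 ω : A → Bool, c a * sg (ω a) * (d b * sg (ω b)) = if a = b then c a * d b else 0 := by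
    intro b
    have e : ∀ ω : A → Bool, c a * sg (ω a) * (d b * sg (ω b)) = (c a * d b) * (sg (ω a) * sg (ω b)) :=
      fun ω => by ring
    simp_rw [e]
    rw [← Finset.mul_expect, expect_sg_sg]
    simp
  simp_rw [this]
  simp

/-- averaging operator of a random step -/
noncomputable def stp {I W : Type*} [Fintype I] [AddCommMonoid W] (U : I → W) (f : W → ℝ) : W → ℝ :=
  fun w => 𝔼 i, f (w + U i)

lemma stp_iter {I W : Type*} [Fintype I] [AddCommMonoid W] (U : I → W) (N : ℕ) (f : W → ℝ) (w : W) :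
    (stp U)^[N] f w = 𝔼 ω : Fin N → I, f (w + ∑ j, U (ω j)) := by
  induction N generalizing w with
  | zero => simp
  | succ N ih =>
    rw [Function.iterate_succ_apply']
    unfold stp
    change 𝔼 i, (stp U)^[N] f (w + U i) = _
    simp_rw [ih]
    have := Finset.expect_product (Finset.univ : Finset I) (Finset.univ : Finset (Fin N → I))
      (fun p => f (w + U p.1 + ∑ j, U (p.2 j)))
    rw [← this]
    rw [Finset.univ_product_univ]
    refine Fintype.expect_equiv (Fin.consEquiv (fun _ => I)) _ _ (fun p => ?_)
    simp [Fin.sum_univ_succ, add_assoc]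

lemma stp_comm {I J W : Type*} [Fintype I] [Fintype J] [AddCommMonoid W] (U : I → W) (V : J → W) :
    Function.Commute (stp U) (stp V) := by
  intro f
  funext w
  unfold stp
  rw [Finset.expect_comm]
  refine Finset.expect_congr rfl fun j _ => Finset.expect_congr rfl fun i _ => ?_
  rw [add_right_comm]

lemma stp_mono {I W : Type*} [Fintype I] [AddCommMonoid W] (U : I → W) {f g : W → ℝ}
    (h : ∀ w, f w ≤ g w) (w : W) : stp U f w ≤ stp U g w :=
  Finset.expect_le_expect fun i _ => h _

lemma stp_iter_mono {I W : Type*} [Fintype I] [AddCommMonoid W] (U : I → W) (N : ℕ) {f g : W → ℝ}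
    (h : ∀ w, f w ≤ g w) (w : W) : (stp U)^[N] f w ≤ (stp U)^[N] g w := by
  rw [stp_iter, stp_iter]
  exact Finset.expect_le_expect fun i _ => h _

lemma stp_compare {I J W : Type*} [Fintype I] [Nonempty I] [Fintype J] [Nonempty J]
    [AddCommMonoid W] (U : I → W) (V : J → W)
    (f : W → ℝ) (c : ℝ) (h : ∀ w, stp V f w - c ≤ stp U f w) (N : ℕ) (w : W) :
    (stp V)^[N] f w - N * c ≤ (stp U)^[N] f w := by
  induction N generalizing w with
  | zero => simp
  | succ N ih =>
    have h1 : (stp U)^[N] (fun w => stp V f w - c) w ≤ (stp U)^[N+1] f w := by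
      rw [Function.iterate_succ_apply]
      exact stp_iter_mono U N h w
    have h2 : (stp U)^[N] (fun w => stp V f w - c) w = (stp U)^[N] (stp V f) w - c := by
      rw [stp_iter, stp_iter, Finset.expect_sub_distrib, Fintype.expect_const]
    have h3 : (stp U)^[N] (stp V f) = stp V ((stp U)^[N] f) :=
      ((stp_comm U V).iterate_left N) f
    have h4 : stp V (fun w => (stp V)^[N] f w - N * c) w ≤ stp V ((stp U)^[N] f) w :=
      stp_mono V ih w
    have h5 : stp V (fun w => (stp V)^[N] f w - N * c) w = (stp V)^[N+1] f w - N * c := by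
      rw [Function.iterate_succ_apply']
      unfold stp
      rw [Finset.expect_sub_distrib, Fintype.expect_const]
    push_cast
    rw [h2, h3] at h1
    rw [h5] at h4
    linarith

lemma exp_bd3 (x δ : ℝ) (h : |x| ≤ δ) (hδ : δ ≤ 1) : |exp (-x) - (1 - x + x^2/2)| ≤ δ^3 := by
  have := Real.exp_bound (x := -x) (by rw [abs_neg]; linarith) (n := 3) (by norm_num)
  rw [abs_neg] at this
  simp [Finset.sum_range_succ, Nat.factorial] at this
  have e : 1 + -x + x^2/2 = 1 - x + x^2/2 := by ring
  rw [e] at this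
  have h3 : |x|^3 ≤ δ^3 := by gcongr
  have h0 : 0 ≤ |x|^3 := by positivity
  norm_num at this
  linarith

set_option maxHeartbeats 400000 in
lemma lse_expand {ι : Type*} [Fintype ι] (w : ι → ℝ) (hw0 : ∀ k, 0 ≤ w k) (hw1 : ∑ k, w k = 1)
    (x : ι → ℝ) (δ : ℝ) (hδ : δ ≤ 1/4) (hx : ∀ k, |x k| ≤ δ) (hδ0 : 0 ≤ δ) :
    |log (∑ k, w k * exp (-(x k))) + ∑ k, w k * x k
      - (1/2) * (∑ k, w k * x k^2 - (∑ k, w k * x k)^2)| ≤ 10 * δ^3 := by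
  have avg : ∀ (f : ι → ℝ) (c : ℝ), (∀ k, |f k| ≤ c) → |∑ k, w k * f k| ≤ c := by
    intro f c h
    calc _ ≤ ∑ k, |w k * f k| := Finset.abs_sum_le_sum_abs _ _
      _ ≤ ∑ k, w k * c := Finset.sum_le_sum fun k _ => by
          rw [abs_mul, abs_of_nonneg (hw0 k)]; exact mul_le_mul_of_nonneg_left (h k) (hw0 k)
      _ = c := by rw [← Finset.sum_mul, hw1, one_mul]
  set μ := ∑ k, w k * x k with hμ
  set q := ∑ k, w k * x k^2 with hq
  set R := ∑ k, w k * (exp (-(x k)) - (1 - x k + x k^2/2)) with hR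
  have bμ : |μ| ≤ δ := avg _ _ hx
  have bq : |q| ≤ δ^2 := avg _ _ fun k => by
    rw [abs_pow]; gcongr; exact hx k
  have bR : |R| ≤ δ^3 := avg _ _ fun k => exp_bd3 _ _ (hx k) (by linarith)
  have hS : ∑ k, w k * exp (-(x k)) = 1 + (-μ + q/2 + R) := by
    rw [hR]
    simp only [mul_sub, mul_add, Finset.sum_sub_distrib, Finset.sum_add_distrib, mul_one, hw1]
    have : ∑ k, w k * (x k^2/2) = q/2 := by rw [hq, Finset.sum_div]; simp only [mul_div_assoc]
    rw [this]; ring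
  set S := -μ + q/2 + R with hSd
  have hd3 : δ^3 ≤ δ^2/4 := by nlinarith [sq_nonneg δ]
  have hd2 : δ^2 ≤ δ/4 := by nlinarith
  have hd30 : 0 ≤ δ^3 := by positivity
  rw [abs_le] at bμ bq bR
  have bS : |S| ≤ 1.2 * δ := by
    rw [abs_le]; constructor <;> linarith [bμ.1, bμ.2, bq.1, bq.2, bR.1, bR.2]
  have hlog := Real.abs_log_sub_add_sum_range_le (x := -S) (by rw [abs_neg]; linarith) 2
  simp [Finset.sum_range_succ] at hlog
  norm_num at hlog
  have b3 : |S|^3 / (1 - |S|) ≤ 3 * δ^3 := by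
    rw [div_le_iff₀ (by linarith)]
    have : |S|^3 ≤ (1.2 * δ)^3 := by gcongr
    have e : (1.2 * δ)^3 = 1.728 * δ^3 := by ring
    rw [e] at this
    nlinarith
  rw [hS]
  have hT : |q/2 + R| ≤ 0.75 * δ^2 := by
    rw [abs_le]; constructor <;> linarith [bμ.1, bμ.2, bq.1, bq.2, bR.1, bR.2]
  have hT2 : |(q/2+R) * ((q/2+R) - 2 * μ)| ≤ 0.75 * δ^2 * (2.25 * δ) := by
    rw [abs_mul]
    apply mul_le_mul hT _ (abs_nonneg _) (by positivity)
    rw [abs_le] at hT ⊢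
    constructor <;> linarith [bμ.1, bμ.2, hT.1, hT.2]
  have e2 : S^2 = μ^2 + (q/2+R) * ((q/2+R) - 2 * μ) := by rw [hSd]; ring
  have hl2 := hlog.trans b3
  have e3 : 0.75 * δ^2 * (2.25 * δ) = 1.6875 * δ^3 := by ring
  rw [e3] at hT2
  rw [abs_le] at hl2 hT2 ⊢
  constructor <;> nlinarith [hl2.1, hl2.2, hT2.1, hT2.2, bR.1, bR.2]

/-- soft minimum -/
noncomputable def smin {ι : Type*} [Fintype ι] (β : ℝ) (a : ι → ℝ) : ℝ :=
  -(1/β) * log (∑ k, exp (-(β * a k)))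

lemma smin_le {ι : Type*} [Fintype ι] {β : ℝ} (hβ : 0 < β) (a : ι → ℝ) (k : ι) : smin β a ≤ a k := by
  unfold smin
  have h1 : exp (-(β * a k)) ≤ ∑ k, exp (-(β * a k)) :=
    Finset.single_le_sum (f := fun k => exp (-(β * a k))) (fun _ _ => (exp_pos _).le) (Finset.mem_univ k)
  have h2 := Real.log_le_log (exp_pos _) h1
  rw [Real.log_exp] at h2
  have : (1/β) * (-(β * a k)) ≤ (1/β) * log (∑ k, exp (-(β * a k))) := by gcongr
  have e : (1/β) * (-(β * a k)) = - a k := by field_simp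
  linarith

lemma le_smin {ι : Type*} [Fintype ι] [Nonempty ι] {β : ℝ} (hβ : 0 < β) (a : ι → ℝ) (c : ℝ)
    (h : ∀ k, c ≤ a k) : c - log (Fintype.card ι) / β ≤ smin β a := by
  unfold smin
  have h1 : ∑ k, exp (-(β * a k)) ≤ Fintype.card ι * exp (-(β * c)) := by
    calc _ ≤ ∑ _k : ι, exp (-(β * c)) := Finset.sum_le_sum fun k _ => by
          apply Real.exp_le_exp.2; have := h k; nlinarith
      _ = _ := by simp
  have hp : 0 < ∑ k, exp (-(β * a k)) := Finset.sum_pos (fun _ _ => exp_pos _) Finset.univ_nonempty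
  have h2 := Real.log_le_log hp h1
  rw [Real.log_mul (by positivity) (by positivity), Real.log_exp] at h2
  have : (1/β) * log (∑ k, exp (-(β * a k))) ≤ (1/β) * (log (Fintype.card ι) + -(β * c)) := by gcongr
  have e : (1/β) * (log (Fintype.card ι) + -(β * c)) = log (Fintype.card ι) / β - c := by field_simp; ring
  linarith

/-- Gibbs weights -/
noncomputable def gw {ι : Type*} [Fintype ι] (β : ℝ) (a : ι → ℝ) (k : ι) : ℝ :=
  exp (-(β * a k)) / ∑ k, exp (-(β * a k))

lemma gw_nonneg {ι : Type*} [Fintype ι] (β : ℝ) (a : ι → ℝ) (k : ι) : 0 ≤ gw β a k :=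
  div_nonneg (exp_pos _).le (Finset.sum_nonneg fun _ _ => (exp_pos _).le)

lemma gw_sum {ι : Type*} [Fintype ι] [Nonempty ι] (β : ℝ) (a : ι → ℝ) : ∑ k, gw β a k = 1 := by
  unfold gw
  rw [← Finset.sum_div]
  exact div_self (Finset.sum_pos (fun _ _ => exp_pos _) Finset.univ_nonempty).ne'

lemma smin_sub {ι : Type*} [Fintype ι] [Nonempty ι] (β : ℝ) (a d : ι → ℝ) :
    smin β (fun k => a k + d k) - smin β a = -(1/β) * log (∑ k, gw β a k * exp (-(β * d k))) := by
  have hp : 0 < ∑ k, exp (-(β * a k)) := Finset.sum_pos (fun _ _ => exp_pos _) Finset.univ_nonempty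
  have hp2 : 0 < ∑ k, exp (-(β * (a k + d k))) := Finset.sum_pos (fun _ _ => exp_pos _) Finset.univ_nonempty
  have : ∑ k, gw β a k * exp (-(β * d k)) = (∑ k, exp (-(β * (a k + d k)))) / ∑ k, exp (-(β * a k)) := by
    rw [Finset.sum_div]
    refine Finset.sum_congr rfl fun k _ => ?_
    unfold gw
    rw [div_mul_eq_mul_div, ← Real.exp_add]
    congr 2; ring
  rw [this, Real.log_div hp2.ne' hp.ne']
  unfold smin
  ring

lemma var_pair {ι : Type*} [Fintype ι] (w : ι → ℝ) (hw1 : ∑ k, w k = 1) (l : ι → ℝ) :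
    ∑ k, w k * l k^2 - (∑ k, w k * l k)^2 = (1/2) * ∑ k, ∑ k', w k * w k' * (l k - l k')^2 := by
  have e : ∀ k k', w k * w k' * (l k - l k')^2 = (w k * l k^2) * w k' + w k * (w k' * l k'^2) 
      - 2 * ((w k * l k) * (w k' * l k')) := fun k k' => by ring
  simp only [e, Finset.sum_sub_distrib, Finset.sum_add_distrib, ← Finset.mul_sum, ← Finset.sum_mul, hw1]
  ring

lemma smin_expand {ι : Type*} [Fintype ι] [Nonempty ι] {β : ℝ} (hβ : 0 < β) (a d : ι → ℝ) (δ : ℝ)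
    (hδ0 : 0 ≤ δ) (hδ : β * δ ≤ 1/4) (hd : ∀ k, |d k| ≤ δ) :
    |smin β (fun k => a k + d k) - smin β a - (∑ k, gw β a k * d k
      - (β/2) * (∑ k, gw β a k * d k^2 - (∑ k, gw β a k * d k)^2))| ≤ 10 * β^2 * δ^3 := by
  have h := lse_expand (gw β a) (gw_nonneg β a) (gw_sum β a) (fun k => β * d k) (β * δ) hδ
    (fun k => by rw [abs_mul, abs_of_pos hβ]; gcongr; exact hd k) (by positivity)
  have e1 : ∑ k, gw β a k * (β * d k) = β * ∑ k, gw β a k * d k := by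
    rw [Finset.mul_sum]; exact Finset.sum_congr rfl fun k _ => by ring
  have e2 : ∑ k, gw β a k * (β * d k)^2 = β^2 * ∑ k, gw β a k * d k^2 := by
    rw [Finset.mul_sum]; exact Finset.sum_congr rfl fun k _ => by ring
  rw [e1, e2] at h
  rw [smin_sub]
  set L := log (∑ k, gw β a k * exp (-(β * d k)))
  set P := ∑ k, gw β a k * d k
  set Q := ∑ k, gw β a k * d k^2
  have e3 : -(1/β) * L - (P - (β/2) * (Q - P^2)) = -(1/β) * (L + β * P - (1/2) * (β^2 * Q - (β*P)^2)) := by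
    field_simp; ring
  rw [e3, abs_mul, abs_neg, abs_of_pos (by positivity : 0 < 1/β)]
  calc _ ≤ (1/β) * (10 * (β * δ)^3) := by gcongr
    _ = _ := by field_simp

set_option maxHeartbeats 1000000 in
lemma one_step {m : ℕ} {ι : Type*} [Fintype ι] [Nonempty ι] {K η : ℝ} {f g : Eu m → ℝ} {D B}
    (hM : IsMoll K η f g D B) (hK : 0 ≤ K) {β R τ : ℝ} (hβ : 0 < β) (hR : 0 ≤ R) (hτ : 0 ≤ τ) 
    (h1 : τ * R ≤ 1) (h2 : β * (2 * (τ * R)) ≤ 1/4)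
    (b : ι → Eu m) (s : ι → ℝ) (u : ι → Eu m) (σ : ι → ℝ) (hu : ∀ k, ‖u k‖ ≤ R) (hσ : ∀ k, |σ k| ≤ R) :
    let w := gw β (fun k => g (b k) + s k)
    |smin β (fun k => g (b k + τ • u k) + (s k + τ * σ k)) - smin β (fun k => g (b k) + s k)
      - (τ * ∑ k, w k * (inner ℝ (D (b k)) (u k) + σ k) + (τ^2/2) * ∑ k, w k * qf (B (b k)) (u k)
        - (β/4) * τ^2 * ∑ k, ∑ k', w k * w k' * 
          ((inner ℝ (D (b k)) (u k) + σ k) - (inner ℝ (D (b k')) (u k') + σ k'))^2)| 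
     ≤ (80 * β^2 + K + 8 * β * K) * R^3 * τ^3 := by
  intro w
  set l : ι → ℝ := fun k => inner ℝ (D (b k)) (u k) + σ k with hl
  set d : ι → ℝ := fun k => g (b k + τ • u k) - g (b k) + τ * σ k with hd
  have hw0 : ∀ k, 0 ≤ w k := gw_nonneg _ _
  have hw1 : ∑ k, w k = 1 := gw_sum _ _
  have avg : ∀ (f : ι → ℝ) (c : ℝ), (∀ k, |f k| ≤ c) → |∑ k, w k * f k| ≤ c := by
    intro f c h
    calc _ ≤ ∑ k, |w k * f k| := Finset.abs_sum_le_sum_abs _ _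
      _ ≤ ∑ k, w k * c := Finset.sum_le_sum fun k _ => by
          rw [abs_mul, abs_of_nonneg (hw0 k)]; exact mul_le_mul_of_nonneg_left (h k) (hw0 k)
      _ = c := by rw [← Finset.sum_mul, hw1, one_mul]
  have hτR : 0 ≤ τ * R := by positivity
  have nu : ∀ k, ‖τ • u k‖ ≤ τ * R := fun k => by
    rw [norm_smul, Real.norm_of_nonneg hτ]; gcongr; exact hu k
  have hdb : ∀ k, |d k| ≤ 2 * (τ * R) := by
    intro k
    have a1 := hM.lip (b k + τ • u k) (b k)
    rw [add_sub_cancel_left] at a1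
    have a2 : |τ * σ k| ≤ τ * R := by rw [abs_mul, abs_of_nonneg hτ]; gcongr; exact hσ k
    have a3 := abs_add_le (g (b k + τ • u k) - g (b k)) (τ * σ k)
    simp only [hd]
    linarith [nu k]
  have hlb : ∀ k, |τ * l k| ≤ 2 * (τ * R) := by
    intro k
    have a1 : |inner ℝ (D (b k)) (u k)| ≤ R := by
      refine (abs_real_inner_le_norm _ _).trans ?_
      nlinarith [hM.grad (b k), hu k, norm_nonneg (u k), norm_nonneg (D (b k))]
    have a2 : |l k| ≤ 2 * R := (abs_add_le _ _).trans (by linarith [hσ k])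
    rw [abs_mul, abs_of_nonneg hτ]
    nlinarith
  have ht : ∀ k, |d k - (τ * l k + (τ^2/2) * qf (B (b k)) (u k))| ≤ K * (τ * R)^3 := by
    intro k
    have a1 := hM.tay (b k) (τ • u k) ((nu k).trans h1)
    have hqs : qf (B (b k)) (τ • u k) = τ^2 * qf (B (b k)) (u k) := by
      simp only [qf, Finset.mul_sum]
      refine Finset.sum_congr rfl fun i _ => Finset.sum_congr rfl fun j _ => ?_
      simp; ring
    rw [hqs, inner_smul_right] at a1
    have a2 : K * ‖τ • u k‖^3 ≤ K * (τ * R)^3 := by gcongr; exact nu k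
    refine le_trans (le_of_eq ?_) (a1.trans a2)
    congr 1
    simp only [hd, hl]; ring
  have hq : ∀ k, |(τ^2/2) * qf (B (b k)) (u k)| ≤ K * (τ * R)^2 / 2 := by
    intro k
    rw [abs_mul, abs_of_nonneg (by positivity)]
    have a1 := hM.hess (b k) (u k)
    have a2 : ‖u k‖^2 ≤ R^2 := by gcongr; exact hu k
    calc _ ≤ (τ^2/2) * (K * R^2) := by gcongr; exact a1.trans (by gcongr)
      _ = _ := by ring
  have hdl : ∀ k, |d k - τ * l k| ≤ 2 * K * (τ * R)^2 := by
    intro k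
    have a1 := ht k
    have a2 := hq k
    have a3 : K * (τ * R)^3 ≤ K * (τ*R)^2 := by
      have : (τ * R)^3 ≤ (τ * R)^2 := pow_le_pow_of_le_one hτR h1 (by norm_num)
      gcongr
    have a4 : 0 ≤ K * (τ*R)^2 := by positivity
    rw [abs_le] at *
    constructor <;> linarith [a1.1, a1.2, a2.1, a2.2]
  have main := smin_expand hβ (fun k => g (b k) + s k) d (2 * (τ * R)) (by positivity) h2 hdb
  have e0 : (fun k => g (b k + τ • u k) + (s k + τ * σ k)) = fun k => g (b k) + s k + d k := by
    ext k; simp only [hd]; ring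
  rw [e0]
  have hlk : ∀ k, inner ℝ (D (b k)) (u k) + σ k = l k := fun _ => rfl
  simp only [hlk]
  have vp := var_pair w hw1 (fun k => τ * l k)
  have e1 : ∑ k, ∑ k', w k * w k' * (τ * l k - τ * l k')^2 = τ^2 * ∑ k, ∑ k', w k * w k' * (l k - l k')^2 := by
    simp only [Finset.mul_sum]
    refine Finset.sum_congr rfl fun i _ => Finset.sum_congr rfl fun j _ => ?_
    ring
  rw [e1] at vp
  have c1 : |∑ k, w k * d k - (τ * ∑ k, w k * l k + (τ^2/2) * ∑ k, w k * qf (B (b k)) (u k))| ≤ K * (τ*R)^3 := by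
    have := avg _ _ ht
    refine le_trans (le_of_eq ?_) this
    congr 1
    simp only [mul_sub, mul_add, Finset.sum_sub_distrib, Finset.sum_add_distrib, Finset.mul_sum]
    congr 2
    · exact Finset.sum_congr rfl fun k _ => by ring
    · exact Finset.sum_congr rfl fun k _ => by ring
  have c2 : |∑ k, w k * d k^2 - ∑ k, w k * (τ * l k)^2| ≤ 8 * K * (τ*R)^3 := by
    rw [← Finset.sum_sub_distrib]
    simp only [← mul_sub]
    apply avg
    intro k
    have : d k^2 - (τ * l k)^2 = (d k - τ * l k) * (d k + τ * l k) := by ring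
    rw [this, abs_mul]
    calc _ ≤ (2 * K * (τ * R)^2) * (4 * (τ*R)) := by
          apply mul_le_mul (hdl k) _ (abs_nonneg _) (by positivity)
          exact (abs_add_le _ _).trans (by linarith [hdb k, hlb k])
      _ = _ := by ring
  have c3 : |(∑ k, w k * d k)^2 - (∑ k, w k * (τ * l k))^2| ≤ 8 * K * (τ*R)^3 := by
    have : (∑ k, w k * d k)^2 - (∑ k, w k * (τ * l k))^2 = 
      (∑ k, w k * (d k - τ * l k)) * (∑ k, w k * (d k + τ * l k)) := by
      simp only [mul_sub, mul_add, Finset.sum_sub_distrib, Finset.sum_add_distrib]; ring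
    rw [this, abs_mul]
    calc _ ≤ (2 * K * (τ * R)^2) * (4 * (τ*R)) := by
          apply mul_le_mul (avg _ _ hdl) _ (abs_nonneg _) (by positivity)
          apply avg
          intro k
          exact (abs_add_le _ _).trans (by linarith [hdb k, hlb k])
      _ = _ := by ring
  clear_value l d
  have hw' : gw β (fun k => g (b k) + s k) = w := rfl
  rw [hw'] at main
  set A1 := ∑ k, w k * d k
  set A2 := ∑ k, w k * d k^2
  set A3 := ∑ k, w k * (τ * l k)^2
  set A4 := ∑ k, w k * (τ * l k)
  set A5 := ∑ k, ∑ k', w k * w k' * (l k - l k')^2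
  have c4 : |(β/2) * ((A2 - A1^2) - (A3 - A4^2))| ≤ 8 * β * K * (τ*R)^3 := by
    rw [abs_mul, abs_of_pos (by positivity)]
    have : |(A2 - A1^2) - (A3 - A4^2)| ≤ 16 * K * (τ*R)^3 := by
      rw [abs_le] at *
      constructor <;> linarith [c2.1, c2.2, c3.1, c3.2]
    calc _ ≤ (β/2) * (16 * K * (τ*R)^3) := by gcongr
      _ = _ := by ring
  rw [vp] at c4
  have e5 : (80 * β^2 + K + 8 * β * K) * R^3 * τ^3 = 10 * β^2 * (2 * (τ * R))^3 + K * (τ*R)^3 + 8 * β * K * (τ*R)^3 := by ring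
  rw [e5]
  rw [abs_le] at *
  constructor <;> linarith [c1.1, c1.2, c4.1, c4.2, main.1, main.2]

/-- sign matrix times vector -/
noncomputable def mv {m n : ℕ} (M : Fin m × Fin n → Bool) (x : Eu n) : Eu m :=
  WithLp.toLp 2 fun i => ∑ j, sg (M (i,j)) * x j

/-- sign vector -/
noncomputable def sv {m : ℕ} (ω : Fin m → Bool) : Eu m := WithLp.toLp 2 fun i => sg (ω i)

lemma eu_inner {m : ℕ} (x y : Eu m) : inner ℝ x y = ∑ i, x i * y i := by
  simp [PiLp.inner_apply, mul_comm]

lemma eu_norm_le {m : ℕ} (x : Eu m) (c : ℝ) (hc : 0 ≤ c) (h : ∀ i, |x i| ≤ c) : ‖x‖ ≤ (m + 1) * c := by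
  have : ‖x‖^2 ≤ ((m + 1) * c)^2 := by
    rw [EuclideanSpace.real_norm_sq_eq]
    calc ∑ i, x i^2 ≤ ∑ _i : Fin m, c^2 := Finset.sum_le_sum fun i _ => by
          rw [← sq_abs]; have := h i; gcongr
      _ = m * c^2 := by simp
      _ ≤ _ := by 
        have : (0:ℝ) ≤ m := by positivity
        nlinarith [sq_nonneg c, mul_nonneg this (sq_nonneg c), mul_nonneg (mul_nonneg this this) (sq_nonneg c)]
  exact le_of_sq_le_sq this (by positivity)

lemma unit_coord {n : ℕ} (x : Eu n) (hx : ‖x‖ = 1) (j : Fin n) : |x j| ≤ 1 := by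
  have := PiLp.norm_apply_le x j
  rw [hx] at this; simpa using this

lemma unit_sum {n : ℕ} (x : Eu n) (hx : ‖x‖ = 1) (ω : Fin n → Bool) : |∑ j, sg (ω j) * x j| ≤ n := by
  calc _ ≤ ∑ j, |sg (ω j) * x j| := Finset.abs_sum_le_sum_abs _ _
    _ ≤ ∑ _j : Fin n, (1:ℝ) := Finset.sum_le_sum fun j _ => by
        rw [abs_mul, abs_sg, one_mul]; exact unit_coord x hx j
    _ = n := by simp

lemma avg_step {m : ℕ} {I ι : Type*} [Fintype I] [Nonempty I] [Fintype ι] [Nonempty ι] {K η : ℝ} {f g : Eu m → ℝ} {D B}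
    (hM : IsMoll K η f g D B) (hK : 0 ≤ K) {β R τ : ℝ} (hβ : 0 < β) (hR : 0 ≤ R) (hτ : 0 ≤ τ) 
    (h1 : τ * R ≤ 1) (h2 : β * (2 * (τ * R)) ≤ 1/4)
    (b : ι → Eu m) (s : ι → ℝ) (u : I → ι → Eu m) (σ : I → ι → ℝ) (hu : ∀ a k, ‖u a k‖ ≤ R) 
    (hσ : ∀ a k, |σ a k| ≤ R) (V : ι → ι → ℝ)
    (e1 : ∀ k, 𝔼 a, (inner ℝ (D (b k)) (u a k) + σ a k) = 0)
    (e2 : ∀ k, 𝔼 a, qf (B (b k)) (u a k) = ∑ i, B (b k) i i)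
    (e3 : ∀ k k', 𝔼 a, ((inner ℝ (D (b k)) (u a k) + σ a k) - (inner ℝ (D (b k')) (u a k') + σ a k'))^2 = V k k') :
    let w := gw β (fun k => g (b k) + s k)
    |(𝔼 a, smin β (fun k => g (b k + τ • u a k) + (s k + τ * σ a k))) - smin β (fun k => g (b k) + s k)
      - ((τ^2/2) * ∑ k, w k * ∑ i, B (b k) i i
        - (β/4) * τ^2 * ∑ k, ∑ k', w k * w k' * V k k')| 
     ≤ (80 * β^2 + K + 8 * β * K) * R^3 * τ^3 := by
  intro w
  have h := fun a => one_step hM hK hβ hR hτ h1 h2 b s (u a) (σ a) (hu a) (hσ a)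
  simp only at h
  change ∀ a, |_ - _ - (τ * ∑ k, w k * _ + (τ^2/2) * ∑ k, w k * _ - (β/4) * τ^2 * ∑ k, ∑ k', w k * w k' * _)| ≤ _ at h
  have hh := Finset.expect_le_expect (s := Finset.univ) fun a _ => h a
  rw [Fintype.expect_const] at hh
  refine le_trans (le_of_eq_of_le ?_ (Finset.abs_expect_le _ _)) hh
  congr 1
  simp only [Finset.expect_sub_distrib, Finset.expect_add_distrib, ← Finset.mul_expect, Finset.expect_sum_comm, 
    e1, e2, e3, Fintype.expect_const]
  simp

section
variable {m n : ℕ}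

lemma mv_inner (d : Eu m) (x : Eu n) (M : Fin m × Fin n → Bool) :
    inner ℝ d (mv M x) = ∑ a : Fin m × Fin n, (d a.1 * x a.2) * sg (M a) := by
  rw [eu_inner, Fintype.sum_prod_type]
  refine Finset.sum_congr rfl fun i _ => ?_
  simp only [mv, Finset.mul_sum]
  exact Finset.sum_congr rfl fun j _ => by ring

lemma sv_inner (d : Eu m) (x : Eu n) (ω : Fin m ⊕ Fin n → Bool) :
    inner ℝ d (sv (fun i => ω (.inl i))) + ∑ j, sg (ω (.inr j)) * x j 
      = ∑ a : Fin m ⊕ Fin n, Sum.elim (fun i => d i) (fun j => x j) a * sg (ω a) := by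
  rw [eu_inner, Fintype.sum_sum_type]
  congr 1
  exact Finset.sum_congr rfl fun j _ => by simp [mul_comm]

lemma expect_lin_sq {A : Type*} [Fintype A] [DecidableEq A] (c d : A → ℝ) :
    𝔼 ω : A → Bool, ((∑ a, c a * sg (ω a)) - (∑ a, d a * sg (ω a)))^2 = ∑ a, (c a - d a)^2 := by
  simp only [← Finset.sum_sub_distrib, ← sub_mul, sq]
  exact expect_lin_mul _ _

lemma expect_qf {A : Type*} [Fintype A] [DecidableEq A] (B : Fin m → Fin m → ℝ) (u : (A → Bool) → Eu m)
    (c : Fin m → A → ℝ) (hc : ∀ ω i, u ω i = ∑ a, c i a * sg (ω a)) 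
    (ho : ∀ i j, ∑ a, c i a * c j a = if i = j then 1 else 0) :
    𝔼 ω, qf B (u ω) = ∑ i, B i i := by
  simp only [qf, hc, Finset.expect_sum_comm, ← Finset.mul_expect, expect_lin_mul, ho]
  simp

lemma expect_qf_mv (B : Fin m → Fin m → ℝ) (x : Eu n) (hx : ‖x‖ = 1) :
    𝔼 M, qf B (mv M x) = ∑ i, B i i := by
  have hx2 : ∑ j, x j * x j = 1 := by
    rw [← eu_inner, real_inner_self_eq_norm_sq, hx]; norm_num
  apply expect_qf B _ (fun i a => if a.1 = i then x a.2 else 0)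
  · intro M i
    rw [Fintype.sum_prod_type]
    simp [mv, ite_mul, Finset.sum_ite_irrel, mul_comm]
  · intro i j
    rw [Fintype.sum_prod_type]
    by_cases h : i = j
    · subst h
      simp [ite_mul, Finset.sum_ite_irrel, hx2]
    · simp [ite_mul, Finset.sum_ite_irrel, h, Ne.symm h]

lemma expect_qf_sv (B : Fin m → Fin m → ℝ) :
    𝔼 ω : Fin m ⊕ Fin n → Bool, qf B (sv (fun i => ω (.inl i))) = ∑ i, B i i := by
  apply expect_qf B _ (fun i => Sum.elim (fun a => if a = i then 1 else 0) 0)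
  · intro M i
    rw [Fintype.sum_sum_type]
    simp [sv]
  · intro i j
    rw [Fintype.sum_sum_type]
    simp [eq_comm]

lemma var_cmp (d e : Eu m) (x y : Eu n) (hx : ‖x‖ = 1) (hy : ‖y‖ = 1) (hd : ‖d‖ ≤ 1) (he : ‖e‖ ≤ 1) :
    ∑ a : Fin m × Fin n, (d a.1 * x a.2 - e a.1 * y a.2)^2 ≤ 
    ∑ a : Fin m ⊕ Fin n, (Sum.elim (fun i => d i) (fun j => x j) a - Sum.elim (fun i => e i) (fun j => y j) a)^2 := by
  have e1 : ∑ a : Fin m × Fin n, (d a.1 * x a.2 - e a.1 * y a.2)^2 = 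
      inner ℝ d d * inner ℝ x x + inner ℝ e e * inner ℝ y y - 2 * (inner ℝ d e * inner ℝ x y) := by
    simp only [eu_inner]
    rw [Finset.sum_mul_sum, Finset.sum_mul_sum, Finset.sum_mul_sum]
    simp only [Finset.mul_sum, Fintype.sum_prod_type, ← Finset.sum_add_distrib, ← Finset.sum_sub_distrib]
    exact Finset.sum_congr rfl fun i _ => Finset.sum_congr rfl fun j _ => by ring
  have e2 : ∑ a : Fin m ⊕ Fin n, (Sum.elim (fun i => d i) (fun j => x j) a - Sum.elim (fun i => e i) (fun j => y j) a)^2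
     = (inner ℝ d d + inner ℝ e e - 2 * inner ℝ d e) + (inner ℝ x x + inner ℝ y y - 2 * inner ℝ x y) := by
    simp only [eu_inner, Fintype.sum_sum_type, Sum.elim_inl, Sum.elim_inr, Finset.mul_sum, ← Finset.sum_add_distrib, ← Finset.sum_sub_distrib]
    congr 1 <;> exact Finset.sum_congr rfl fun i _ => by ring
  rw [e1, e2, real_inner_self_eq_norm_sq x, real_inner_self_eq_norm_sq y, hx, hy]
  have h1 : inner ℝ d e ≤ 1 := (real_inner_le_norm d e).trans (by nlinarith [norm_nonneg d, norm_nonneg e])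
  have h2 : inner ℝ x y ≤ 1 := (real_inner_le_norm x y).trans (by rw [hx, hy]; norm_num)
  nlinarith [mul_nonneg (sub_nonneg.2 h1) (sub_nonneg.2 h2)]

lemma step_cmp {ι : Type*} [Fintype ι] [Nonempty ι] {K η : ℝ} {f g : Eu m → ℝ} {D B}
    (hM : IsMoll K η f g D B) (hK : 0 ≤ K) {β R τ : ℝ} (hβ : 0 < β) (hR : R = (m+1)*(n+1)) (hτ : 0 ≤ τ) 
    (h1 : τ * R ≤ 1) (h2 : β * (2 * (τ * R)) ≤ 1/4) (x : ι → Eu n) (hx : ∀ k, ‖x k‖ = 1)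
    (b : ι → Eu m) (s : ι → ℝ) :
    (𝔼 ω : Fin m ⊕ Fin n → Bool, smin β (fun k => g (b k + τ • sv (fun i => ω (.inl i))) 
        + (s k + τ * ∑ j, sg (ω (.inr j)) * x k j))) - 2 * ((80 * β^2 + K + 8 * β * K) * R^3) * τ^3
    ≤ 𝔼 M : Fin m × Fin n → Bool, smin β (fun k => g (b k + τ • mv M (x k)) + s k) := by
  have hR0 : 0 ≤ R := by rw [hR]; positivity
  have hnR : (n:ℝ) ≤ R := by rw [hR]; nlinarith [Nat.cast_nonneg (α := ℝ) m, Nat.cast_nonneg (α := ℝ) n, mul_nonneg (Nat.cast_nonneg (α := ℝ) m) (Nat.cast_nonneg (α := ℝ) n)]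
  have hX := avg_step hM hK hβ hR0 hτ h1 h2 b s (fun M k => mv M (x k)) (fun (_ : Fin m × Fin n → Bool) _ => 0)
    (fun M k => by
      rw [hR]; apply eu_norm_le _ _ (by positivity)
      intro i
      exact (unit_sum (x k) (hx k) (fun j => M (i,j))).trans (by simp))
    (fun M k => by simpa using hR0) (fun k k' => ∑ a : Fin m × Fin n, (D (b k) a.1 * x k a.2 - D (b k') a.1 * x k' a.2)^2)
    (fun k => by simp only [add_zero, mv_inner]; exact expect_lin _)
    (fun k => expect_qf_mv _ _ (hx k))
    (fun k k' => by simp only [add_zero, mv_inner]; exact expect_lin_sq _ _)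
  have hY := avg_step hM hK hβ hR0 hτ h1 h2 b s (fun (ω : Fin m ⊕ Fin n → Bool) k => sv (fun i => ω (.inl i))) 
    (fun ω k => ∑ j, sg (ω (.inr j)) * x k j)
    (fun M k => by
      rw [hR]; apply eu_norm_le _ _ (by positivity)
      intro i
      simp [sv, abs_sg])
    (fun ω k => (unit_sum (x k) (hx k) _).trans hnR) (fun k k' => ∑ a : Fin m ⊕ Fin n, (Sum.elim (fun i => D (b k) i) (fun j => x k j) a - Sum.elim (fun i => D (b k') i) (fun j => x k' j) a)^2)
    (fun k => by simp only [sv_inner]; exact expect_lin _)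
    (fun k => expect_qf_sv _)
    (fun k k' => by simp only [sv_inner]; exact expect_lin_sq _ _)
  simp only [mul_zero, add_zero] at hX hY
  have hc : ∀ w : ι → ℝ, (∀ k, 0 ≤ w k) → 
     ∑ k, ∑ k', w k * w k' * ∑ a : Fin m × Fin n, (D (b k) a.1 * x k a.2 - D (b k') a.1 * x k' a.2)^2 ≤ 
     ∑ k, ∑ k', w k * w k' * ∑ a : Fin m ⊕ Fin n, (Sum.elim (fun i => D (b k) i) (fun j => x k j) a - Sum.elim (fun i => D (b k') i) (fun j => x k' j) a)^2 := by
    intro w hw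
    refine Finset.sum_le_sum fun k _ => Finset.sum_le_sum fun k' _ => ?_
    exact mul_le_mul_of_nonneg_left (var_cmp _ _ _ _ (hx k) (hx k') (hM.grad _) (hM.grad _)) (mul_nonneg (hw k) (hw k'))
  have hc' := mul_le_mul_of_nonneg_left (hc _ (gw_nonneg β (fun k => g (b k) + s k))) (by positivity : 0 ≤ (β/4) * τ^2)
  rw [abs_le] at hX hY
  linarith [hX.1, hX.2, hY.1, hY.2]
end

/-- normalized sign sum vector -/
noncomputable def hv {N m : ℕ} (ω : Fin N × Fin m → Bool) : Eu m :=
  WithLp.toLp 2 fun i => (1/√N) * ∑ j, sg (ω (j,i))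

/-- expectation of a function of the normalized sign sum vector -/
noncomputable def EN {m : ℕ} (N : ℕ) (f : Eu m → ℝ) : ℝ := 𝔼 ω : Fin N × Fin m → Bool, f (hv ω)

/-- the random matrix applied to a vector -/
noncomputable def Gv {N m n : ℕ} (ω : Fin N → Fin m × Fin n → Bool) (x : Eu n) : Eu m :=
  ∑ j, (1/√N) • mv (ω j) x

def splitEquiv (N m n : ℕ) : (Fin N → Fin m ⊕ Fin n → Bool) ≃ (Fin N × Fin m → Bool) × (Fin N × Fin n → Bool) where
  toFun ω := (fun a => ω a.1 (.inl a.2), fun a => ω a.1 (.inr a.2))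
  invFun p := fun j => Sum.elim (fun i => p.1 (j,i)) (fun i => p.2 (j,i))
  left_inv ω := by ext j a; cases a <;> rfl
  right_inv p := rfl

lemma expect_fst {N m n : ℕ} (f : (Fin N × Fin m → Bool) → ℝ) :
    𝔼 ω : Fin N → Fin m ⊕ Fin n → Bool, f (fun a => ω a.1 (.inl a.2)) = 𝔼 ω, f ω := by
  refine (Fintype.expect_equiv (splitEquiv N m n) _ (fun p => f p.1) (fun _ => rfl)).trans ?_
  rw [← Finset.univ_product_univ, Finset.expect_product]
  simp only [Fintype.expect_const]

lemma expect_snd {N m n : ℕ} (f : (Fin N × Fin n → Bool) → ℝ) :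
    𝔼 ω : Fin N → Fin m ⊕ Fin n → Bool, f (fun a => ω a.1 (.inr a.2)) = 𝔼 ω, f ω := by
  refine (Fintype.expect_equiv (splitEquiv N m n) _ (fun p => f p.2) (fun _ => rfl)).trans ?_
  rw [← Finset.univ_product_univ, Finset.expect_product]
  simp only [Fintype.expect_const]

lemma tend_inv_sqrt (c : ℝ) : Tendsto (fun N : ℕ => c * (1/√(N:ℝ))) atTop (nhds 0) := by
  have : Tendsto (fun N : ℕ => 1/√(N:ℝ)) atTop (nhds 0) := by
    simp only [one_div]
    exact tendsto_inv_atTop_zero.comp (tendsto_sqrt_atTop.comp tendsto_natCast_atTop_atTop)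
  simpa using this.const_mul c

lemma ev_inv_sqrt (c : ℝ) {d : ℝ} (hd : 0 < d) : ∀ᶠ N : ℕ in atTop, c * (1/√(N:ℝ)) ≤ d :=
  (tend_inv_sqrt c).eventually_le_const hd

lemma gordon {m n : ℕ} {ι : Type*} [Fintype ι] [Nonempty ι] (x : ι → Eu n) (hx : ∀ k, ‖x k‖ = 1)
    {κ : ℝ} (hκ : 0 < κ) : ∀ᶠ N : ℕ in atTop, ∀ Ψ : Eu m → ℝ, LipschitzWith 1 Ψ → 
      ∃ F : (Fin N → Fin m × Fin n → Bool) → ℝ, (∀ ω k, F ω ≤ Ψ (Gv ω (x k))) ∧ 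
        EN N Ψ - EN N (fun y : Eu n => ‖y‖) - κ ≤ 𝔼 ω, F ω := by
  obtain ⟨K, hK, hmoll⟩ := moll m (κ/8) (by positivity)
  set R : ℝ := (m+1)*(n+1) with hR
  have hR0 : 0 < R := by positivity
  set L := log (Fintype.card ι) with hL
  have hL0 : 0 ≤ L := Real.log_nonneg (by exact_mod_cast Fintype.card_pos)
  set β := 4 * (L+1) / κ with hβ
  have hβ0 : 0 < β := by positivity
  have hLβ : L / β ≤ κ/4 := by
    rw [hβ, div_div_eq_mul_div, div_le_div_iff₀ (by positivity) (by positivity)]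
    nlinarith
  set C := (80 * β^2 + K + 8 * β * K) * R^3 with hC
  filter_upwards [ev_inv_sqrt R one_pos, ev_inv_sqrt (β * 2 * R) (d := 1/4) (by norm_num), 
    ev_inv_sqrt (2 * C) (d := κ/4) (by positivity), eventually_gt_atTop 0] with N h1 h2 h3 hN Ψ hΨ
  obtain ⟨g, D, B, hM⟩ := hmoll Ψ hΨ
  set τ := 1/√(N:ℝ) with hτ
  have hτ0 : 0 ≤ τ := by positivity
  have hNτ : (N:ℝ) * τ^2 = 1 := by
    rw [hτ, div_pow, Real.sq_sqrt (by positivity)]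
    have : (N:ℝ) ≠ 0 := by positivity
    field_simp
  let F : (ι → Eu m × ℝ) → ℝ := fun w => smin β (fun k => g (w k).1 + (w k).2)
  let UX : (Fin m × Fin n → Bool) → (ι → Eu m × ℝ) := fun M k => (τ • mv M (x k), 0)
  let UY : (Fin m ⊕ Fin n → Bool) → (ι → Eu m × ℝ) := fun ω k => 
    (τ • sv (fun i => ω (.inl i)), τ * ∑ j, sg (ω (.inr j)) * x k j)
  have hcmp : ∀ w, stp UY F w - 2 * C * τ^3 ≤ stp UX F w := by
    intro w
    have := step_cmp hM hK hβ0 hR hτ0 (by linarith) (by linarith) x hx (fun k => (w k).1) (fun k => (w k).2)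
    simpa [stp, F, UX, UY, hC] using this
  have hfin := stp_compare UX UY F _ hcmp N 0
  rw [stp_iter, stp_iter] at hfin
  have hNc : (N:ℝ) * (2 * C * τ^3) = 2 * C * τ := by linear_combination (2 * C * τ) * hNτ
  rw [hNc] at hfin
  have hX : ∀ (ω : Fin N → Fin m × Fin n → Bool) k, ((0 + ∑ j, UX (ω j)) k) = (Gv ω (x k), 0) := by
    intro ω k
    simp only [zero_add, Finset.sum_apply, UX, Gv]
    ext <;> simp [Prod.fst_sum, Prod.snd_sum, hτ]
  have hY1 : ∀ (ω : Fin N → Fin m ⊕ Fin n → Bool) k, ((0 + ∑ j, UY (ω j)) k).1 = hv (fun a => ω a.1 (.inl a.2)) := by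
    intro ω k
    simp only [zero_add, Finset.sum_apply, UY, hv]
    ext i
    simp [Prod.fst_sum, hτ, sv, Finset.mul_sum]
  have hY2 : ∀ (ω : Fin N → Fin m ⊕ Fin n → Bool) k, ((0 + ∑ j, UY (ω j)) k).2 = inner ℝ (hv (fun a => ω a.1 (.inr a.2))) (x k) := by
    intro ω k
    simp only [zero_add, Finset.sum_apply, UY, hv, eu_inner, Prod.snd_sum]
    simp only [Finset.mul_sum, Finset.sum_mul, hτ]
    rw [Finset.sum_comm]
    exact Finset.sum_congr rfl fun i _ => Finset.sum_congr rfl fun j _ => by ring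
  refine ⟨fun ω => F (0 + ∑ j, UX (ω j)) - κ/8, fun ω k => ?_, ?_⟩
  · have a1 := smin_le hβ0 (fun k => g ((0 + ∑ j, UX (ω j)) k).1 + ((0 + ∑ j, UX (ω j)) k).2) k
    simp only [hX, add_zero] at a1
    have a2 := (abs_le.1 (hM.close (Gv ω (x k)))).2
    simp only [F, hX, add_zero]
    linarith
  · rw [Finset.expect_sub_distrib, Fintype.expect_const]
    have low : ∀ ω : Fin N → Fin m ⊕ Fin n → Bool, Ψ (hv (fun a => ω a.1 (.inl a.2))) - κ/8 - ‖hv (fun a => ω a.1 (.inr a.2))‖ - L/β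
        ≤ F (0 + ∑ j, UY (ω j)) := by
      intro ω
      apply le_smin hβ0
      intro k
      rw [hY1, hY2]
      have a1 := (abs_le.1 (abs_real_inner_le_norm (hv (fun a => ω a.1 (.inr a.2))) (x k))).1
      rw [hx, mul_one] at a1
      have a2 := (abs_le.1 (hM.close (hv (fun a => ω a.1 (.inl a.2))))).1
      linarith
    have low2 := Finset.expect_le_expect (s := Finset.univ) fun ω _ => low ω
    simp only [Finset.expect_sub_distrib, Fintype.expect_const] at low2
    rw [expect_fst (fun ω => Ψ (hv ω)), expect_snd (fun ω => ‖hv ω‖)] at low2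
    unfold EN
    linarith

lemma tau_sq {N : ℕ} (hN : 0 < N) : (N:ℝ) * (1/√(N:ℝ))^2 = 1 := by
  rw [div_pow, Real.sq_sqrt (by positivity)]
  have : (N:ℝ) ≠ 0 := by positivity
  field_simp

lemma expect_hsq {N : ℕ} (hN : 0 < N) {A : Type*} [Fintype A] [DecidableEq A] (a : A) :
    𝔼 ω : Fin N × A → Bool, ((1/√(N:ℝ)) * ∑ j, sg (ω (j,a)))^2 = 1 := by
  have e : ∀ ω : Fin N × A → Bool, (1/√(N:ℝ)) * ∑ j, sg (ω (j,a)) = 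
      ∑ b : Fin N × A, (if b.2 = a then (1/√(N:ℝ)) else 0) * sg (ω b) := by
    intro ω
    rw [Fintype.sum_prod_type]
    simp [Finset.mul_sum]
  simp only [e, sq]
  rw [expect_lin_mul, Fintype.sum_prod_type]
  simp
  have := tau_sq hN
  rw [sq] at this
  simpa using this

/-- squared Frobenius norm -/
noncomputable def frb {N m n : ℕ} (ω : Fin N → Fin m × Fin n → Bool) : ℝ :=
  ∑ a, ((1/√(N:ℝ)) * ∑ j, sg (ω j a))^2

lemma expect_frb {N m n : ℕ} (hN : 0 < N) : 𝔼 ω : Fin N → Fin m × Fin n → Bool, frb ω = m * n := by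
  unfold frb
  rw [Finset.expect_sum_comm]
  have : ∀ a : Fin m × Fin n, 𝔼 ω : Fin N → Fin m × Fin n → Bool, ((1/√(N:ℝ)) * ∑ j, sg (ω j a))^2 = 1 := by
    intro a
    refine Eq.trans ?_ (expect_hsq hN a)
    exact Fintype.expect_equiv (Equiv.curry (Fin N) (Fin m × Fin n) Bool).symm _ _ (fun _ => rfl)
  simp only [this]
  simp

lemma Gv_apply {N m n : ℕ} (ω : Fin N → Fin m × Fin n → Bool) (x : Eu n) (i : Fin m) :
    Gv ω x i = ∑ l, ((1/√(N:ℝ)) * ∑ j, sg (ω j (i,l))) * x l := by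
  simp only [Gv, mv]
  simp [Finset.mul_sum, Finset.sum_mul]
  rw [Finset.sum_comm]
  exact Finset.sum_congr rfl fun i _ => Finset.sum_congr rfl fun j _ => by ring

lemma Gv_norm {N m n : ℕ} (ω : Fin N → Fin m × Fin n → Bool) (x : Eu n) :
    ‖Gv ω x‖ ≤ (1 + frb ω) / 2 * ‖x‖ := by
  have hf : 0 ≤ frb ω := Finset.sum_nonneg fun _ _ => sq_nonneg _
  have : ‖Gv ω x‖^2 ≤ frb ω * ‖x‖^2 := by
    rw [EuclideanSpace.real_norm_sq_eq, EuclideanSpace.real_norm_sq_eq, frb, Fintype.sum_prod_type, Finset.sum_mul]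
    refine Finset.sum_le_sum fun i _ => ?_
    rw [Gv_apply]
    exact Finset.sum_mul_sq_le_sq_mul_sq _ _ _
  apply le_of_sq_le_sq _ (by positivity)
  refine this.trans ?_
  rw [mul_pow]
  gcongr
  nlinarith [sq_nonneg (frb ω - 1)]

/-- as a linear map -/
noncomputable def Gl {N m n : ℕ} (ω : Fin N → Fin m × Fin n → Bool) : Eu n →ₗ[ℝ] Eu m where
  toFun := Gv ω
  map_add' x y := by
    ext i; simp only [PiLp.add_apply, Gv_apply, mul_add, Finset.sum_add_distrib]
  map_smul' c x := by
    ext i; simp only [PiLp.smul_apply, Gv_apply, smul_eq_mul, RingHom.id_apply, Finset.mul_sum]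
    exact Finset.sum_congr rfl fun i _ => by ring

lemma exists_map {m n : ℕ} (hn : 0 < n) {κ : ℝ} (hκ : 0 < κ) : ∀ᶠ N : ℕ in atTop, 
    ∀ Ψ : Eu m → ℝ, LipschitzWith 1 Ψ → EN N (fun y : Eu n => ‖y‖) + κ ≤ EN N Ψ → 
    ∃ G : Eu n →ₗ[ℝ] Eu m, ∀ x, ‖x‖ = 1 → 0 < Ψ (G x) := by
  set δ := κ / (2 * (1 + m * n)) with hδ
  have hδ0 : 0 < δ := by positivity
  obtain ⟨t, hts, htf, htc⟩ := (isCompact_sphere (0 : Eu n) 1).finite_cover_balls hδ0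
  have : Fintype t := htf.fintype
  have : Nonempty t := by
    have h0 : EuclideanSpace.single (⟨0, hn⟩ : Fin n) (1:ℝ) ∈ Metric.sphere (0 : Eu n) 1 := by simp
    obtain ⟨x, hx, -⟩ := Set.mem_iUnion₂.1 (htc h0)
    exact ⟨⟨x, hx⟩⟩
  filter_upwards [gordon (m := m) (fun k : t => (k : Eu n)) (fun k => by simpa using hts k.2) 
    (κ := κ/2) (by positivity), eventually_gt_atTop 0] with N hg hN Ψ hΨ hE
  obtain ⟨F, hF, hEF⟩ := hg Ψ hΨ
  by_contra! hcon
  have key : ∀ ω : Fin N → Fin m × Fin n → Bool, F ω ≤ (1 + frb ω) / 2 * δ := by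
    intro ω
    obtain ⟨x, hx, hxG⟩ := hcon (Gl ω)
    obtain ⟨y, hy, hxy⟩ := Set.mem_iUnion₂.1 (htc (by simpa using hx : x ∈ Metric.sphere (0 : Eu n) 1))
    have h1 := hF ω ⟨y, hy⟩
    have h2 := hΨ.dist_le_mul (Gv ω y) (Gv ω x)
    rw [Real.dist_eq, dist_eq_norm] at h2
    have h3 : Gv ω y - Gv ω x = Gv ω (y - x) := ((Gl ω).map_sub y x).symm
    rw [h3] at h2
    have h4 := Gv_norm ω (y - x)
    have hf : 0 ≤ frb ω := Finset.sum_nonneg fun _ _ => sq_nonneg _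
    have h5 : ‖y - x‖ ≤ δ := by
      rw [Metric.mem_ball, dist_eq_norm, ← norm_neg, neg_sub] at hxy; exact hxy.le
    have h6 : (1 + frb ω)/2 * ‖y - x‖ ≤ (1 + frb ω)/2 * δ := by gcongr
    have h7 : Ψ (Gv ω x) ≤ 0 := hxG
    have h8 := (abs_le.1 h2).2
    simp only [NNReal.coe_one, one_mul] at h8
    simp only at h1
    linarith
  have h1 := Finset.expect_le_expect (s := Finset.univ) fun ω _ => key ω
  rw [← Finset.expect_mul, ← Finset.expect_div, Finset.expect_add_distrib, expect_frb hN, Fintype.expect_const] at h1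
  have h2 : (1 + (m:ℝ) * n)/2 * δ = κ/4 := by rw [hδ]; field_simp; norm_num
  linarith

section Walsh
variable {A : Type*} [Fintype A] [DecidableEq A]

/-- Walsh character -/
noncomputable def wch (S : Finset A) (ω : A → Bool) : ℝ := ∏ a ∈ S, sg (ω a)

/-- Walsh coefficient -/
noncomputable def wco (f : (A → Bool) → ℝ) (S : Finset A) : ℝ := 𝔼 ω, f ω * wch S ω

lemma sum_wch (ω ω' : A → Bool) : ∑ S, wch S ω * wch S ω' = if ω = ω' then (Fintype.card (A → Bool) : ℝ) else 0 := by
  have h1 : ∑ S, wch S ω * wch S ω' = ∏ a : A, (1 + sg (ω a) * sg (ω' a)) := by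
    rw [Finset.prod_one_add, ← Finset.powerset_univ]
    simp only [wch, Finset.prod_mul_distrib]
  rw [h1]
  split_ifs with h
  · subst h
    simp [sg_sq]; norm_num
  · obtain ⟨a, ha⟩ := Function.ne_iff.1 h
    apply Finset.prod_eq_zero (Finset.mem_univ a)
    have : ω' a = !(ω a) := by cases h1 : ω a <;> cases h2 : ω' a <;> simp_all
    rw [this, sg_not, mul_neg, sg_sq]; norm_num

lemma parseval (f : (A → Bool) → ℝ) : ∑ S, wco f S ^ 2 = 𝔼 ω, f ω ^ 2 := by
  have h1 : ∀ S, wco f S ^ 2 = 𝔼 ω, 𝔼 ω', f ω * f ω' * (wch S ω * wch S ω') := by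
    intro S
    rw [sq]
    simp only [wco]
    rw [Finset.expect_mul_expect]
    refine Finset.expect_congr rfl fun ω _ => Finset.expect_congr rfl fun ω' _ => by ring
  simp only [h1]
  rw [← Finset.expect_sum_comm]
  refine Finset.expect_congr rfl fun ω _ => ?_
  rw [← Finset.expect_sum_comm]
  simp only [← Finset.mul_sum, sum_wch]
  rw [Fintype.expect_eq_sum_div_card]
  simp only [mul_ite, mul_zero, Finset.sum_ite_eq, Finset.mem_univ, if_true]
  field_simp

/-- discrete derivative -/
noncomputable def ddf (f : (A → Bool) → ℝ) (a : A) (ω : A → Bool) : ℝ := (f ω - f (flp a ω)) / 2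

lemma wch_flp (S : Finset A) (a : A) (ω : A → Bool) : wch S (flp a ω) = if a ∈ S then - wch S ω else wch S ω := by
  unfold wch
  split_ifs with h
  · rw [← Finset.mul_prod_erase S _ h, ← Finset.mul_prod_erase S (fun a => sg (ω a)) h, flp_same, sg_not, neg_mul]
    congr 2
    refine Finset.prod_congr rfl fun b hb => ?_
    rw [flp_ne (Finset.ne_of_mem_erase hb)]
  · refine Finset.prod_congr rfl fun b hb => ?_
    rw [flp_ne (a := a) (b := b) (by rintro rfl; exact h hb)]

lemma wco_ddf (f : (A → Bool) → ℝ) (a : A) (S : Finset A) : wco (ddf f a) S = if a ∈ S then wco f S else 0 := by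
  have h1 : 𝔼 ω, f (flp a ω) * wch S ω = 𝔼 ω, f ω * wch S (flp a ω) := by
    rw [← expect_flp a]
    simp only [flp_flp]
  have h2 : wco (ddf f a) S = (wco f S - 𝔼 ω, f ω * wch S (flp a ω)) / 2 := by
    rw [← h1]
    unfold wco ddf
    rw [← Finset.expect_sub_distrib, Finset.expect_div]
    exact Finset.expect_congr rfl fun ω _ => by ring
  rw [h2]
  simp only [wch_flp]
  split_ifs with h
  · simp only [mul_neg, Finset.expect_neg_distrib]
    unfold wco; ring
  · unfold wco; ring

lemma energy_eq (f : (A → Bool) → ℝ) : ∑ a, 𝔼 ω, ddf f a ω ^ 2 = ∑ S : Finset A, (S.card : ℝ) * wco f S ^ 2 := by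
  simp only [← parseval, wco_ddf]
  rw [Finset.sum_comm]
  refine Finset.sum_congr rfl fun S _ => ?_
  simp [ite_pow]

lemma poincare (f : (A → Bool) → ℝ) : 𝔼 ω, f ω ^ 2 - (𝔼 ω, f ω)^2 ≤ ∑ a, 𝔼 ω, ddf f a ω ^ 2 := by
  rw [energy_eq, ← parseval]
  have h0 : 𝔼 ω, f ω = wco f ∅ := by simp [wco, wch]
  rw [h0, ← Finset.add_sum_erase _ _ (Finset.mem_univ (∅ : Finset A)), add_sub_cancel_left,
    ← Finset.add_sum_erase _ (fun S : Finset A => (S.card : ℝ) * wco f S ^ 2) (Finset.mem_univ (∅ : Finset A))]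
  simp only [Finset.card_empty, Nat.cast_zero, zero_mul, zero_add]
  refine Finset.sum_le_sum fun S hS => ?_
  have : (1:ℝ) ≤ S.card := by
    exact_mod_cast Finset.card_pos.2 (Finset.nonempty_iff_ne_empty.2 (Finset.ne_of_mem_erase hS))
  nlinarith [sq_nonneg (wco f S)]

lemma low_energy (f : (A → Bool) → ℝ) : 
    𝔼 ω, f ω ^ 2 ≤ (1/4) * ∑ a, 𝔼 ω, ddf f a ω ^ 2 + ∑ S : Finset A with S.card ≤ 3, wco f S ^ 2 := by
  rw [energy_eq, ← parseval, Finset.sum_filter, Finset.mul_sum, ← Finset.sum_add_distrib]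
  refine Finset.sum_le_sum fun S _ => ?_
  split_ifs with h
  · have : (0:ℝ) ≤ S.card := by positivity
    nlinarith [sq_nonneg (wco f S), mul_nonneg this (sq_nonneg (wco f S))]
  · have : (4:ℝ) ≤ S.card := by exact_mod_cast (by omega : 4 ≤ S.card)
    nlinarith [sq_nonneg (wco f S)]

lemma low_sub (f g : (A → Bool) → ℝ) (η : ℝ) (h : ∀ ω, |g ω - f ω| ≤ η) :
    ∑ S : Finset A with S.card ≤ 3, wco g S ^ 2 ≤ 2 * (∑ S : Finset A with S.card ≤ 3, wco f S ^ 2) + 2 * η^2 := by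
  have h1 : ∀ S, wco g S = wco f S + wco (fun ω => g ω - f ω) S := by
    intro S
    unfold wco
    rw [← Finset.expect_add_distrib]
    exact Finset.expect_congr rfl fun ω _ => by ring
  have h2 : ∑ S : Finset A with S.card ≤ 3, wco (fun ω => g ω - f ω) S ^ 2 ≤ η^2 := by
    calc _ ≤ ∑ S : Finset A, wco (fun ω => g ω - f ω) S ^ 2 :=
          Finset.sum_le_sum_of_subset_of_nonneg (Finset.filter_subset _ _) fun _ _ _ => sq_nonneg _
      _ = _ := parseval _
      _ ≤ 𝔼 _ω : A → Bool, η^2 := Finset.expect_le_expect fun ω _ => by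
          rw [← sq_abs]; have := h ω; gcongr
      _ = _ := Fintype.expect_const _
  calc _ ≤ ∑ S : Finset A with S.card ≤ 3, (2 * wco f S ^ 2 + 2 * wco (fun ω => g ω - f ω) S ^ 2) := by
        refine Finset.sum_le_sum fun S _ => ?_
        rw [h1]; nlinarith [sq_nonneg (wco f S - wco (fun ω => g ω - f ω) S)]
    _ = 2 * (∑ S : Finset A with S.card ≤ 3, wco f S ^ 2) + 2 * ∑ S : Finset A with S.card ≤ 3, wco (fun ω => g ω - f ω) S ^ 2 := by
        rw [Finset.sum_add_distrib, ← Finset.mul_sum, ← Finset.mul_sum]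
    _ ≤ _ := by linarith
end Walsh

section
variable {m N : ℕ}

lemma hv_flp (ω : Fin N × Fin m → Bool) (a : Fin N × Fin m) :
    hv (flp a ω) = hv ω + (-(2 * (1/√(N:ℝ)) * sg (ω a))) • EuclideanSpace.single a.2 (1:ℝ) := by
  obtain ⟨j, i⟩ := a
  ext k
  simp only [hv, PiLp.add_apply, PiLp.smul_apply, smul_eq_mul]
  by_cases h : k = i
  · subst h
    have : ∑ j', sg (flp (j,k) ω (j',k)) = ∑ j', sg (ω (j',k)) - 2 * sg (ω (j,k)) := by
      rw [← Finset.add_sum_erase _ _ (Finset.mem_univ j), ← Finset.add_sum_erase _ (fun j' => sg (ω (j',k))) (Finset.mem_univ j),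
        flp_same, sg_not]
      have : ∑ j' ∈ Finset.univ.erase j, sg (flp (j,k) ω (j',k)) = ∑ j' ∈ Finset.univ.erase j, sg (ω (j',k)) := by
        refine Finset.sum_congr rfl fun b hb => ?_
        rw [flp_ne]
        intro e
        exact Finset.ne_of_mem_erase hb (Prod.ext_iff.1 e).1
      rw [this]; ring
    rw [this]
    simp; ring
  · have : ∀ j', flp (j,i) ω (j',k) = ω (j',k) := fun j' => flp_ne (fun e => h (Prod.ext_iff.1 e).2) ω
    simp [this, h]

lemma flp_tay {K η : ℝ} {f g : Eu m → ℝ} {D B} (hM : IsMoll K η f g D B) (hK : 0 ≤ K) (h2 : 2 * (1/√(N:ℝ)) ≤ 1)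
    (ω : Fin N × Fin m → Bool) (a : Fin N × Fin m) :
    |g (hv ω) - g (hv (flp a ω)) - 2 * (1/√(N:ℝ)) * sg (ω a) * D (hv ω) a.2| ≤ 6 * K * (1/√(N:ℝ))^2 := by
  set τ := 1/√(N:ℝ)
  have hτ : 0 ≤ τ := by positivity
  set e : Eu m := EuclideanSpace.single a.2 (1:ℝ)
  set u : Eu m := (-(2 * τ * sg (ω a))) • e with hu
  have nu : ‖u‖ = 2 * τ := by
    rw [hu, norm_smul, Real.norm_eq_abs, abs_neg, abs_mul, abs_sg, abs_of_nonneg (by positivity)]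
    simp [e]
  have h1 := hM.tay (hv ω) u (by rw [nu]; exact h2)
  have h3 := hM.hess (hv ω) u
  rw [nu] at h1 h3
  have e1 : inner ℝ (D (hv ω)) u = -(2 * τ * sg (ω a)) * D (hv ω) a.2 := by
    rw [hu, inner_smul_right, eu_inner]; simp [e, Pi.single_apply]
  rw [hv_flp]
  rw [e1] at h1
  have h4 : K * (2 * τ)^3 ≤ 4 * K * τ^2 := by
    have : (2 * τ)^3 ≤ (2 * τ)^2 := pow_le_pow_of_le_one (by positivity) h2 (by norm_num)
    nlinarith
  rw [abs_le] at *
  constructor <;> nlinarith [h1.1, h1.2, h3.1, h3.2]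

lemma energy_bd {K η : ℝ} {f g : Eu m → ℝ} {D B} (hM : IsMoll K η f g D B) (hK : 0 ≤ K) (h2 : 2 * (1/√(N:ℝ)) ≤ 1)
    (hN : 0 < N) :
    ∑ a, 𝔼 ω : Fin N × Fin m → Bool, ddf (fun ω => g (hv ω)) a ω ^ 2 ≤ 1 + m * (6 * K + 9 * K^2) * (1/√(N:ℝ)) := by
  have hNt := tau_sq hN
  set τ := 1/√(N:ℝ) with hτd
  have hτ : 0 ≤ τ := by positivity
  have key : ∀ ω : Fin N × Fin m → Bool, ∀ a, ddf (fun ω => g (hv ω)) a ω ^ 2 ≤ τ^2 * (D (hv ω) a.2)^2 + τ^2 * ((6 * K + 9 * K^2) * τ) := by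
    intro ω a
    have h := flp_tay hM hK h2 ω a
    have hD : |D (hv ω) a.2| ≤ 1 := by
      have := PiLp.norm_apply_le (D (hv ω)) a.2
      rw [Real.norm_eq_abs] at this
      exact this.trans (hM.grad _)
    have h5 : |ddf (fun ω => g (hv ω)) a ω| ≤ τ * |D (hv ω) a.2| + 3 * K * τ^2 := by
      have e : ddf (fun ω => g (hv ω)) a ω = (g (hv ω) - g (hv (flp a ω)) - 2 * τ * sg (ω a) * D (hv ω) a.2) / 2 + τ * sg (ω a) * D (hv ω) a.2 := by
        unfold ddf; ring
      rw [e]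
      refine (abs_add_le _ _).trans ?_
      rw [abs_mul, abs_mul, abs_sg, abs_of_nonneg hτ, abs_div, abs_two]
      linarith
    rw [← sq_abs, ← sq_abs (D (hv ω) a.2)]
    calc |ddf (fun ω => g (hv ω)) a ω|^2 ≤ (τ * |D (hv ω) a.2| + 3 * K * τ^2)^2 := by gcongr
      _ = τ^2 * |D (hv ω) a.2|^2 + τ^2 * (6 * K * τ * |D (hv ω) a.2| + 9 * K^2 * τ^2) := by ring
      _ ≤ _ := by
        have a1 : 6 * K * τ * |D (hv ω) a.2| ≤ 6 * K * τ * 1 := by gcongr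
        have a2 : 9 * K^2 * τ^2 ≤ 9 * K^2 * τ := by
          have : τ^2 ≤ τ := by nlinarith
          gcongr
        gcongr; linarith
  rw [← Finset.expect_sum_comm]
  calc _ ≤ 𝔼 _ω : Fin N × Fin m → Bool, (1 + m * (6 * K + 9 * K^2) * τ) := by
        refine Finset.expect_le_expect fun ω _ => ?_
        refine (Finset.sum_le_sum fun a _ => key ω a).trans ?_
        rw [Fintype.sum_prod_type]
        simp only [Finset.sum_add_distrib, Finset.sum_const, Finset.card_univ, Fintype.card_fin, nsmul_eq_mul, ← Finset.mul_sum]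
        have hD2 : ∑ i, (D (hv ω) i)^2 ≤ 1 := by
          rw [← EuclideanSpace.real_norm_sq_eq]
          have := hM.grad (hv ω)
          nlinarith [norm_nonneg (D (hv ω))]
        calc _ = (N * τ^2) * (∑ i, (D (hv ω) i)^2) + (N * τ^2) * (m * ((6 * K + 9 * K^2) * τ)) := by ring
          _ ≤ _ := by rw [hNt]; linarith
    _ = _ := Fintype.expect_const _

lemma var_bd (m : ℕ) {κ : ℝ} (hκ : 0 < κ) : ∀ᶠ N : ℕ in atTop, ∀ f : Eu m → ℝ, LipschitzWith 1 f → 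
    EN N (fun y => f y ^ 2) - (EN N f)^2 ≤ 1 + κ := by
  set η := min (1/2) (κ/16) with hη
  have hη0 : 0 < η := by positivity
  obtain ⟨K, hK, hmoll⟩ := moll m η hη0
  filter_upwards [ev_inv_sqrt 2 one_pos, ev_inv_sqrt (m * (6 * K + 9 * K^2)) (d := κ/4) (by positivity), 
    eventually_gt_atTop 0] with N h1 h2 hN f hf
  obtain ⟨g, D, B, hM⟩ := hmoll f hf
  have he := energy_bd hM hK h1 hN
  have hp := poincare (fun ω : Fin N × Fin m → Bool => g (hv ω))
  have varform : ∀ q : (Fin N × Fin m → Bool) → ℝ, 𝔼 ω, (q ω - 𝔼 ω, q ω)^2 = 𝔼 ω, q ω^2 - (𝔼 ω, q ω)^2 := by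
    intro q
    have : ∀ ω, (q ω - 𝔼 ω, q ω)^2 = q ω^2 - 2 * (𝔼 ω, q ω) * q ω + (𝔼 ω, q ω)^2 := fun ω => by ring
    simp only [this, Finset.expect_add_distrib, Finset.expect_sub_distrib, ← Finset.mul_expect, Fintype.expect_const]
    ring
  rw [← varform] at hp
  unfold EN
  rw [← varform (fun ω => f (hv ω))]
  set Ef := 𝔼 ω : Fin N × Fin m → Bool, f (hv ω)
  set Eg := 𝔼 ω : Fin N × Fin m → Bool, g (hv ω)
  have hEE : |Ef - Eg| ≤ η := by
    simp only [Ef, Eg]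
    rw [← Finset.expect_sub_distrib]
    refine (Finset.abs_expect_le _ _).trans ?_
    calc _ ≤ 𝔼 _ω : Fin N × Fin m → Bool, η := Finset.expect_le_expect fun ω _ => by
          rw [abs_sub_comm]; exact hM.close _
      _ = η := Fintype.expect_const _
  have pw : ∀ ω : Fin N × Fin m → Bool, (f (hv ω) - Ef)^2 ≤ (1 + 2 * η) * (g (hv ω) - Eg)^2 + (2 * η + 4 * η^2) := by
    intro ω
    have := hM.close (hv ω)
    set G := g (hv ω) - Eg
    have hd : |(f (hv ω) - Ef) - G| ≤ 2 * η := by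
      simp only [G]
      rw [abs_le] at *
      constructor <;> linarith [this.1, this.2, hEE.1, hEE.2]
    set d := (f (hv ω) - Ef) - G
    have e : f (hv ω) - Ef = G + d := by simp only [d]; ring
    rw [e]
    have h3 : G * d ≤ η * (1 + G^2) := by
      calc G * d ≤ |G| * |d| := by rw [← abs_mul]; exact le_abs_self _
        _ ≤ |G| * (2 * η) := by gcongr
        _ ≤ _ := by nlinarith [sq_nonneg (|G| - 1), sq_abs G]
    have h4 : d^2 ≤ 4 * η^2 := by rw [← sq_abs]; nlinarith [abs_nonneg d]
    nlinarith
  have hfin := Finset.expect_le_expect (s := Finset.univ) fun ω _ => pw ω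
  rw [Finset.expect_add_distrib, ← Finset.mul_expect, Fintype.expect_const] at hfin
  refine hfin.trans ?_
  have hη1 : η ≤ 1/2 := min_le_left _ _
  have hη2 : η ≤ κ/16 := min_le_right _ _
  set V := 𝔼 ω : Fin N × Fin m → Bool, (g (hv ω) - Eg)^2
  have hV : V ≤ 1 + κ/4 := by
    have : V ≤ _ := hp
    linarith
  nlinarith
end

section
variable {m N : ℕ}

lemma expect_coord_sq (hN : 0 < N) (i : Fin m) : 𝔼 ω : Fin N × Fin m → Bool, (hv ω i)^2 = 1 :=
  expect_hsq hN i

lemma EN_norm_sq (hN : 0 < N) : EN N (fun y : Eu m => ‖y‖^2) = m := by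
  unfold EN
  simp only [EuclideanSpace.real_norm_sq_eq]
  rw [Finset.expect_sum_comm]
  simp only [expect_coord_sq hN]
  simp

lemma expect_abs_coord (hN : 0 < N) (i : Fin m) : 𝔼 ω : Fin N × Fin m → Bool, |hv ω i| ≤ 1 := by
  have : ∀ ω : Fin N × Fin m → Bool, |hv ω i| ≤ (1 + (hv ω i)^2)/2 := fun ω => by
    rw [← sq_abs]; nlinarith [sq_nonneg (|hv ω i| - 1)]
  have h := Finset.expect_le_expect (s := Finset.univ) fun ω _ => this ω
  rw [← Finset.expect_div, Finset.expect_add_distrib, expect_coord_sq hN, Fintype.expect_const] at h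
  linarith

lemma hv_flp_coord (ω : Fin N × Fin m → Bool) (a : Fin N × Fin m) :
    hv (flp a ω) a.2 = hv ω a.2 - 2 * (1/√(N:ℝ)) * sg (ω a) := by
  rw [hv_flp]; simp; ring

lemma stein_one {K η : ℝ} {f g : Eu m → ℝ} {D B} (hM : IsMoll K η f g D B) (hK : 0 ≤ K) (h2 : 2 * (1/√(N:ℝ)) ≤ 1)
    (hN : 0 < N) (a : Fin N × Fin m) :
    |(𝔼 ω : Fin N × Fin m → Bool, sg (ω a) * (hv ω a.2 * g (hv ω))) - (1/√(N:ℝ)) * (𝔼 ω : Fin N × Fin m → Bool, hv ω a.2 * D (hv ω) a.2)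
      - (1/√(N:ℝ)) * 𝔼 ω : Fin N × Fin m → Bool, g (hv ω)| ≤ 3 * K * (1/√(N:ℝ))^2 := by
  have ht := flp_tay hM hK h2 (N := N)
  have hc := hv_flp_coord (m := m) (N := N)
  set τ := 1/√(N:ℝ)
  have hτ : 0 ≤ τ := by positivity
  have s1 : 𝔼 ω : Fin N × Fin m → Bool, sg (ω a) * (hv ω a.2 * g (hv ω)) = 
      𝔼 ω : Fin N × Fin m → Bool, - (sg (ω a) * ((hv ω a.2 - 2 * τ * sg (ω a)) * g (hv (flp a ω)))) := by
    conv_lhs => rw [← expect_flp a]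
    refine Finset.expect_congr rfl fun ω _ => ?_
    rw [flp_same, sg_not, hc]; ring
  have s2 : 𝔼 ω : Fin N × Fin m → Bool, g (hv (flp a ω)) = 𝔼 ω : Fin N × Fin m → Bool, g (hv ω) :=
    expect_flp a (fun ω => g (hv ω))
  have e : (𝔼 ω : Fin N × Fin m → Bool, sg (ω a) * (hv ω a.2 * g (hv ω))) - τ * (𝔼 ω : Fin N × Fin m → Bool, hv ω a.2 * D (hv ω) a.2)
      - τ * 𝔼 ω : Fin N × Fin m → Bool, g (hv ω) = 
     𝔼 ω : Fin N × Fin m → Bool, (sg (ω a) * hv ω a.2 / 2) * (g (hv ω) - g (hv (flp a ω)) - 2 * τ * sg (ω a) * D (hv ω) a.2) := by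
    have s3 : 𝔼 ω : Fin N × Fin m → Bool, sg (ω a) * (hv ω a.2 * g (hv ω)) = (1/2) * ((𝔼 ω : Fin N × Fin m → Bool, sg (ω a) * (hv ω a.2 * g (hv ω))) + 
       𝔼 ω : Fin N × Fin m → Bool, - (sg (ω a) * ((hv ω a.2 - 2 * τ * sg (ω a)) * g (hv (flp a ω))))) := by
      rw [← s1]; ring
    rw [s3, ← s2, ← Finset.expect_add_distrib, Finset.mul_expect, Finset.mul_expect, Finset.mul_expect, ← Finset.expect_sub_distrib, ← Finset.expect_sub_distrib]
    refine Finset.expect_congr rfl fun ω _ => ?_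
    have := sg_sq (ω a)
    linear_combination (τ * g (hv (flp a ω)) + τ * hv ω a.2 * D (hv ω) a.2) * this
  rw [e]
  refine (Finset.abs_expect_le _ _).trans ?_
  calc _ ≤ 𝔼 ω : Fin N × Fin m → Bool, |hv ω a.2| * (3 * K * τ^2) := by
        refine Finset.expect_le_expect fun ω _ => ?_
        rw [abs_mul, abs_div, abs_mul, abs_sg, abs_two]
        calc _ ≤ 1 * |hv ω a.2| / 2 * (6 * K * τ^2) := by gcongr; exact ht ω a
          _ = _ := by ring
    _ = (𝔼 ω : Fin N × Fin m → Bool, |hv ω a.2|) * (3 * K * τ^2) := by rw [Finset.expect_mul]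
    _ ≤ 1 * (3 * K * τ^2) := by gcongr; exact expect_abs_coord hN _
    _ = _ := by ring

lemma stein_all {K η : ℝ} {f g : Eu m → ℝ} {D B} (hM : IsMoll K η f g D B) (hK : 0 ≤ K) (h2 : 2 * (1/√(N:ℝ)) ≤ 1)
    (hN : 0 < N) :
    |(𝔼 ω : Fin N × Fin m → Bool, g (hv ω) * (‖hv ω‖^2 - m)) - 𝔼 ω : Fin N × Fin m → Bool, inner ℝ (D (hv ω)) (hv ω)| 
      ≤ 3 * K * m * (1/√(N:ℝ)) := by
  have hs := stein_one hM hK h2 hN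
  have hNt := tau_sq hN
  have hh : ∀ ω : Fin N × Fin m → Bool, ∀ i, hv ω i = (1/√(N:ℝ)) * ∑ j, sg (ω (j,i)) := fun _ _ => rfl
  set τ := 1/√(N:ℝ)
  have hτ : 0 ≤ τ := by positivity
  have e : (𝔼 ω : Fin N × Fin m → Bool, g (hv ω) * (‖hv ω‖^2 - m)) - 𝔼 ω : Fin N × Fin m → Bool, inner ℝ (D (hv ω)) (hv ω) = 
    ∑ i : Fin m, ∑ j : Fin N, τ * ((𝔼 ω : Fin N × Fin m → Bool, sg (ω (j,i)) * (hv ω i * g (hv ω))) - τ * (𝔼 ω : Fin N × Fin m → Bool, hv ω i * D (hv ω) i)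
      - τ * 𝔼 ω : Fin N × Fin m → Bool, g (hv ω)) := by
    have e1 : ∀ i, ∑ j : Fin N, τ * ((𝔼 ω : Fin N × Fin m → Bool, sg (ω (j,i)) * (hv ω i * g (hv ω))) - τ * (𝔼 ω : Fin N × Fin m → Bool, hv ω i * D (hv ω) i)
      - τ * 𝔼 ω : Fin N × Fin m → Bool, g (hv ω)) = 
      (𝔼 ω : Fin N × Fin m → Bool, (hv ω i)^2 * g (hv ω)) - (𝔼 ω : Fin N × Fin m → Bool, hv ω i * D (hv ω) i) - 𝔼 ω : Fin N × Fin m → Bool, g (hv ω) := by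
      intro i
      rw [← Finset.mul_sum, Finset.sum_sub_distrib, Finset.sum_sub_distrib, ← Finset.expect_sum_comm]
      have : 𝔼 ω : Fin N × Fin m → Bool, (hv ω i)^2 * g (hv ω) = τ * 𝔼 ω : Fin N × Fin m → Bool, ∑ j, sg (ω (j,i)) * (hv ω i * g (hv ω)) := by
        rw [Finset.mul_expect]
        refine Finset.expect_congr rfl fun ω _ => ?_
        rw [← Finset.sum_mul, sq]
        conv_lhs => rw [mul_assoc]; arg 1; rw [hh]
        ring
      rw [this]
      simp only [Finset.sum_const, Finset.card_univ, Fintype.card_fin, nsmul_eq_mul]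
      linear_combination (-(𝔼 ω : Fin N × Fin m → Bool, hv ω i * D (hv ω) i) - 𝔼 ω : Fin N × Fin m → Bool, g (hv ω)) * hNt
    rw [Finset.sum_congr rfl fun i _ => e1 i, Finset.sum_sub_distrib, Finset.sum_sub_distrib, ← Finset.expect_sum_comm, ← Finset.expect_sum_comm]
    have e2 : ∀ ω : Fin N × Fin m → Bool, inner ℝ (D (hv ω)) (hv ω) = ∑ i, hv ω i * D (hv ω) i := fun ω => by
      rw [eu_inner]; exact Finset.sum_congr rfl fun i _ => mul_comm _ _
    simp only [e2, mul_sub, Finset.expect_sub_distrib, EuclideanSpace.real_norm_sq_eq]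
    rw [← Finset.expect_mul]
    have e3 : ∀ ω : Fin N × Fin m → Bool, g (hv ω) * ∑ i, (hv ω i)^2 = ∑ i, (hv ω i)^2 * g (hv ω) := fun ω => by
      rw [mul_comm, Finset.sum_mul]
    simp only [e3, Finset.sum_const, Finset.card_univ, Fintype.card_fin, nsmul_eq_mul]
    ring
  rw [e]
  calc _ ≤ ∑ i : Fin m, ∑ j : Fin N, τ * (3 * K * τ^2) := by
        refine (Finset.abs_sum_le_sum_abs _ _).trans (Finset.sum_le_sum fun i _ => ?_)
        refine (Finset.abs_sum_le_sum_abs _ _).trans (Finset.sum_le_sum fun j _ => ?_)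
        rw [abs_mul, abs_of_nonneg hτ]
        gcongr
        exact hs (j,i)
    _ = _ := by
        simp only [Finset.sum_const, Finset.card_univ, Fintype.card_fin, nsmul_eq_mul]
        linear_combination (3 * K * m * τ) * hNt

lemma EN_sub_le (hN : 0 < N) (f g : Eu m → ℝ) (η : ℝ) (h : ∀ b, |g b - f b| ≤ η) : |EN N g - EN N f| ≤ η := by
  unfold EN
  rw [← Finset.expect_sub_distrib]
  refine (Finset.abs_expect_le _ _).trans ?_
  calc _ ≤ 𝔼 _ω : Fin N × Fin m → Bool, η := Finset.expect_le_expect fun ω _ => h _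
    _ = η := Fintype.expect_const _

lemma stein (m : ℕ) {κ : ℝ} (hκ : 0 < κ) : ∀ᶠ N : ℕ in atTop, ∀ f : Eu m → ℝ, LipschitzWith 1 f → 
    (∀ (c : ℝ) b, 0 ≤ c → f (c • b) = c * f b) →
    |EN N (fun y => f y * (‖y‖^2 - m)) - EN N f| ≤ κ := by
  set η := κ / (2 * (2 + 2 * m)) with hη
  have hη0 : 0 < η := by positivity
  have hη1 : η * (2 + 2 * m) = κ/2 := by rw [hη]; field_simp
  obtain ⟨K, hK, hmoll⟩ := moll m η hη0
  filter_upwards [ev_inv_sqrt 2 one_pos, ev_inv_sqrt (3 * K * m) (d := κ/2) (by positivity), 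
    eventually_gt_atTop 0] with N h1 h2 hN f hf hom
  obtain ⟨g, D, B, hM⟩ := hmoll f hf
  have s := stein_all hM hK h1 hN
  have c1 := EN_sub_le hN f g η hM.close
  have c2 := EN_sub_le hN g (fun b => inner ℝ (D b) b) η (hM.hom hom)
  have c3 : |EN N (fun y => g y * (‖y‖^2 - m)) - EN N (fun y => f y * (‖y‖^2 - m))| ≤ η * (2 * m) := by
    unfold EN
    rw [← Finset.expect_sub_distrib]
    refine (Finset.abs_expect_le _ _).trans ?_
    calc _ ≤ 𝔼 ω : Fin N × Fin m → Bool, η * (‖hv ω‖^2 + m) := Finset.expect_le_expect fun ω _ => by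
          rw [← sub_mul, abs_mul]
          gcongr
          · exact hM.close _
          · rw [abs_le]; constructor <;> nlinarith [sq_nonneg ‖hv ω‖, Nat.cast_nonneg (α := ℝ) m]
      _ = _ := by
          have := EN_norm_sq (m := m) hN
          unfold EN at this
          rw [← Finset.mul_expect, Finset.expect_add_distrib, this, Fintype.expect_const]; ring
  change |EN N (fun y => g y * (‖y‖^2 - m)) - EN N (fun b => inner ℝ (D b) b)| ≤ _ at s
  rw [abs_le] at *
  constructor <;> linarith [s.1, s.2, c1.1, c1.2, c2.1, c2.2, c3.1, c3.2]
end

section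
variable {m N : ℕ}

/-- flip a whole column -/
def cfl (N : ℕ) {m : ℕ} (i : Fin m) : (Fin N × Fin m → Bool) ≃ (Fin N × Fin m → Bool) where
  toFun ω := fun a => if a.2 = i then !(ω a) else ω a
  invFun ω := fun a => if a.2 = i then !(ω a) else ω a
  left_inv ω := by ext a; by_cases h : a.2 = i <;> simp [h]
  right_inv ω := by ext a; by_cases h : a.2 = i <;> simp [h]

lemma cfl_apply (i : Fin m) (ω : Fin N × Fin m → Bool) (a) : cfl N i ω a = if a.2 = i then !(ω a) else ω a := rfl

lemma hv_cfl (i : Fin m) (ω : Fin N × Fin m → Bool) (k : Fin m) : |hv (cfl N i ω) k| = |hv ω k| := by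
  simp only [hv, cfl_apply]
  by_cases h : k = i
  · simp [h, sg_not]
  · simp [h]

lemma wch_cfl (i : Fin m) (ω : Fin N × Fin m → Bool) (S : Finset (Fin N × Fin m)) :
    wch S (cfl N i ω) = (-1)^(S.filter (fun a => a.2 = i)).card * wch S ω := by
  unfold wch
  have : ∀ a, sg (cfl N i ω a) = (if a.2 = i then (-1:ℝ) else 1) * sg (ω a) := by
    intro a; rw [cfl_apply]; split_ifs <;> simp [sg_not]
  simp only [this, Finset.prod_mul_distrib, Finset.prod_ite, Finset.prod_const, one_pow, mul_one]

lemma wco_odd (f : Eu m → ℝ) (hev : ∀ y z : Eu m, (∀ i, |y i| = |z i|) → f y = f z) (S : Finset (Fin N × Fin m)) (i : Fin m)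
    (h : Odd (S.filter (fun a => a.2 = i)).card) : wco (fun ω => f (hv ω)) S = 0 := by
  have h1 : wco (fun ω => f (hv ω)) S = 𝔼 ω, f (hv (cfl N i ω)) * wch S (cfl N i ω) :=
    (Fintype.expect_equiv (cfl N i) _ _ (fun _ => rfl)).symm
  have h2 : ∀ ω : Fin N × Fin m → Bool, f (hv (cfl N i ω)) * wch S (cfl N i ω) = - (f (hv ω) * wch S ω) := by
    intro ω
    rw [wch_cfl, h.neg_one_pow, hev _ _ (hv_cfl i ω)]; ring
  simp only [h2, Finset.expect_neg_distrib] at h1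
  change wco (fun ω => f (hv ω)) S = - wco (fun ω => f (hv ω)) S at h1
  linarith

/-- degree two coefficient -/
noncomputable def c2 (f : Eu m → ℝ) (i : Fin m) (j j' : Fin N) : ℝ :=
  𝔼 ω : Fin N × Fin m → Bool, f (hv ω) * (sg (ω (j,i)) * sg (ω (j',i)))

lemma c2_perm (f : Eu m → ℝ) (hpe : ∀ (e : Equiv.Perm (Fin m)) (y z : Eu m), (∀ i, z i = y (e i)) → f z = f y)
    (σ : Equiv.Perm (Fin N)) (e : Equiv.Perm (Fin m)) (i j j') : c2 f i j j' = c2 f (e i) (σ j) (σ j') := by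
  unfold c2
  symm
  refine Fintype.expect_equiv (Equiv.arrowCongr (Equiv.prodCongr σ e).symm (Equiv.refl Bool)) _ _ fun ω => ?_
  have h1 : ∀ a, (Equiv.arrowCongr (Equiv.prodCongr σ e).symm (Equiv.refl Bool)) ω a = ω (σ a.1, e a.2) := fun a => rfl
  rw [h1, h1]
  congr 1
  symm
  apply hpe e
  intro k
  simp only [hv, h1]
  congr 1
  exact Equiv.sum_comp σ (fun j => sg (ω (j, e k)))

lemma c2_const (f : Eu m → ℝ) (hpe : ∀ (e : Equiv.Perm (Fin m)) (y z : Eu m), (∀ i, z i = y (e i)) → f z = f y)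
    (i i' : Fin m) (j j' k k' : Fin N) (h : j ≠ j') (h' : k ≠ k') : c2 f i j j' = c2 f i' k k' := by
  have h1 : Equiv.swap j k j = k := Equiv.swap_apply_left _ _
  have h2 : Equiv.swap j k j' ≠ k := fun e => h ((Equiv.swap j k).injective (h1.trans e.symm))
  rw [c2_perm f hpe ((Equiv.swap j k).trans (Equiv.swap (Equiv.swap j k j') k')) (Equiv.swap i i')]
  simp only [Equiv.trans_apply, Equiv.swap_apply_left]
  rw [Equiv.swap_apply_of_ne_of_ne h2.symm h']

lemma low_bd (f : Eu m → ℝ) (hev : ∀ y z : Eu m, (∀ i, |y i| = |z i|) → f y = f z) :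
    ∑ S : Finset (Fin N × Fin m) with S.card ≤ 3, wco (fun ω => f (hv ω)) S ^ 2 ≤ 
     (EN N f)^2 + ∑ i : Fin m, ∑ j : Fin N, ∑ j' : Fin N, if j ≠ j' then (c2 f i j j')^2 else 0 := by
  set q := fun S : Finset (Fin N × Fin m) => wco (fun ω => f (hv ω)) S ^ 2 with hq
  have hq0 : ∀ S, 0 ≤ q S := fun S => sq_nonneg _
  have key : ∀ S : Finset (Fin N × Fin m), S.card ≤ 3 → q S ≤ (if S = ∅ then q S else 0) + 
      ∑ i : Fin m, ∑ j : Fin N, ∑ j' : Fin N, if S = {(j,i),(j',i)} then (if j ≠ j' then q S else 0) else 0 := by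
    intro S hS
    have hnn : ∀ (i : Fin m) (j j' : Fin N), 0 ≤ if S = {(j,i),(j',i)} then (if j ≠ j' then q S else 0) else 0 := by
      intro i j j'; split_ifs <;> first | exact hq0 S | exact le_rfl
    have hnn' := Finset.sum_nonneg (s := Finset.univ) fun i _ => Finset.sum_nonneg (s := Finset.univ) fun j _ => Finset.sum_nonneg (s := Finset.univ) fun j' _ => hnn i j j'
    by_cases h0 : S = ∅
    · simp only [h0, if_true] at hnn' ⊢; linarith
    by_cases hz : q S = 0
    · rw [if_neg h0, hz]; simp
    have hz' : wco (fun ω => f (hv ω)) S ≠ 0 := by intro e; apply hz; simp [hq, e]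
    have hodd : ∀ i, Even (S.filter (fun a => a.2 = i)).card := by
      intro i
      by_contra hc
      exact hz' (wco_odd f hev S i (Nat.not_even_iff_odd.1 hc))
    obtain ⟨⟨j, i⟩, ha⟩ := Finset.nonempty_iff_ne_empty.2 h0
    have hT := hodd i
    have hTpos : 0 < (S.filter (fun a => a.2 = i)).card := Finset.card_pos.2 ⟨(j,i), by simp [ha]⟩
    have hTle : (S.filter (fun a => a.2 = i)).card ≤ S.card := Finset.card_le_card (Finset.filter_subset _ _)
    have hT2 : (S.filter (fun a => a.2 = i)).card = 2 := by
      obtain ⟨r, hr⟩ := hT; omega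
    have hrest : S.filter (fun a => ¬ a.2 = i) = ∅ := by
      by_contra hne
      obtain ⟨c, hc⟩ := Finset.nonempty_iff_ne_empty.2 hne
      have hsum := Finset.card_filter_add_card_filter_not (s := S) (fun a => a.2 = i)
      have hsub : S.filter (fun a => a.2 = c.2) ⊆ S.filter (fun a => ¬ a.2 = i) := by
        intro x hx
        simp only [Finset.mem_filter] at hx hc ⊢
        exact ⟨hx.1, by rw [hx.2]; exact hc.2⟩
      have h3 := Finset.card_le_card hsub
      have h4 : 0 < (S.filter (fun a => a.2 = c.2)).card := Finset.card_pos.2 ⟨c, by simp only [Finset.mem_filter] at hc ⊢; exact ⟨hc.1, trivial⟩⟩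
      obtain ⟨r, hr⟩ := hodd c.2
      omega
    have hSe : S = S.filter (fun a => a.2 = i) := by
      have := Finset.filter_union_filter_not_eq (fun a => a.2 = i) S
      rw [hrest, Finset.union_empty] at this
      exact this.symm
    obtain ⟨x, y, hxy, hTe⟩ := Finset.card_eq_two.1 hT2
    have hx : x.2 = i := by
      have : x ∈ S.filter (fun a => a.2 = i) := by rw [hTe]; simp
      exact (Finset.mem_filter.1 this).2
    have hy : y.2 = i := by
      have : y ∈ S.filter (fun a => a.2 = i) := by rw [hTe]; simp
      exact (Finset.mem_filter.1 this).2
    have hSf : S = {(x.1, i), (y.1, i)} := by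
      rw [hSe, hTe, ← hx]; congr 1; rw [hx, ← hy]
    have hne : x.1 ≠ y.1 := fun e => hxy (Prod.ext e (hx.trans hy.symm))
    have e : q S = if S = {(x.1,i),(y.1,i)} then (if x.1 ≠ y.1 then q S else 0) else 0 := by
      rw [if_pos hSf, if_pos hne]
    rw [if_neg h0, zero_add]
    calc q S = if S = {(x.1,i),(y.1,i)} then (if x.1 ≠ y.1 then q S else 0) else 0 := e
      _ ≤ ∑ j' : Fin N, if S = {(x.1,i),(j',i)} then (if x.1 ≠ j' then q S else 0) else 0 := 
        Finset.single_le_sum (f := fun j' => if S = {(x.1,i),(j',i)} then (if x.1 ≠ j' then q S else 0) else 0) (fun j' _ => hnn i x.1 j') (Finset.mem_univ y.1)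
      _ ≤ ∑ j : Fin N, ∑ j' : Fin N, if S = {(j,i),(j',i)} then (if j ≠ j' then q S else 0) else 0 := 
        Finset.single_le_sum (f := fun j => ∑ j' : Fin N, if S = {(j,i),(j',i)} then (if j ≠ j' then q S else 0) else 0) (fun j _ => Finset.sum_nonneg fun j' _ => hnn i j j') (Finset.mem_univ x.1)
      _ ≤ _ := 
        Finset.single_le_sum (f := fun i => ∑ j : Fin N, ∑ j' : Fin N, if S = {(j,i),(j',i)} then (if j ≠ j' then q S else 0) else 0) (fun i _ => Finset.sum_nonneg fun j _ => Finset.sum_nonneg fun j' _ => hnn i j j') (Finset.mem_univ i)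
  have hnn : ∀ S : Finset (Fin N × Fin m), 0 ≤ (if S = ∅ then q S else 0) + 
      ∑ i : Fin m, ∑ j : Fin N, ∑ j' : Fin N, if S = {(j,i),(j',i)} then (if j ≠ j' then q S else 0) else 0 := by
    intro S
    refine add_nonneg (by split_ifs <;> first | exact hq0 S | exact le_rfl) ?_
    refine Finset.sum_nonneg fun i _ => Finset.sum_nonneg fun j _ => Finset.sum_nonneg fun j' _ => ?_
    split_ifs <;> first | exact hq0 S | exact le_rfl
  calc _ ≤ ∑ S : Finset (Fin N × Fin m) with S.card ≤ 3, ((if S = ∅ then q S else 0) + 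
      ∑ i : Fin m, ∑ j : Fin N, ∑ j' : Fin N, if S = {(j,i),(j',i)} then (if j ≠ j' then q S else 0) else 0) := 
        Finset.sum_le_sum fun S hS => key S (Finset.mem_filter.1 hS).2
    _ ≤ ∑ S : Finset (Fin N × Fin m), ((if S = ∅ then q S else 0) + 
      ∑ i : Fin m, ∑ j : Fin N, ∑ j' : Fin N, if S = {(j,i),(j',i)} then (if j ≠ j' then q S else 0) else 0) := 
        Finset.sum_le_sum_of_subset_of_nonneg (Finset.filter_subset _ _) fun S _ _ => hnn S
    _ = _ := by
        rw [Finset.sum_add_distrib]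
        congr 1
        · rw [Finset.sum_ite_eq' ]
          simp [hq, wco, wch, EN]
        · rw [Finset.sum_comm]; refine Finset.sum_congr rfl fun i _ => ?_
          rw [Finset.sum_comm]; refine Finset.sum_congr rfl fun j _ => ?_
          rw [Finset.sum_comm]; refine Finset.sum_congr rfl fun j' _ => ?_
          rw [Finset.sum_ite_eq']
          simp only [Finset.mem_univ, if_true]
          by_cases hj : j ≠ j'
          · rw [if_pos hj, if_pos hj]
            simp only [hq, wco, wch, c2]
            congr 1
            refine Finset.expect_congr rfl fun ω _ => ?_
            rw [Finset.prod_pair (fun e => hj (Prod.ext_iff.1 e).1)]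
          · rw [if_neg hj, if_neg hj]

lemma stein_c2 (hN : 0 < N) (f : Eu m → ℝ) : EN N (fun y => f y * (‖y‖^2 - m)) = 
    (1/√(N:ℝ))^2 * ∑ i : Fin m, ∑ j : Fin N, ∑ j' : Fin N, if j ≠ j' then c2 f i j j' else 0 := by
  have hNt := tau_sq hN
  have hh : ∀ ω : Fin N × Fin m → Bool, ∀ i, hv ω i = (1/√(N:ℝ)) * ∑ j, sg (ω (j,i)) := fun _ _ => rfl
  set τ := 1/√(N:ℝ)
  have h1 : ∀ ω : Fin N × Fin m → Bool, ‖hv ω‖^2 - m = τ^2 * ∑ i : Fin m, ∑ j : Fin N, ∑ j' : Fin N, if j ≠ j' then (sg (ω (j,i)) * sg (ω (j',i))) else 0 := by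
    intro ω
    have h2 : ∀ i, (hv ω i)^2 - 1 = τ^2 * ∑ j : Fin N, ∑ j' : Fin N, if j ≠ j' then (sg (ω (j,i)) * sg (ω (j',i))) else 0 := by
      intro i
      have h3 : ∀ j j', (if j ≠ j' then (sg (ω (j,i)) * sg (ω (j',i))) else 0) = sg (ω (j,i)) * sg (ω (j',i)) - if j = j' then 1 else 0 := by
        intro j j'
        by_cases h : j = j'
        · subst h; simp [sg_sq]
        · simp [h]
      simp only [h3, Finset.sum_sub_distrib, Finset.sum_ite_eq, Finset.mem_univ, if_true, Finset.sum_const, Finset.card_univ, Fintype.card_fin, nsmul_eq_mul, mul_one]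
      rw [← Finset.sum_mul_sum, hh]
      linear_combination hNt
    rw [EuclideanSpace.real_norm_sq_eq, Finset.mul_sum, ← Finset.sum_congr rfl fun i _ => h2 i]
    simp
  unfold EN
  simp only [h1]
  rw [Finset.mul_sum]
  simp only [Finset.mul_sum, Finset.expect_sum_comm, c2]
  refine Finset.sum_congr rfl fun i _ => Finset.sum_congr rfl fun j _ => Finset.sum_congr rfl fun j' _ => ?_
  split_ifs
  · rw [Finset.mul_expect]
    exact Finset.expect_congr rfl fun ω _ => by ring
  · simp

lemma low_stein (hN : 2 ≤ N) (hm : 0 < m) (f : Eu m → ℝ) 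
    (hpe : ∀ (e : Equiv.Perm (Fin m)) (y z : Eu m), (∀ i, z i = y (e i)) → f z = f y) :
    ∑ i : Fin m, ∑ j : Fin N, ∑ j' : Fin N, (if j ≠ j' then (c2 f i j j')^2 else 0) ≤ 2 * (EN N (fun y => f y * (‖y‖^2 - m)))^2 := by
  have hNt := tau_sq (N := N) (by omega)
  rw [stein_c2 (by omega)]
  set τ := 1/√(N:ℝ)
  set c := c2 f ⟨0, hm⟩ ⟨0, by omega⟩ (⟨1, by omega⟩ : Fin N) with hc
  have hcc : ∀ i j j', j ≠ j' → c2 f i j j' = c := fun i j j' h => c2_const f hpe _ _ _ _ _ _ h (by simp)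
  have h3 : ∀ (d : ℝ), ∑ i : Fin m, ∑ j : Fin N, ∑ j' : Fin N, (if j ≠ j' then d else 0) = m * ((N:ℝ)^2 - N) * d := by
    intro d
    have : ∀ j j' : Fin N, (if j ≠ j' then d else 0) = d - if j = j' then d else 0 := by
      intro j j'; by_cases h : j = j' <;> simp [h]
    simp only [this, Finset.sum_sub_distrib, Finset.sum_ite_eq, Finset.mem_univ, if_true, Finset.sum_const, Finset.card_univ, Fintype.card_fin, nsmul_eq_mul]
    ring
  have h4 : ∑ i : Fin m, ∑ j : Fin N, ∑ j' : Fin N, (if j ≠ j' then (c2 f i j j')^2 else 0) = m * ((N:ℝ)^2 - N) * c^2 := by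
    rw [← h3]
    refine Finset.sum_congr rfl fun i _ => Finset.sum_congr rfl fun j _ => Finset.sum_congr rfl fun j' _ => ?_
    by_cases h : j = j'
    · simp [h]
    · simp [h, hcc i j j' h]
  have h5 : ∑ i : Fin m, ∑ j : Fin N, ∑ j' : Fin N, (if j ≠ j' then (c2 f i j j') else 0) = m * ((N:ℝ)^2 - N) * c := by
    rw [← h3]
    refine Finset.sum_congr rfl fun i _ => Finset.sum_congr rfl fun j _ => Finset.sum_congr rfl fun j' _ => ?_
    by_cases h : j = j'
    · simp [h]
    · simp [h, hcc i j j' h]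
  rw [h4, h5]
  have hN2 : (2:ℝ) ≤ N := by exact_mod_cast hN
  have hm1 : (1:ℝ) ≤ m := by exact_mod_cast hm
  have hP : 0 ≤ (N:ℝ)^2 - N := by nlinarith
  have h6 : 1 ≤ 2 * τ^4 * (m * ((N:ℝ)^2 - N)) := by
    have a1 : τ^4 * (N:ℝ)^2 = 1 := by linear_combination (N * τ^2 + 1) * hNt
    have a2 : τ^2 ≤ 1/2 := by nlinarith [sq_nonneg τ]
    have a3 : τ^4 * ((N:ℝ)^2 - N) = 1 - τ^2 := by linear_combination a1 - τ^2 * hNt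
    have : 2 * τ^4 * (m * ((N:ℝ)^2 - N)) = 2 * m * (1 - τ^2) := by rw [← a3]; ring
    rw [this]; nlinarith
  have h7 : 0 ≤ m * ((N:ℝ)^2 - N) * c^2 := by positivity
  calc _ = (m * ((N:ℝ)^2 - N) * c^2) * 1 := by ring
    _ ≤ (m * ((N:ℝ)^2 - N) * c^2) * (2 * τ^4 * (m * ((N:ℝ)^2 - N))) := by gcongr
    _ = _ := by ring

lemma quarter_bd {m : ℕ} (hm : 0 < m) {κ : ℝ} (hκ : 0 < κ) : ∀ᶠ N : ℕ in atTop, ∀ f : Eu m → ℝ, LipschitzWith 1 f → 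
    (∀ (c : ℝ) b, 0 ≤ c → f (c • b) = c * f b) →
    (∀ y z : Eu m, (∀ i, |y i| = |z i|) → f y = f z) → 
    (∀ (e : Equiv.Perm (Fin m)) (y z : Eu m), (∀ i, z i = y (e i)) → f z = f y) →
    EN N f = 0 → EN N (fun y => f y ^ 2) ≤ 1/4 + κ := by
  set η := min (1/16) (κ/16) with hη
  have hη0 : 0 < η := by positivity
  have hη1 : η ≤ 1/16 := min_le_left _ _
  have hη2 : η ≤ κ/16 := min_le_right _ _
  obtain ⟨K, hK, hmoll⟩ := moll m η hη0
  filter_upwards [ev_inv_sqrt 2 one_pos, ev_inv_sqrt (m * (6 * K + 9 * K^2)) (d := η) (by positivity), 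
    eventually_ge_atTop 2, stein m hη0] with N h1 h2 hN hst f hf hom hev hpe hE
  obtain ⟨g, D, B, hM⟩ := hmoll f hf
  have he := energy_bd hM hK h1 (by omega : 0 < N)
  have s := hst f hf hom
  rw [hE, sub_zero] at s
  have l1 := low_bd (N := N) f hev
  rw [hE] at l1
  have l2 := low_stein hN hm f hpe
  have l3 := low_energy (fun ω : Fin N × Fin m → Bool => g (hv ω))
  have l4 := low_sub (fun ω : Fin N × Fin m → Bool => f (hv ω)) (fun ω => g (hv ω)) η (fun ω => hM.close _)
  have s2 : (EN N (fun y => f y * (‖y‖^2 - m)))^2 ≤ η^2 := by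
    rw [← sq_abs]; gcongr
  have hg2 : 𝔼 ω : Fin N × Fin m → Bool, g (hv ω)^2 ≤ 1/4 + η/4 + 6 * η^2 := by nlinarith
  have pw : ∀ ω : Fin N × Fin m → Bool, f (hv ω)^2 ≤ (1 + η) * g (hv ω)^2 + (η + η^2) := by
    intro ω
    have := hM.close (hv ω)
    set G := g (hv ω)
    set d := f (hv ω) - G with hd
    have hd' : |d| ≤ η := by rw [abs_sub_comm]; exact this
    have e : f (hv ω) = G + d := by simp only [d]; ring
    rw [e]
    have h3 : 2 * (G * d) ≤ η * (1 + G^2) := by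
      have : G * d ≤ |G| * η := by
        calc G * d ≤ |G| * |d| := by rw [← abs_mul]; exact le_abs_self _
          _ ≤ |G| * η := by gcongr
      nlinarith [sq_nonneg (|G| - 1), sq_abs G]
    have h4 : d^2 ≤ η^2 := by rw [← sq_abs]; gcongr
    nlinarith
  have hfin := Finset.expect_le_expect (s := Finset.univ) fun ω _ => pw ω
  rw [Finset.expect_add_distrib, ← Finset.mul_expect, Fintype.expect_const] at hfin
  unfold EN
  nlinarith
end

section
variable {A : Type*} [Fintype A] [DecidableEq A]

lemma sum_sg_eq (J : Finset A) (ω : A → Bool) : ∑ a ∈ J, sg (ω a) = 2 * ((J.filter (fun a => ω a = true)).card : ℝ) - J.card := by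
  have : ∀ a, sg (ω a) = 2 * (if ω a = true then 1 else 0) - 1 := by
    intro a; cases ω a <;> simp [sg]; norm_num
  simp only [this, Finset.sum_sub_distrib, ← Finset.mul_sum, Finset.sum_boole, Finset.sum_const, nsmul_eq_mul, mul_one]

lemma sum_flp_notMem {J : Finset A} {a : A} (ha : a ∉ J) (ω : A → Bool) : ∑ b ∈ J, sg (flp a ω b) = ∑ b ∈ J, sg (ω b) := by
  refine Finset.sum_congr rfl fun b hb => ?_
  rw [flp_ne (a := a) (b := b) (by rintro rfl; exact ha hb)]

lemma expect_insert {J : Finset A} {a : A} (ha : a ∉ J) (φ : ℝ → ℝ) :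
    𝔼 ω : A → Bool, φ (∑ b ∈ insert a J, sg (ω b)) = 𝔼 ω : A → Bool, (φ (1 + ∑ b ∈ J, sg (ω b)) + φ (-1 + ∑ b ∈ J, sg (ω b))) / 2 := by
  have h1 : 𝔼 ω : A → Bool, φ (∑ b ∈ insert a J, sg (ω b)) = (1/2) * ((𝔼 ω : A → Bool, φ (∑ b ∈ insert a J, sg (ω b))) + 𝔼 ω : A → Bool, φ (∑ b ∈ insert a J, sg (flp a ω b))) := by
    rw [expect_flp a (fun ω => φ (∑ b ∈ insert a J, sg (ω b)))]; ring
  rw [h1, ← Finset.expect_add_distrib, Finset.mul_expect]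
  refine Finset.expect_congr rfl fun ω _ => ?_
  rw [Finset.sum_insert ha, Finset.sum_insert ha, sum_flp_notMem ha, flp_same, sg_not]
  cases ω a <;> simp [sg] <;> ring

lemma prob_eq (J : Finset A) : ∀ t : ℕ, 
    𝔼 ω : A → Bool, (if ∑ a ∈ J, sg (ω a) = 2 * (t:ℝ) - J.card then (1:ℝ) else 0) = (J.card.choose t) / 2^J.card := by
  induction J using Finset.induction_on with
  | empty => 
    intro t
    rcases t with _ | t
    · simp
    · have : ¬ ((0:ℝ) = 2 * ((t:ℝ) + 1)) := by positivity
      simp [this]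
  | insert a J ha ih =>
    intro t
    rw [expect_insert ha (fun x => if x = 2 * (t:ℝ) - (insert a J).card then (1:ℝ) else 0)]
    rw [Finset.card_insert_of_notMem ha]
    rw [← Finset.expect_div, Finset.expect_add_distrib]
    have e2 : ∀ ω : A → Bool, (if -1 + ∑ b ∈ J, sg (ω b) = 2 * (t:ℝ) - ((J.card + 1 : ℕ):ℝ) then (1:ℝ) else 0) = 
       if ∑ b ∈ J, sg (ω b) = 2 * (t:ℝ) - J.card then (1:ℝ) else 0 := by
      intro ω
      refine if_congr ?_ rfl rfl
      push_cast
      constructor <;> intro h <;> linarith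
    simp only [e2, ih t]
    rcases t with _ | t
    · have e1 : ∀ ω : A → Bool, (if 1 + ∑ b ∈ J, sg (ω b) = 2 * ((0:ℕ):ℝ) - ((J.card + 1 : ℕ):ℝ) then (1:ℝ) else 0) = 0 := by
        intro ω
        rw [if_neg]
        rw [sum_sg_eq]
        push_cast
        intro h
        have : (0:ℝ) ≤ ((J.filter (fun a => ω a = true)).card : ℝ) := by positivity
        linarith
      simp only [e1, Finset.expect_const_zero, Nat.choose_zero_right]
      rw [pow_succ]; field_simp; norm_num
    · have e1 : ∀ ω : A → Bool, (if 1 + ∑ b ∈ J, sg (ω b) = 2 * ((t+1:ℕ):ℝ) - ((J.card + 1 : ℕ):ℝ) then (1:ℝ) else 0) = 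
         if ∑ b ∈ J, sg (ω b) = 2 * (t:ℝ) - J.card then (1:ℝ) else 0 := by
        intro ω
        refine if_congr ?_ rfl rfl
        push_cast
        constructor <;> intro h <;> linarith
      simp only [e1, ih t]
      rw [Nat.choose_succ_succ, pow_succ]
      push_cast
      field_simp

lemma abs_step (x : ℝ) (z : ℤ) (hx : x = z) : (|1 + x| + |-1 + x|)/2 = |x| + if x = 0 then 1 else 0 := by
  split_ifs with h
  · rw [h]; norm_num
  · have hz : z ≠ 0 := by rintro rfl; simp at hx; exact h hx
    rcases lt_or_gt_of_ne hz with hz | hz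
    · have h1 : x ≤ -1 := by rw [hx]; exact_mod_cast (by omega : z ≤ -1)
      rw [abs_of_nonpos (by linarith : 1 + x ≤ 0), abs_of_nonpos (by linarith : -1 + x ≤ 0), abs_of_nonpos (by linarith : x ≤ 0)]; ring
    · have h1 : 1 ≤ x := by rw [hx]; exact_mod_cast (by omega : 1 ≤ z)
      rw [abs_of_nonneg (by linarith : 0 ≤ 1 + x), abs_of_nonneg (by linarith : 0 ≤ -1 + x), abs_of_nonneg (by linarith : 0 ≤ x)]; ring

lemma expect_abs_insert {J : Finset A} {a : A} (ha : a ∉ J) :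
    𝔼 ω : A → Bool, |∑ b ∈ insert a J, sg (ω b)| = 𝔼 ω : A → Bool, |∑ b ∈ J, sg (ω b)| + 
      𝔼 ω : A → Bool, (if ∑ b ∈ J, sg (ω b) = 0 then (1:ℝ) else 0) := by
  rw [expect_insert ha (fun x => |x|), ← Finset.expect_add_distrib]
  refine Finset.expect_congr rfl fun ω _ => ?_
  apply abs_step _ (2 * ((J.filter (fun a => ω a = true)).card : ℤ) - J.card)
  rw [sum_sg_eq]; push_cast; ring

lemma expect_abs_odd (k : ℕ) : ∀ J : Finset A, J.card = 2 * k + 1 → 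
    𝔼 ω : A → Bool, |∑ b ∈ J, sg (ω b)| = (2 * k + 1) * (k.centralBinom : ℝ) / 4^k := by
  have pz : ∀ (J : Finset A) (k : ℕ), J.card = 2 * k → 𝔼 ω : A → Bool, (if ∑ b ∈ J, sg (ω b) = 0 then (1:ℝ) else 0) = (k.centralBinom : ℝ) / 4^k := by
    intro J k hJ
    have := prob_eq J k
    rw [hJ] at this
    push_cast at this
    rw [sub_self, pow_mul] at this
    rw [this, Nat.centralBinom]; norm_num
  have po : ∀ (J : Finset A) (k : ℕ), J.card = 2 * k + 1 → 𝔼 ω : A → Bool, (if ∑ b ∈ J, sg (ω b) = 0 then (1:ℝ) else 0) = 0 := by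
    intro J k hJ
    apply Finset.expect_eq_zero
    intro ω _
    rw [if_neg]
    rw [sum_sg_eq, hJ]
    intro h
    have h2 : 2 * ((J.filter (fun a => ω a = true)).card : ℝ) = ((2 * k + 1 : ℕ):ℝ) := by linarith
    have h3 : 2 * (J.filter (fun a => ω a = true)).card = 2 * k + 1 := by exact_mod_cast h2
    omega
  induction k with
  | zero =>
    intro J hJ
    obtain ⟨a, rfl⟩ := Finset.card_eq_one.1 hJ
    simp [abs_sg]
  | succ k ih =>
    intro J hJ
    obtain ⟨a, J1, ha, rfl, hJ1⟩ := Finset.card_eq_succ.1 (by rw [hJ]; ring : J.card = (2 * k + 2) + 1)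
    obtain ⟨b, J2, hb, rfl, hJ2⟩ := Finset.card_eq_succ.1 (by rw [hJ1] : J1.card = (2 * k + 1) + 1)
    rw [expect_abs_insert ha, expect_abs_insert hb, ih J2 hJ2, po J2 k hJ2, pz _ (k+1) (by rw [hJ1]; ring)]
    have h := Nat.succ_mul_centralBinom_succ k
    have h' : ((k:ℝ) + 1) * ((k+1).centralBinom : ℝ) = 2 * (2 * k + 1) * (k.centralBinom : ℝ) := by exact_mod_cast h
    push_cast
    rw [pow_succ]
    field_simp
    linear_combination (-2) * h'
end

lemma wallis_bd (k : ℕ) : 2/π ≤ (2 * k + 1) * ((k.centralBinom : ℝ) / 4^k)^2 := by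
  have h1 := Real.Wallis.W_le k
  have h2 := Real.Wallis.W_eq_factorial_ratio k
  have h3 : (k.centralBinom : ℝ) = (2*k).factorial / (k.factorial)^2 := by
    rw [Nat.centralBinom_eq_two_mul_choose, Nat.cast_choose ℝ (by omega : k ≤ 2 * k)]
    have : 2 * k - k = k := by omega
    rw [this, sq]
  have h4 : (2 * k + 1) * ((k.centralBinom : ℝ) / 4^k)^2 = 1 / Real.Wallis.W k := by
    rw [h2, h3]
    have : (4:ℝ)^k = 2^(2*k) := by rw [pow_mul]; norm_num
    rw [this]
    have f1 : ((2*k).factorial : ℝ) ≠ 0 := by positivity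
    have f2 : (k.factorial : ℝ) ≠ 0 := by positivity
    field_simp
    ring
  rw [h4]
  have hW := Real.Wallis.W_pos k
  rw [div_le_div_iff₀ Real.pi_pos hW]
  linarith

lemma expect_abs_coord_ge {m k : ℕ} (i : Fin m) :
    2/π ≤ (𝔼 ω : Fin (2*k+1) × Fin m → Bool, |hv ω i|)^2 := by
  have hNt := tau_sq (N := 2*k+1) (by omega)
  have e : 𝔼 ω : Fin (2*k+1) × Fin m → Bool, |hv ω i| = (1/√((2*k+1:ℕ):ℝ)) * ((2 * k + 1) * (k.centralBinom : ℝ) / 4^k) := by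
    rw [← expect_abs_odd k ((Finset.univ : Finset (Fin (2*k+1))).map ⟨fun j => (j, i), fun a b h => (Prod.ext_iff.1 h).1⟩) (by simp), Finset.mul_expect]
    refine Finset.expect_congr rfl fun ω _ => ?_
    rw [Finset.sum_map]
    simp only [hv, abs_mul, Function.Embedding.coeFn_mk]
    rw [abs_of_nonneg (by positivity : 0 ≤ 1/√((2*k+1:ℕ):ℝ))]
    rfl
  rw [e]
  refine (wallis_bd k).trans (le_of_eq ?_)
  push_cast at hNt ⊢
  linear_combination (-(2 * k + 1) * ((k.centralBinom : ℝ) / 4^k)^2) * hNt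

section
variable {m N : ℕ}

lemma expect_sym (a : Fin N × Fin m) (F : (Fin N × Fin m → Bool) → ℝ) :
    𝔼 ω : Fin N × Fin m → Bool, sg (ω a) * F ω = 𝔼 ω : Fin N × Fin m → Bool, sg (ω a) * (F ω - F (flp a ω)) / 2 := by
  have s1 : 𝔼 ω : Fin N × Fin m → Bool, sg (ω a) * F ω = 𝔼 ω : Fin N × Fin m → Bool, - (sg (ω a) * F (flp a ω)) := by
    conv_lhs => rw [← expect_flp a]
    refine Finset.expect_congr rfl fun ω _ => ?_
    rw [flp_same, sg_not]; ring
  have s3 : 𝔼 ω : Fin N × Fin m → Bool, sg (ω a) * F ω = (1/2) * ((𝔼 ω : Fin N × Fin m → Bool, sg (ω a) * F ω) + 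
       𝔼 ω : Fin N × Fin m → Bool, - (sg (ω a) * F (flp a ω))) := by
      rw [← s1]; ring
  rw [s3, ← Finset.expect_add_distrib, Finset.mul_expect]
  refine Finset.expect_congr rfl fun ω _ => ?_
  ring

lemma expect_sg_h (a : Fin N × Fin m) : 𝔼 ω : Fin N × Fin m → Bool, sg (ω a) * hv ω a.2 = 1/√(N:ℝ) := by
  rw [expect_sym a (fun ω => hv ω a.2)]
  calc _ = 𝔼 _ω : Fin N × Fin m → Bool, 1/√(N:ℝ) := by
        refine Finset.expect_congr rfl fun ω _ => ?_
        rw [hv_flp_coord]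
        have := sg_sq (ω a)
        linear_combination (1/√(N:ℝ)) * this
    _ = _ := Fintype.expect_const _

lemma expect_sg_h3 (hN : 0 < N) (a : Fin N × Fin m) : 
    𝔼 ω : Fin N × Fin m → Bool, sg (ω a) * (hv ω a.2)^3 ≤ 3 * (1/√(N:ℝ)) := by
  rw [expect_sym a (fun ω => (hv ω a.2)^3)]
  have h1 := expect_sg_h a
  have h2 := expect_coord_sq hN a.2
  have hc := hv_flp_coord (m := m) (N := N)
  set τ := 1/√(N:ℝ)
  have hτ : 0 ≤ τ := by positivity
  calc _ = 𝔼 ω : Fin N × Fin m → Bool, (3 * τ * (hv ω a.2)^2 - 6 * τ^2 * (sg (ω a) * hv ω a.2) + 4 * τ^3) := by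
        refine Finset.expect_congr rfl fun ω _ => ?_
        simp only [hc]
        have := sg_sq (ω a)
        linear_combination (3 * τ * (hv ω a.2)^2 - 6 * τ^2 * (sg (ω a) * hv ω a.2) + 4 * τ^3 * (sg (ω a)^2 + 1)) * this
    _ = 3 * τ - 2 * τ^3 := by
        rw [Finset.expect_add_distrib, Finset.expect_sub_distrib, ← Finset.mul_expect, ← Finset.mul_expect, h1, h2, Fintype.expect_const]
        ring
    _ ≤ _ := by nlinarith [pow_nonneg hτ 3]

lemma sum_split (i : Fin m) (F : (Fin N × Fin m → Bool) → ℝ) : 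
    𝔼 ω : Fin N × Fin m → Bool, hv ω i * F ω = (1/√(N:ℝ)) * ∑ j, 𝔼 ω : Fin N × Fin m → Bool, sg (ω (j,i)) * F ω := by
  rw [← Finset.expect_sum_comm, Finset.mul_expect]
  refine Finset.expect_congr rfl fun ω _ => ?_
  rw [← Finset.sum_mul, ← mul_assoc]
  rfl

lemma expect_coord_4 (hN : 0 < N) (i : Fin m) : 𝔼 ω : Fin N × Fin m → Bool, (hv ω i)^4 ≤ 3 := by
  have : ∀ ω : Fin N × Fin m → Bool, (hv ω i)^4 = hv ω i * (hv ω i)^3 := fun ω => by ring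
  simp only [this]
  rw [sum_split i (fun ω => (hv ω i)^3)]
  have hNt := tau_sq hN
  have h3 := fun j => expect_sg_h3 hN (j, i)
  simp only at h3
  set τ := 1/√(N:ℝ)
  have hτ : 0 ≤ τ := by positivity
  calc _ ≤ τ * ∑ j : Fin N, 3 * τ := by gcongr; exact h3 _
    _ = 3 := by simp; linear_combination 3 * hNt

lemma norm_sq_flp (ω : Fin N × Fin m → Bool) (a : Fin N × Fin m) :
    ‖hv (flp a ω)‖^2 = ‖hv ω‖^2 - 4 * (1/√(N:ℝ)) * sg (ω a) * hv ω a.2 + 4 * (1/√(N:ℝ))^2 := by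
  rw [hv_flp]
  have := sg_sq (ω a)
  rw [norm_add_sq_real, norm_smul, EuclideanSpace.norm_single, inner_smul_right, eu_inner, mul_pow, Real.norm_eq_abs, sq_abs]
  simp only [PiLp.single_apply, mul_ite, mul_one, mul_zero, Finset.sum_ite_eq', Finset.sum_ite_eq, Finset.mem_univ, if_true, norm_one]
  linear_combination (4 * (1/√(N:ℝ))^2) * this

lemma expect_sg_hS (hN : 0 < N) (a : Fin N × Fin m) : 
    𝔼 ω : Fin N × Fin m → Bool, sg (ω a) * (hv ω a.2 * ‖hv ω‖^2) ≤ (1/√(N:ℝ)) * (2 + m) := by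
  rw [expect_sym a (fun ω => hv ω a.2 * ‖hv ω‖^2)]
  have h1 := expect_sg_h a
  have h2 := expect_coord_sq hN a.2
  have h3 := EN_norm_sq (m := m) hN
  simp only [EN] at h3
  have hc := hv_flp_coord (m := m) (N := N)
  have hs := norm_sq_flp (m := m) (N := N)
  set τ := 1/√(N:ℝ)
  have hτ : 0 ≤ τ := by positivity
  calc _ = 𝔼 ω : Fin N × Fin m → Bool, (2 * τ * (hv ω a.2)^2 - 6 * τ^2 * (sg (ω a) * hv ω a.2) + 4 * τ^3 + τ * ‖hv ω‖^2 : ℝ) := by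
        refine Finset.expect_congr rfl fun ω _ => ?_
        simp only [hc, hs]
        have := sg_sq (ω a)
        linear_combination (2 * τ * (hv ω a.2)^2  + τ * ‖hv ω‖^2 + 4 * τ^3 - 4 * τ^2 * (sg (ω a) * hv ω a.2)) * this
    _ = τ * (2 + m) - 2 * τ^3 := by
        rw [Finset.expect_add_distrib, Finset.expect_add_distrib, Finset.expect_sub_distrib, ← Finset.mul_expect, ← Finset.mul_expect, ← Finset.mul_expect, ← Finset.mul_expect, h1, h2, h3, Fintype.expect_const]
        ring
    _ ≤ _ := by nlinarith [pow_nonneg hτ 3]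

lemma EN_norm_4 (hN : 0 < N) : EN N (fun y : Eu m => ‖y‖^4) ≤ m * (m + 2) := by
  unfold EN
  have : ∀ ω : Fin N × Fin m → Bool, ‖hv ω‖^4 = ∑ i, hv ω i * (hv ω i * ‖hv ω‖^2) := fun ω => by
    have : ‖hv ω‖^4 = (∑ i, (hv ω i)^2) * ‖hv ω‖^2 := by rw [← EuclideanSpace.real_norm_sq_eq]; ring
    rw [this, Finset.sum_mul]
    exact Finset.sum_congr rfl fun i _ => by ring
  simp only [this]
  rw [Finset.expect_sum_comm]
  have hNt := tau_sq hN
  have h3 := fun j i => expect_sg_hS (m := m) hN (j, i)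
  simp only at h3
  have hss := fun i => sum_split (m := m) (N := N) i (fun ω => (hv ω i * ‖hv ω‖^2))
  set τ := 1/√(N:ℝ)
  have hτ : 0 ≤ τ := by positivity
  calc _ ≤ ∑ i : Fin m, τ * ∑ j : Fin N, τ * (2 + m) := by 
          refine Finset.sum_le_sum fun i _ => ?_
          rw [hss]
          gcongr; exact h3 _ _
    _ = _ := by
      simp only [Finset.sum_const, Finset.card_univ, Fintype.card_fin, nsmul_eq_mul]
      linear_combination (m * (m + 2)) * hNt

lemma EN_var (hN : 0 < N) : EN N (fun y : Eu m => (‖y‖^2 - m)^2) ≤ 2 * m := by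
  have h2 := EN_norm_sq (m := m) hN
  have h4 := EN_norm_4 (m := m) hN
  unfold EN at *
  have : ∀ ω : Fin N × Fin m → Bool, (‖hv ω‖^2 - m)^2 = ‖hv ω‖^4 - 2 * m * ‖hv ω‖^2 + m^2 := fun ω => by ring
  simp only [this]
  rw [Finset.expect_add_distrib, Finset.expect_sub_distrib, ← Finset.mul_expect, h2, Fintype.expect_const]
  nlinarith

/-- Cauchy-Schwarz for `EN`. -/
lemma EN_cs (f g : Eu m → ℝ) : (EN N (fun y => f y * g y))^2 ≤ EN N (fun y => f y^2) * EN N (fun y => g y^2) := by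
  unfold EN
  simp only [Fintype.expect_eq_sum_div_card]
  have := Finset.sum_mul_sq_le_sq_mul_sq Finset.univ (fun ω : Fin N × Fin m → Bool => f (hv ω)) (fun ω => g (hv ω))
  rw [div_pow, div_mul_div_comm, ← sq]
  gcongr

lemma EN_sq_le (f : Eu m → ℝ) : (EN N f)^2 ≤ EN N (fun y => f y^2) := by
  have := EN_cs (N := N) f (fun _ => 1)
  simpa [EN] using this

lemma EN_norm_le (m : ℕ) {κ : ℝ} (hκ : 0 < κ) : ∀ᶠ N : ℕ in atTop, 
    (EN N (fun y : Eu m => ‖y‖))^2 ≤ 2 * m^2 / (2 * m + 1) + κ := by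
  have hs := stein m (κ := min 1 (κ / (2 * m + 1))) (by positivity)
  filter_upwards [hs, eventually_gt_atTop 0] with N hs hN
  have hs := hs (fun y => ‖y‖) lipschitzWith_one_norm (fun c b hc => by rw [norm_smul, Real.norm_of_nonneg hc])
  set κ' := min 1 (κ / (2 * m + 1)) 
  set a := EN N (fun y : Eu m => ‖y‖) with ha
  have h2 := EN_norm_sq (m := m) hN
  have hvv := EN_var (m := m) hN
  have ha0 : 0 ≤ a := Finset.expect_nonneg fun ω _ => norm_nonneg _
  have ha2 : a^2 ≤ m := by rw [← h2]; exact EN_sq_le _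
  have hX : EN N (fun y : Eu m => (‖y‖ - a) * (‖y‖^2 - m)) = EN N (fun y : Eu m => ‖y‖ * (‖y‖^2 - m)) := by
    unfold EN at h2 ⊢
    simp only [sub_mul (_ : ℝ) a]
    rw [Finset.expect_sub_distrib, ← Finset.mul_expect, Finset.expect_sub_distrib, h2, Fintype.expect_const]
    ring
  have hV : EN N (fun y : Eu m => (‖y‖ - a)^2) = m - a^2 := by
    unfold EN at h2 ha ⊢
    have : ∀ ω : Fin N × Fin m → Bool, (‖hv ω‖ - a)^2 = ‖hv ω‖^2 - 2 * a * ‖hv ω‖ + a^2 := fun ω => by ring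
    simp only [this]
    rw [Finset.expect_add_distrib, Finset.expect_sub_distrib, ← Finset.mul_expect, h2, ← ha, Fintype.expect_const]
    ring
  have hc := EN_cs (N := N) (fun y : Eu m => ‖y‖ - a) (fun y => (‖y‖^2 - m))
  rw [hX, hV] at hc
  set X := EN N (fun y : Eu m => ‖y‖ * (‖y‖^2 - m))
  have hX2 : X^2 ≤ (m - a^2) * (2 * m) := hc.trans (mul_le_mul_of_nonneg_left hvv (by linarith))
  have hk0 : 0 < κ' := by positivity
  have hk1 : κ' ≤ 1 := min_le_left _ _
  have hk2 : κ' * (2 * m + 1) ≤ κ := by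
    rw [← le_div_iff₀ (by positivity)]; exact min_le_right _ _
  have hax : a - κ' ≤ X := by linarith [(abs_le.1 hs).1]
  rw [← sub_le_iff_le_add, le_div_iff₀ (by positivity)]
  rcases le_total a κ' with h | h
  · have : a^2 ≤ κ := by nlinarith [Nat.cast_nonneg (α := ℝ) m]
    have := mul_nonneg (sub_nonneg.2 this) (by positivity : (0:ℝ) ≤ 2 * m + 1)
    nlinarith [sq_nonneg (m:ℝ)]
  · have h5 : (a - κ')^2 ≤ X^2 := pow_le_pow_left₀ (by linarith) hax 2
    have h6 : 2 * a ≤ m + 1 := by nlinarith [sq_nonneg (a - 1)]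
    have h7 : 2 * a * κ' ≤ κ := by nlinarith [Nat.cast_nonneg (α := ℝ) m]
    nlinarith [Nat.cast_nonneg (α := ℝ) m]
end

/-- planar comparison for a norm dominated by the Euclidean one -/
lemma planar_aux {ν w r ν' w' r' β δ : ℝ} (h0 : 0 ≤ ν) (h0' : 0 ≤ ν') (hw : 0 ≤ w) (hw' : 0 ≤ w') (hδ : 0 ≤ δ)
    (hr : 0 ≤ r) (hr' : 0 ≤ r')
    (e1 : ν^2 + w^2 = r^2) (e2 : ν'^2 + w'^2 = r'^2) (e3 : β^2 + δ^2 = r'^2) (hβ : β ≤ ν') (hor : ν' * r ≤ ν * r') :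
    ν * β + w * δ ≤ ν * ν' + w * w' := by
  rcases le_total δ w' with h | h
  · nlinarith
  · have h1 : w * ν' ≤ ν * w' := by
      refine abs_le_of_sq_le_sq' ?_ (by positivity) |>.2
      have := pow_le_pow_left₀ (by positivity) hor 2
      nlinarith
    rcases eq_or_lt_of_le (add_nonneg hδ hw') with h2 | h2
    · have : δ = 0 := by linarith
      have : w' = 0 := by linarith
      subst δ w'; nlinarith
    · have h3 : w * β ≤ ν * δ := by nlinarith
      have h4 : 0 ≤ (ν' - β) * (ν * (δ + w') - w * (ν' + β)) := mul_nonneg (by linarith) (by linarith)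
      have h5 : (ν * ν' + w * w' - (ν * β + w * δ)) * (δ + w') = (ν' - β) * (ν * (δ + w') - w * (ν' + β)) := by
        linear_combination w * e2 - w * e3
      have h6 : 0 ≤ (ν * ν' + w * w' - (ν * β + w * δ)) := by
        by_contra hneg
        push Not at hneg
        nlinarith
      linarith

lemma psd_cs {m : ℕ} (z x y : Eu m) (hz : ‖z‖ ≤ 1) :
    (inner ℝ x y - inner ℝ z x * inner ℝ z y)^2 ≤ (‖x‖^2 - (inner ℝ z x)^2) * (‖y‖^2 - (inner ℝ z y)^2) := by
  have key : ∀ s : ℝ, 0 ≤ (‖y‖^2 - (inner ℝ z y)^2) * (s * s) + (2 * (inner ℝ x y - inner ℝ z x * inner ℝ z y)) * s + (‖x‖^2 - (inner ℝ z x)^2) := by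
    intro s
    have h := abs_real_inner_le_norm z (x + s • y)
    have h2 : (inner ℝ z (x + s • y))^2 ≤ ‖x + s • y‖^2 := by
      rw [← sq_abs]
      refine pow_le_pow_left₀ (abs_nonneg _) (h.trans ?_) 2
      nlinarith [norm_nonneg (x + s • y)]
    rw [norm_add_sq_real, inner_add_right, inner_smul_right, inner_smul_right, norm_smul, mul_pow, Real.norm_eq_abs, sq_abs] at h2
    nlinarith
  have := discrim_le_zero key
  rw [discrim] at this
  nlinarith

section
variable {m : ℕ} {ν : Eu m → ℝ} 

lemma planar (h0 : ∀ b, 0 ≤ ν b) (h1 : ∀ b, ν b ≤ ‖b‖) 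
    (hd : ∀ b, ∃ z : Eu m, inner ℝ z b = ν b ∧ ∀ b', inner ℝ z b' ≤ ν b') (b b' : Eu m) :
    inner ℝ b b' ≤ ν b * ν b' + √(‖b‖^2 - ν b^2) * √(‖b'‖^2 - ν b'^2) := by
  have hpos : ∀ b, 0 ≤ ‖b‖^2 - ν b^2 := fun b => sub_nonneg.2 (pow_le_pow_left₀ (h0 b) (h1 b) 2)
  have main : ∀ b b', ν b' * ‖b‖ ≤ ν b * ‖b'‖ → inner ℝ b b' ≤ ν b * ν b' + √(‖b‖^2 - ν b^2) * √(‖b'‖^2 - ν b'^2) := by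
    intro b b' hor
    obtain ⟨z, hz, hz'⟩ := hd b
    have hz1 : ‖z‖ ≤ 1 := by
      have := (hz' z).trans (h1 z)
      rw [real_inner_self_eq_norm_sq] at this
      nlinarith [norm_nonneg z]
    have hc := psd_cs z b b' hz1
    have hb : 0 ≤ ‖b'‖^2 - (inner ℝ z b')^2 := by
      have h := abs_real_inner_le_norm z b'
      rw [sub_nonneg, ← sq_abs]
      refine pow_le_pow_left₀ (abs_nonneg _) (h.trans ?_) 2
      nlinarith [norm_nonneg b']
    have hc2 : inner ℝ b b' - inner ℝ z b * inner ℝ z b' ≤ √(‖b‖^2 - ν b^2) * √(‖b'‖^2 - (inner ℝ z b')^2) := by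
      rw [← Real.sqrt_mul (hpos b)]
      refine Real.le_sqrt_of_sq_le ?_
      rw [hz] at hc ⊢; exact hc
    have := planar_aux (h0 b) (h0 b') (Real.sqrt_nonneg _) (Real.sqrt_nonneg _) (Real.sqrt_nonneg _) (norm_nonneg b) (norm_nonneg b')
      (ν := ν b) (ν' := ν b') (w := √(‖b‖^2 - ν b^2)) (w' := √(‖b'‖^2 - ν b'^2)) (β := inner ℝ z b') (δ := √(‖b'‖^2 - (inner ℝ z b')^2))
      (by rw [Real.sq_sqrt (hpos b)]; ring) (by rw [Real.sq_sqrt (hpos b')]; ring) (by rw [Real.sq_sqrt hb]; ring) (hz' b') hor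
    rw [hz] at hc2
    linarith
  rcases le_total (ν b' * ‖b‖) (ν b * ‖b'‖) with h | h
  · exact main b b' h
  · have := main b' b h
    rw [real_inner_comm]; linarith

lemma planar_lip (h0 : ∀ b, 0 ≤ ν b) (h1 : ∀ b, ν b ≤ ‖b‖) 
    (hd : ∀ b, ∃ z : Eu m, inner ℝ z b = ν b ∧ ∀ b', inner ℝ z b' ≤ ν b') {α γ : ℝ} (hαγ : α^2 + γ^2 = 1) :
    LipschitzWith 1 (fun b => α * ν b + γ * √(‖b‖^2 - ν b^2)) := by
  have hpos : ∀ b, 0 ≤ ‖b‖^2 - ν b^2 := fun b => sub_nonneg.2 (pow_le_pow_left₀ (h0 b) (h1 b) 2)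
  refine LipschitzWith.of_dist_le_mul fun b b' => ?_
  rw [NNReal.coe_one, one_mul, Real.dist_eq, dist_eq_norm]
  refine abs_le_of_sq_le_sq ?_ (norm_nonneg _)
  rw [norm_sub_sq_real]
  have := planar h0 h1 hd b b'
  have e1 := Real.sq_sqrt (hpos b)
  have e2 := Real.sq_sqrt (hpos b')
  set w := √(‖b‖^2 - ν b^2)
  set w' := √(‖b'‖^2 - ν b'^2)
  have : (α * (ν b - ν b') + γ * (w - w'))^2 ≤ (α^2 + γ^2) * ((ν b - ν b')^2 + (w - w')^2) := by
    nlinarith [sq_nonneg (α * (w - w') - γ * (ν b - ν b'))]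
  rw [hαγ] at this
  nlinarith
end

/-- normalised ℓ_p norm -/
noncomputable def nn (p : ℝ) {m : ℕ} (b : Eu m) : ℝ := (m:ℝ)^(1/2 - 1/p) * lpNorm p (fun i => b i)

section
variable {m : ℕ} {p : ℝ}

lemma lp_sum_nonneg (b : Fin m → ℝ) : 0 ≤ ∑ i, |b i|^p := Finset.sum_nonneg fun i _ => by positivity

lemma lp_nonneg (b : Fin m → ℝ) : 0 ≤ lpNorm p b := Real.rpow_nonneg (lp_sum_nonneg b) _

lemma nn_nonneg (b : Eu m) : 0 ≤ nn p b := mul_nonneg (by positivity) (lp_nonneg _)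

lemma lp_smul (hp : 1 ≤ p) (c : ℝ) (b : Fin m → ℝ) : lpNorm p (fun i => c * b i) = |c| * lpNorm p b := by
  unfold lpNorm
  have : ∀ i, |c * b i|^p = |c|^p * |b i|^p := fun i => by
    rw [abs_mul, Real.mul_rpow (abs_nonneg _) (abs_nonneg _)]
  simp only [this]
  rw [← Finset.mul_sum, Real.mul_rpow (by positivity) (lp_sum_nonneg b), ← Real.rpow_mul (abs_nonneg _), mul_one_div, div_self (by linarith), Real.rpow_one]

lemma nn_smul (hp : 1 ≤ p) (c : ℝ) (b : Eu m) (hc : 0 ≤ c) : nn p (c • b) = c * nn p b := by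
  unfold nn
  have := lp_smul hp c (fun i => b i)
  simp only [PiLp.smul_apply, smul_eq_mul]
  rw [this, abs_of_nonneg hc]; ring

lemma nn_even (y z : Eu m) (h : ∀ i, |y i| = |z i|) : nn p y = nn p z := by
  unfold nn lpNorm; simp only [h]

lemma nn_perm (e : Equiv.Perm (Fin m)) (y z : Eu m) (h : ∀ i, z i = y (e i)) : nn p z = nn p y := by
  unfold nn lpNorm
  simp only [h]
  rw [Equiv.sum_comp e (fun i => |y i|^p)]

lemma lp_holder (hp : 1 ≤ p) (b c : Fin m → ℝ) : 
    ∑ i, |b i|^(p-1) * |c i| ≤ (∑ i, |b i|^p)^(1 - 1/p) * lpNorm p c := by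
  unfold lpNorm
  rcases eq_or_lt_of_le hp with rfl | hp
  · simp
  · have hc := Real.HolderConjugate.conjExponent hp
    have := Real.inner_le_Lp_mul_Lq Finset.univ (fun i => |c i|) (fun i => |b i|^(p-1)) hc
    simp only [abs_abs] at this
    have h2 : ∀ i, |(|b i|^(p-1))|^(Real.conjExponent p) = |b i|^p := fun i => by
      rw [abs_of_nonneg (by positivity), ← Real.rpow_mul (abs_nonneg _)]
      congr 1
      unfold Real.conjExponent
      field_simp [show p - 1 ≠ 0 by linarith]
    have h3 : 1 / Real.conjExponent p = 1 - 1/p := by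
      unfold Real.conjExponent
      field_simp [show p - 1 ≠ 0 by linarith]
    simp only [h2, h3] at this
    rw [mul_comm]
    refine le_trans (le_of_eq ?_) this
    exact Finset.sum_congr rfl fun i _ => mul_comm _ _

lemma nn_dual (hp : 1 ≤ p) (b : Eu m) : ∃ z : Eu m, inner ℝ z b = nn p b ∧ ∀ b', inner ℝ z b' ≤ nn p b' := by
  by_cases hS : ∑ i, |b i|^p = 0
  · refine ⟨0, ?_, fun b' => ?_⟩
    · rw [inner_zero_left]; unfold nn lpNorm
      rw [hS, Real.zero_rpow (by positivity), mul_zero]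
    · rw [inner_zero_left]; exact nn_nonneg _
  · have hS' : 0 < ∑ i, |b i|^p := lt_of_le_of_ne (lp_sum_nonneg _) (Ne.symm hS)
    set S := ∑ i, |b i|^p with hSd
    have hT : 0 < S^(1-1/p) := by positivity
    refine ⟨WithLp.toLp 2 fun i => (m:ℝ)^(1/2-1/p) / S^(1-1/p) * (SignType.sign (b i) * |b i|^(p-1)), ?_, fun b' => ?_⟩
    · rw [eu_inner]
      simp only
      have : ∀ i, (m:ℝ)^(1/2-1/p) / S^(1-1/p) * (SignType.sign (b i) * |b i|^(p-1)) * b i = (m:ℝ)^(1/2-1/p) / S^(1-1/p) * |b i|^p := fun i => by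
        have h1 : |b i|^(p-1) * |b i| = |b i|^p := by
          rcases eq_or_ne (b i) 0 with h | h
          · simp [h, show p ≠ 0 by linarith]
          · rw [← Real.rpow_add_one (by positivity)]; congr 1; ring
        have h2 : (SignType.sign (b i) : ℝ) * b i = |b i| := sign_mul_self (b i)
        rw [← h1, ← h2]; ring
      simp only [this]
      rw [← Finset.mul_sum, ← hSd]
      unfold nn lpNorm
      rw [← hSd, div_mul_eq_mul_div, mul_div_assoc]
      congr 1
      rw [div_eq_iff hT.ne', ← Real.rpow_add hS']
      simp
    · rw [eu_inner]
      simp only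
      calc _ ≤ ∑ i, (m:ℝ)^(1/2-1/p) / S^(1-1/p) * (|b i|^(p-1) * |b' i|) := by
            refine Finset.sum_le_sum fun i _ => ?_
            rw [mul_assoc]
            refine mul_le_mul_of_nonneg_left ?_ (by positivity)
            refine (le_abs_self _).trans ?_
            rw [abs_mul, abs_mul, abs_of_nonneg (by positivity : 0 ≤ |b i|^(p-1))]
            refine mul_le_mul_of_nonneg_right ?_ (abs_nonneg _)
            refine mul_le_of_le_one_left (by positivity) ?_
            rcases lt_trichotomy (b i) 0 with h | h | h <;> simp [h]
        _ = (m:ℝ)^(1/2-1/p) / S^(1-1/p) * ∑ i, (|b i|^(p-1) * |b' i|) := by rw [Finset.mul_sum]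
        _ ≤ (m:ℝ)^(1/2-1/p) / S^(1-1/p) * (S^(1-1/p) * lpNorm p (fun i => b' i)) := by
            gcongr; exact lp_holder hp (fun i => b i) (fun i => b' i)
        _ = nn p b' := by unfold nn; field_simp

lemma nn_le_norm (hm : 0 < m) (hp1 : 1 ≤ p) (hp2 : p ≤ 2) (b : Eu m) : nn p b ≤ ‖b‖ := by
  have hm' : (0:ℝ) < m := by exact_mod_cast hm
  have h := Real.rpow_arith_mean_le_arith_mean_rpow Finset.univ (fun _ : Fin m => (1:ℝ)/m) (fun i => |b i|^p) (fun _ _ => by positivity)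
    (by simp; field_simp) (fun _ _ => by positivity) (p := 2/p) (by rw [le_div_iff₀] <;> linarith)
  rw [← Finset.mul_sum, ← Finset.mul_sum] at h
  have e : ∀ i, (|b i|^p)^(2/p) = b i^2 := fun i => by
    rw [← Real.rpow_mul (abs_nonneg _), mul_div_cancel₀ _ (by linarith : p ≠ 0), Real.rpow_two, sq_abs]
  simp only [e] at h
  rw [← EuclideanSpace.real_norm_sq_eq] at h
  refine abs_le_of_sq_le_sq' ?_ (norm_nonneg _) |>.2
  unfold nn lpNorm
  have hS := lp_sum_nonneg (p := p) (fun i => b i)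
  set S := ∑ i, |b i|^p
  rw [mul_pow, ← Real.rpow_two, ← Real.rpow_two, ← Real.rpow_mul hm'.le, ← Real.rpow_mul hS]
  rw [Real.mul_rpow (by positivity) hS, one_div, Real.inv_rpow hm'.le, ← Real.rpow_neg hm'.le] at h
  have := mul_le_mul_of_nonneg_left h hm'.le
  rw [← mul_assoc, ← mul_assoc, mul_inv_cancel₀ hm'.ne', one_mul] at this
  convert! this using 2
  · nth_rewrite 2 [← Real.rpow_one (m:ℝ)]
    rw [← Real.rpow_add hm']
    congr 1; field_simp; ring
  · congr 1; ring

lemma l1_le_nn (hm : 0 < m) (hp1 : 1 ≤ p) (b : Eu m) : (1/√(m:ℝ)) * ∑ i, |b i| ≤ nn p b := by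
  have hm' : (0:ℝ) < m := by exact_mod_cast hm
  have h := Real.arith_mean_le_rpow_mean Finset.univ (fun _ : Fin m => (1:ℝ)/m) (fun i => |b i|) (fun _ _ => by positivity)
    (by simp; field_simp) (fun _ _ => by positivity) hp1
  rw [← Finset.mul_sum, ← Finset.mul_sum] at h
  unfold nn lpNorm
  have hS := lp_sum_nonneg (p := p) (fun i => b i)
  set S := ∑ i, |b i|^p
  rw [Real.mul_rpow (by positivity) hS] at h
  have := mul_le_mul_of_nonneg_left h (Real.sqrt_nonneg m)
  rw [← mul_assoc, ← mul_assoc] at this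
  convert! this using 2
  · have := Real.sq_sqrt hm'.le
    field_simp; linarith
  · rw [Real.rpow_sub hm', Real.sqrt_eq_rpow, div_eq_mul_inv, one_div (m:ℝ), Real.inv_rpow hm'.le]

/-- ℓ_2 ≤ ℓ_p -/
lemma norm_le_lp (hp1 : 1 ≤ p) (hp2 : p ≤ 2) (b : Eu m) : ‖b‖ ≤ lpNorm p (fun i => b i) := by
  have hS := lp_sum_nonneg (p := p) (fun i => b i)
  refine abs_le_of_sq_le_sq' ?_ (lp_nonneg _) |>.2
  rw [EuclideanSpace.real_norm_sq_eq]
  have hi : ∀ i, |b i| ≤ lpNorm p (fun i => b i) := fun i => by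
    unfold lpNorm
    calc |b i| = (|b i|^p)^(1/p) := by rw [← Real.rpow_mul (abs_nonneg _), mul_one_div, div_self (by linarith), Real.rpow_one]
      _ ≤ _ := by
        gcongr
        exact Finset.single_le_sum (f := fun i => |b i|^p) (fun i _ => by positivity) (Finset.mem_univ i)
  have hL := lp_nonneg (p := p) (fun i => b i)
  have e : ∑ i, |b i|^p = (lpNorm p (fun i => b i))^p := by
    unfold lpNorm
    rw [← Real.rpow_mul hS, one_div, inv_mul_cancel₀ (by linarith), Real.rpow_one]
  set L := lpNorm p (fun i => b i)
  have comb : ∀ x : ℝ, 0 ≤ x → x^(2-p) * x^p = x^2 := fun x hx => by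
    rw [← Real.rpow_add' hx (by norm_num)]; norm_num
  calc _ ≤ ∑ i, L^(2-p) * |b i|^p := by
        refine Finset.sum_le_sum fun i _ => ?_
        rw [← sq_abs, ← comb _ (abs_nonneg _)]
        gcongr
        exact hi i
    _ = L^2 := by rw [← Finset.mul_sum, e, comb _ hL]

/-- ℓ_p ≤ ℓ_1 -/
lemma lp_le_l1 (hp1 : 1 ≤ p) (b : Eu m) : lpNorm p (fun i => b i) ≤ ∑ i, |b i| := by
  have hi : ∀ i, |b i| ≤ ∑ i, |b i| := fun i => Finset.single_le_sum (f := fun i => |b i|) (fun i _ => by positivity) (Finset.mem_univ i)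
  have hL : 0 ≤ ∑ i, |b i| := Finset.sum_nonneg fun i _ => by positivity
  have comb : ∀ x : ℝ, 0 ≤ x → x^(p-1) * x = x^p := fun x hx => by
    rcases eq_or_lt_of_le hx with h | h
    · simp [← h, show p ≠ 0 by linarith]
    · rw [← Real.rpow_add_one h.ne']; congr 1; ring
  have : ∑ i, |b i|^p ≤ (∑ i, |b i|)^p := by
    calc _ ≤ ∑ i, (∑ i, |b i|)^(p-1) * |b i| := by
          refine Finset.sum_le_sum fun i _ => ?_
          rw [← comb _ (abs_nonneg _)]
          gcongr
          exact hi i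
      _ = _ := by rw [← Finset.mul_sum, comb _ hL]
  unfold lpNorm
  calc _ ≤ ((∑ i, |b i|)^p)^(1/p) := by gcongr
    _ = _ := by rw [← Real.rpow_mul hL, mul_one_div, div_self (by linarith), Real.rpow_one]
end

section
variable {m n : ℕ} {p : ℝ}

lemma reduce (hp : 1 ≤ p) {ε K : ℝ} (hK : 0 < K) (G : Eu n →ₗ[ℝ] Eu m) 
    (hG : ∀ x, ‖x‖ = 1 → 0 < ‖G x‖ ∧ (1 - ε) * K * ‖G x‖ ≤ lpNorm p (fun i => G x i) ∧ lpNorm p (fun i => G x i) ≤ (1 + ε) * K * ‖G x‖) :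
    ∃ f : (Fin n → ℝ) →ₗ[ℝ] (Fin m → ℝ), ∀ x : Fin n → ℝ,
      (1 - ε) * Real.sqrt (∑ i, x i ^ 2) ≤ lpNorm p (f x) ∧
      lpNorm p (f x) ≤ (1 + ε) * Real.sqrt (∑ i, x i ^ 2) := by
  have hall : ∀ x, (1 - ε) * K * ‖G x‖ ≤ lpNorm p (fun i => G x i) ∧ lpNorm p (fun i => G x i) ≤ (1 + ε) * K * ‖G x‖ := by
    intro x
    rcases eq_or_ne x 0 with rfl | hx
    · have : lpNorm p (fun i => G (0 : Eu n) i) = 0 := by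
        have := lp_smul hp 0 (fun i => G (0 : Eu n) i)
        simpa using this
      rw [this]; simp
    · have hx' : 0 < ‖x‖ := norm_pos_iff.2 hx
      obtain ⟨-, h1, h2⟩ := hG (‖x‖⁻¹ • x) (by rw [norm_smul, norm_inv, norm_norm, inv_mul_cancel₀ hx'.ne'])
      have e : lpNorm p (fun i => G (‖x‖⁻¹ • x) i) = ‖x‖⁻¹ * lpNorm p (fun i => G x i) := by
        have := lp_smul hp ‖x‖⁻¹ (fun i => G x i)
        rw [abs_of_pos (by positivity)] at this
        rw [← this]; simp
      have e2 : ‖G (‖x‖⁻¹ • x)‖ = ‖x‖⁻¹ * ‖G x‖ := by rw [map_smul, norm_smul, norm_inv, norm_norm]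
      rw [e, e2] at h1 h2
      constructor
      · refine le_of_mul_le_mul_left ?_ (inv_pos.2 hx'); linarith
      · refine le_of_mul_le_mul_left ?_ (inv_pos.2 hx'); linarith
  have hinj : Function.Injective G := by
    rw [← LinearMap.ker_eq_bot, LinearMap.ker_eq_bot']
    intro x hx0
    by_contra hx
    have hx' : 0 < ‖x‖ := norm_pos_iff.2 hx
    have := (hG (‖x‖⁻¹ • x) (by rw [norm_smul, norm_inv, norm_norm, inv_mul_cancel₀ hx'.ne'])).1
    rw [map_smul, hx0] at this
    simp at this
  have hfr : Module.finrank ℝ (LinearMap.range G) = n := by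
    rw [LinearMap.finrank_range_of_inj hinj]; simp
  let B := (stdOrthonormalBasis ℝ (LinearMap.range G)).reindex (finCongr hfr)
  let U := B.repr.symm
  refine ⟨(1/K) • ((WithLp.linearEquiv 2 ℝ (Fin m → ℝ)).toLinearMap ∘ₗ (LinearMap.range G).subtype ∘ₗ U.toLinearEquiv.toLinearMap ∘ₗ (WithLp.linearEquiv 2 ℝ (Fin n → ℝ)).symm.toLinearMap), fun x => ?_⟩
  set v := U (WithLp.toLp 2 x) with hv
  obtain ⟨u, hu⟩ := v.2
  have hnv : ‖G u‖ = √(∑ i, x i^2) := by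
    rw [hu]
    have : ‖v‖ = ‖(WithLp.toLp 2 x : Eu n)‖ := by rw [hv]; exact U.norm_map _
    rw [Submodule.coe_norm] at this
    rw [this, EuclideanSpace.norm_eq]
    simp
  have hl : lpNorm p (((1/K) • ((WithLp.linearEquiv 2 ℝ (Fin m → ℝ)).toLinearMap ∘ₗ (LinearMap.range G).subtype ∘ₗ U.toLinearEquiv.toLinearMap ∘ₗ (WithLp.linearEquiv 2 ℝ (Fin n → ℝ)).symm.toLinearMap)) x) = (1/K) * lpNorm p (fun i => G u i) := by
    rw [hu]
    have := lp_smul hp (1/K) (fun i => (v : Eu m) i)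
    rw [abs_of_pos (by positivity)] at this
    rw [← this]; rfl
  rw [hl, ← hnv]
  obtain ⟨h1, h2⟩ := hall u
  constructor
  · rw [one_div, ← div_eq_inv_mul, le_div_iff₀ hK]; linarith
  · rw [one_div, ← div_eq_inv_mul, div_le_iff₀ hK]; linarith

lemma reduce' (hm : 0 < m) (hp : 1 ≤ p) {ε K : ℝ} (hK : 0 < K) (G : Eu n →ₗ[ℝ] Eu m) 
    (hG : ∀ x, ‖x‖ = 1 → 0 < ‖G x‖ ∧ (1 - ε) * K * ‖G x‖ ≤ nn p (G x) ∧ nn p (G x) ≤ (1 + ε) * K * ‖G x‖) :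
    ∃ f : (Fin n → ℝ) →ₗ[ℝ] (Fin m → ℝ), ∀ x : Fin n → ℝ,
      (1 - ε) * Real.sqrt (∑ i, x i ^ 2) ≤ lpNorm p (f x) ∧
      lpNorm p (f x) ≤ (1 + ε) * Real.sqrt (∑ i, x i ^ 2) := by
  have hm' : (0:ℝ) < m := by exact_mod_cast hm
  have hC : 0 < (m:ℝ)^(1/2 - 1/p) := by positivity
  refine reduce hp (K := K / (m:ℝ)^(1/2 - 1/p)) (by positivity) G fun x hx => ?_
  obtain ⟨h0, h1, h2⟩ := hG x hx
  unfold nn at h1 h2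
  refine ⟨h0, ?_, ?_⟩
  · rw [← mul_le_mul_iff_of_pos_left hC]
    refine le_trans (le_of_eq ?_) h1
    field_simp
  · rw [← mul_le_mul_iff_of_pos_left hC]
    refine le_trans h2 (le_of_eq ?_)
    field_simp

/-- Regime 0: coordinate embedding. -/
lemma regime0 (hp1 : 1 ≤ p) (hp2 : p ≤ 2) {ε : ℝ} (hε : ε < 1) (hnm : n ≤ m) (h : (1 - ε) * √(n:ℝ) ≤ 1 + ε) :
    ∃ f : (Fin n → ℝ) →ₗ[ℝ] (Fin m → ℝ), ∀ x : Fin n → ℝ,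
      (1 - ε) * Real.sqrt (∑ i, x i ^ 2) ≤ lpNorm p (f x) ∧
      lpNorm p (f x) ≤ (1 + ε) * Real.sqrt (∑ i, x i ^ 2) := by
  let G : Eu n →ₗ[ℝ] Eu m := 
    { toFun := fun x => WithLp.toLp 2 fun i => if hi : i.1 < n then x ⟨i.1, hi⟩ else 0
      map_add' := fun x y => by ext i; simp; split_ifs <;> simp
      map_smul' := fun c x => by ext i; simp }
  have hGi : ∀ x i, G x i = if hi : i.1 < n then x ⟨i.1, hi⟩ else 0 := fun x i => rfl
  have hs : ∀ (F : ℝ → ℝ), F 0 = 0 → ∀ x, ∑ i, F (G x i) = ∑ j, F (x j) := by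
    intro F hF x
    symm
    refine Finset.sum_of_injOn (fun j => Fin.castLE hnm j) (fun a _ b _ h => Fin.castLE_injective hnm h) (fun _ _ => Finset.mem_univ _) ?_ ?_
    · intro i _ hi
      have : ¬ i.1 < n := fun hlt => hi ⟨⟨i.1, hlt⟩, Finset.mem_coe.2 (Finset.mem_univ _), rfl⟩
      rw [hGi, dif_neg this, hF]
    · intro j _
      rw [hGi]; simp
  have h1 : 0 < 1 - ε := by linarith
  refine reduce hp1 (K := 1/(1-ε)) (by positivity) G fun x hx => ?_
  have hn1 : ‖G x‖ = 1 := by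
    rw [← hx, EuclideanSpace.norm_eq, EuclideanSpace.norm_eq, hs (fun t => ‖t‖^2) (by simp)]
  refine ⟨by rw [hn1]; norm_num, ?_, ?_⟩
  · rw [mul_one_div_cancel h1.ne', one_mul]
    exact norm_le_lp hp1 hp2 _
  · refine (lp_le_l1 hp1 _).trans ?_
    rw [hs (fun t => |t|) (by simp), hn1, mul_one]
    have : ∑ j, |x j| ≤ √(n:ℝ) := by
      refine Real.le_sqrt_of_sq_le ?_
      have := Finset.sum_mul_sq_le_sq_mul_sq Finset.univ (fun j => |x j|) (fun _ => (1:ℝ))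
      simp only [mul_one, sq_abs, one_pow, Finset.sum_const, Finset.card_univ, Fintype.card_fin, nsmul_eq_mul] at this
      rw [← EuclideanSpace.real_norm_sq_eq, hx] at this
      linarith
    refine this.trans ?_
    rw [mul_one_div, le_div_iff₀ h1]; linarith

/-- the Lipschitz function of regime 2 -/
lemma inner_T {h y : Eu m} {lam t : ℝ} (hl : 0 < lam) (hy : ∑ i, |y i| ≤ t * √(m:ℝ) * ‖y‖) :
    inner ℝ h y ≤ ‖y‖ * (√(∑ i, (h i)^4) / (4 * lam) + lam * t * √(m:ℝ)) := by
  rw [eu_inner]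
  have h1 : ∀ i, h i * y i ≤ (1/(4*lam)) * ((h i)^2 * |y i|) + lam * |y i| := fun i => by
    have a : |h i| ≤ (1/(4*lam)) * (h i)^2 + lam := by
      rw [← sub_nonneg]
      have : (1/(4*lam)) * (h i)^2 + lam - |h i| = (|h i| - 2 * lam)^2 / (4 * lam) := by
        rw [← sq_abs (h i)]; field_simp; ring
      rw [this]; positivity
    calc h i * y i ≤ |h i| * |y i| := by rw [← abs_mul]; exact le_abs_self _
      _ ≤ ((1/(4*lam)) * (h i)^2 + lam) * |y i| := by gcongr
      _ = _ := by ring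
  have h2 : ∑ i, (h i)^2 * |y i| ≤ √(∑ i, (h i)^4) * ‖y‖ := by
    have := Finset.sum_mul_sq_le_sq_mul_sq Finset.univ (fun i => (h i)^2) (fun i => |y i|)
    rw [EuclideanSpace.norm_eq, ← Real.sqrt_mul (Finset.sum_nonneg fun i _ => by positivity)]
    refine Real.le_sqrt_of_sq_le (this.trans (le_of_eq ?_))
    simp only [Real.norm_eq_abs, ← pow_mul]
  calc _ ≤ ∑ i, ((1/(4*lam)) * ((h i)^2 * |y i|) + lam * |y i|) := Finset.sum_le_sum fun i _ => h1 i
    _ = (1/(4*lam)) * ∑ i, (h i)^2 * |y i| + lam * ∑ i, |y i| := by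
      rw [Finset.sum_add_distrib, Finset.mul_sum, Finset.mul_sum]
    _ ≤ (1/(4*lam)) * (√(∑ i, (h i)^4) * ‖y‖) + lam * (t * √(m:ℝ) * ‖y‖) := by gcongr
    _ = _ := by ring

lemma infDist_T {h : Eu m} {lam t : ℝ} (hl : 0 < lam) (T : Set (Eu m)) (hT : ∀ y ∈ T, ∑ i, |y i| ≤ t * √(m:ℝ) * ‖y‖) (hne : T.Nonempty) :
    ‖h‖^2 - (√(∑ i, (h i)^4) / (4 * lam) + lam * t * √(m:ℝ))^2 ≤ (Metric.infDist h T)^2 := by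
  set c := √(∑ i, (h i)^4) / (4 * lam) + lam * t * √(m:ℝ)
  rcases le_total (‖h‖^2 - c^2) 0 with h0 | h0
  · exact h0.trans (sq_nonneg _)
  have : √(‖h‖^2 - c^2) ≤ Metric.infDist h T := by
    rw [Metric.le_infDist hne]
    intro y hy
    rw [dist_eq_norm]
    refine Real.sqrt_le_iff.2 ⟨norm_nonneg _, ?_⟩
    rw [norm_sub_sq_real]
    have := inner_T (h := h) hl (hT y hy)
    nlinarith [sq_nonneg (‖y‖ - c)]
  calc _ = (√(‖h‖^2 - c^2))^2 := (Real.sq_sqrt h0).symm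
    _ ≤ _ := by gcongr

lemma EN_infDist (hm : 0 < m) {N : ℕ} (hN : 0 < N) {t : ℝ} (ht : 0 < t) (T : Set (Eu m)) (hT : ∀ y ∈ T, ∑ i, |y i| ≤ t * √(m:ℝ) * ‖y‖) (hne : T.Nonempty) :
    m * (1 - √3 * t) ≤ EN N (fun y => (Metric.infDist y T)^2) := by
  have hm' : (0:ℝ) < m := by exact_mod_cast hm
  have h3 : √3 ^2 = 3 := Real.sq_sqrt (by norm_num)
  have h3p : 0 < √3 := by positivity
  set s := √3
  set lam := √(s / (4 * t)) with hlam
  have hl : 0 < lam := by positivity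
  have hl2 : lam^2 = s / (4 * t) := Real.sq_sqrt (by positivity)
  have key : ∀ h : Eu m, ‖h‖^2 - (t/s * ((1/2) * ∑ i, (h i)^4) + s * t/2 * m) ≤ (Metric.infDist h T)^2 := fun h => by
    refine le_trans ?_ (infDist_T hl T hT hne)
    have hM : 0 ≤ ∑ i, (h i)^4 := Finset.sum_nonneg fun i _ => by positivity
    have e1 := Real.sq_sqrt hM
    have e2 := Real.sq_sqrt hm'.le
    set M := ∑ i, (h i)^4
    set R := √M
    set q := √(m:ℝ)
    have : (R / (4 * lam) + lam * t * q)^2 = R^2 / (16 * lam^2) + t * (R * q) / 2 + lam^2 * t^2 * q^2 := by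
      field_simp; ring
    rw [this, hl2, e1, e2]
    have h5 : R * q ≤ (M / s + s * m)/2 := by
      rw [← e1, ← e2, ← sub_nonneg]
      have : (R^2/s + s * q^2)/2 - R * q = (R - s * q)^2 / (2 * s) := by field_simp; ring
      rw [this]; positivity
    have h6 : t * (R * q) / 2 ≤ t * ((M / s + s * m)/2) / 2 := by gcongr
    have h7 : M / (16 * (s / (4 * t))) = t/s * M/4 := by field_simp; ring
    have h8 : s / (4*t) * t^2 * m = s * t * m / 4 := by field_simp
    rw [h7, h8]
    have h9 : t * ((M / s + s * m)/2) / 2 = t/s * M/4 + s * t * m/4 := by ring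
    linarith
  have h2 := EN_norm_sq (m := m) hN
  simp only [EN] at h2 ⊢
  refine le_trans ?_ (Finset.expect_le_expect fun ω _ => key (hv ω))
  rw [Finset.expect_sub_distrib, h2, Finset.expect_add_distrib, ← Finset.mul_expect, ← Finset.mul_expect, Finset.expect_sum_comm, Fintype.expect_const]
  have : ∑ i : Fin m, 𝔼 ω : Fin N × Fin m → Bool, (hv ω i)^4 ≤ m * 3 := by
    calc _ ≤ ∑ i : Fin m, (3:ℝ) := Finset.sum_le_sum fun i _ => expect_coord_4 hN i
      _ = _ := by simp
  have h5 : t/s * ((1/2) * ∑ i : Fin m, 𝔼 ω : Fin N × Fin m → Bool, (hv ω i)^4) ≤ t/s * ((1/2) * (m * 3)) := by gcongr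
  have h6 : t/s * ((1/2) * (m * 3)) = s * t / 2 * m := by rw [← h3]; field_simp
  linarith

lemma regime2 (hn : 0 < n) (hm : 0 < m) (hp1 : 1 ≤ p) (hp2 : p ≤ 2) {ε : ℝ} (h0 : 35/100 ≤ ε) (hε : ε < 1) 
    (hnm : n ≤ ε^2 * m) (h : 1 + ε < (1 - ε) * √(n:ℝ)) :
    ∃ f : (Fin n → ℝ) →ₗ[ℝ] (Fin m → ℝ), ∀ x : Fin n → ℝ,
      (1 - ε) * Real.sqrt (∑ i, x i ^ 2) ≤ lpNorm p (f x) ∧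
      lpNorm p (f x) ≤ (1 + ε) * Real.sqrt (∑ i, x i ^ 2) := by
  have hm' : (0:ℝ) < m := by exact_mod_cast hm
  set t := (1 - ε)/(1 + ε) with ht
  have ht0 : 0 < t := div_pos (by linarith) (by linarith)
  have het : ε = (1 - t)/(1 + t) := by rw [ht]; field_simp; ring
  have ht1 : t ≤ 0.4815 := by rw [ht, div_le_iff₀ (by linarith)]; linarith
  have hs := Real.sq_sqrt (Nat.cast_nonneg (α := ℝ) n)
  have hn1 : 1 < t * √(n:ℝ) := by
    rw [ht, div_mul_eq_mul_div, lt_div_iff₀ (by linarith)]; linarith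
  have h3 : √3 ≤ 1.7321 := by rw [Real.sqrt_le_iff]; norm_num
  have hgap : n < m * (1 - √3 * t) - 1 := by
    have hn2 : 1 < t^2 * n := by
      calc (1:ℝ) = 1^2 := by norm_num
        _ < (t * √(n:ℝ))^2 := by gcongr
        _ = _ := by rw [mul_pow, hs]
    have hm2 : 1 < t^2 * ε^2 * m := by nlinarith [mul_le_mul_of_nonneg_left hnm (sq_nonneg t)]
    have hq : t^2 * ε^2 ≤ 1 - √3 * t - ε^2 := by
      have hq2 : t^2 * (1-t)^2 ≤ (1 - √3 * t) * (1 + t)^2 - (1-t)^2 := by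
        have : √3 * t * (1+t)^2 ≤ 1.7321 * t * (1+t)^2 := by gcongr
        have : 0 ≤ t * (4 - 1.7321 * (1+t)^2 - t * (1-t)^2) := by
          refine mul_nonneg ht0.le ?_
          nlinarith [sq_nonneg t, mul_pos ht0 ht0, mul_nonneg ht0.le (sub_nonneg.2 ht1), mul_nonneg (sq_nonneg t) (sub_nonneg.2 ht1)]
        nlinarith
      have het2 : ε^2 = (1-t)^2/(1+t)^2 := by nth_rewrite 1 [het]; rw [div_pow]
      have hp : 0 < (1+t)^2 := by positivity
      rw [het2, ← mul_div_assoc, div_le_iff₀ hp, sub_mul, div_mul_cancel₀ _ hp.ne']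
      exact hq2
    nlinarith
  set gap := m * (1 - √3 * t) - 1 - n with hgd
  have hg : 0 < gap := by linarith
  set q := √(n:ℝ)
  have hq0 : 0 ≤ q := Real.sqrt_nonneg _
  set κ := min 1 (gap / (2 * q + 2)) with hκd
  have hκ : 0 < κ := by positivity
  have hκ1 : κ ≤ 1 := min_le_left _ _
  have hκ2 : κ * (2 * q + 2) ≤ gap := by rw [← le_div_iff₀ (by positivity)]; exact min_le_right _ _
  let T : Set (Eu m) := {y | ∑ i, |y i| ≤ t * √(m:ℝ) * ‖y‖}
  have hTne : T.Nonempty := ⟨0, by simp [T]⟩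
  have hlip : LipschitzWith 1 (fun y => Metric.infDist y T) := Metric.lipschitz_infDist_pt T
  obtain ⟨N, hN1, hN2, hN⟩ := ((exists_map (m := m) hn hκ).and ((var_bd m hκ).and (eventually_gt_atTop 0))).exists
  have hv := hN2 _ hlip
  have he := EN_infDist hm hN ht0 T (fun y hy => hy) hTne
  have ha : EN N (fun y : Eu n => ‖y‖) ≤ q := by
    refine Real.le_sqrt_of_sq_le ?_
    rw [← EN_norm_sq hN]; exact EN_sq_le _
  have hpos : 0 ≤ EN N (fun y => Metric.infDist y T) := Finset.expect_nonneg fun _ _ => Metric.infDist_nonneg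
  have hmain : q + κ ≤ EN N (fun y => Metric.infDist y T) := by
    refine abs_le_of_sq_le_sq' ?_ hpos |>.2
    nlinarith
  obtain ⟨G, hG⟩ := hN1 _ hlip (by linarith)
  refine reduce' hm hp1 (K := 1/(1+ε)) (by positivity) G fun x hx => ?_
  have hgx := hG x hx
  have hnT : G x ∉ T := fun hmem => by
    rw [Metric.infDist_zero_of_mem hmem] at hgx; exact lt_irrefl _ hgx
  simp only [T, Set.mem_setOf_eq, not_le] at hnT
  refine ⟨?_, ?_, ?_⟩
  · rw [norm_pos_iff]; intro h0; rw [h0] at hnT; simp at hnT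
  · rw [mul_one_div, ← ht]
    refine le_trans ?_ (l1_le_nn hm hp1 _)
    rw [one_div, ← div_eq_inv_mul, le_div_iff₀ (by positivity)]
    linarith
  · rw [mul_one_div_cancel (by linarith), one_mul]
    exact nn_le_norm hm hp1 hp2 _
end

lemma num_aux {s ρ x ε a e q a0 L : ℝ} (hx0 : 0 ≤ x) (hx : x^2 ≤ 0.5708) (hε0 : 0 < ε) (he : ε ≤ e) (hq : 0.5708 + e^2 ≤ q^2) (hq0 : 0 ≤ q)
    (ha : 0 ≤ a) (ha0 : a ≤ a0) (hL0 : 0 ≤ L) (hs : 0 ≤ s * ρ) (hL : L^2 ≤ (s * ρ)^2) (hh : 0.3786 + q * (a0 + 0.001) ≤ L) :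
    x * 0.501 + √(x^2 + ε^2) * (a + 0.001) ≤ s * ρ := by
  have h1 : x ≤ 0.7556 := by nlinarith
  have h2 : √(x^2 + ε^2) ≤ q := by
    rw [Real.sqrt_le_iff]; exact ⟨hq0, by nlinarith⟩
  have h3 : √(x^2 + ε^2) * (a + 0.001) ≤ q * (a0 + 0.001) := by gcongr
  have h4 : L ≤ s * ρ := abs_le_of_sq_le_sq' hL hs |>.2
  linarith

lemma num {n : ℕ} {ρ x ε a : ℝ} (hn : 1 < n) (hx0 : 0 ≤ x) (hx : x^2 ≤ 0.5708) (hε0 : 0 < ε) (hε : ε ≤ 35/100)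
    (h : 1 + ε < (1 - ε) * √(n:ℝ)) (hρ0 : 0 ≤ ρ) (hρ : n - 1.252 * ε^2 ≤ n * ρ^2)
    (ha : 0 ≤ a) (ha2 : a^2 ≤ 2 * n^2 / (2 * n + 1) + 0.001) :
    x * 0.501 + √(x^2 + ε^2) * (a + 0.001) ≤ √(n:ℝ) * ρ := by
  have hs := Real.sq_sqrt (Nat.cast_nonneg (α := ℝ) n)
  have hs0 := Real.sqrt_nonneg (n:ℝ)
  have hsρ : (√(n:ℝ) * ρ)^2 = n * ρ^2 := by rw [mul_pow, hs]
  have hsρ0 : 0 ≤ √(n:ℝ) * ρ := by positivity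
  have bound : ∀ {e q a0 L : ℝ}, ε ≤ e → 0.5708 + e^2 ≤ q^2 → 0 ≤ q → a^2 ≤ a0^2 → 0 ≤ a0 → 0 ≤ L → L^2 ≤ n - 1.252 * e^2 → 
      0.3786 + q * (a0 + 0.001) ≤ L → x * 0.501 + √(x^2 + ε^2) * (a + 0.001) ≤ √(n:ℝ) * ρ := by
    intro e q a0 L he hq hq0 h1 h2 h3 h4 h5
    refine num_aux hx0 hx hε0 he hq hq0 ha (abs_le_of_sq_le_sq' h1 h2 |>.2) h3 hsρ0 ?_ h5
    rw [hsρ]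
    nlinarith
  rcases Nat.lt_or_ge n 7 with hn7 | hn7
  · interval_cases n
    · have : √((2:ℕ):ℝ) ≤ 1.41422 := by rw [Real.sqrt_le_iff]; norm_num
      push_cast at *
      refine bound (e := 0.172) (q := 0.775) (a0 := 1.2654) (L := 1.40) (by nlinarith) (by norm_num) (by norm_num) (ha2.trans (by norm_num)) (by norm_num) (by norm_num) (by norm_num) (by norm_num)
    · have : √((3:ℕ):ℝ) ≤ 1.7321 := by rw [Real.sqrt_le_iff]; norm_num
      push_cast at *
      refine bound (e := 0.268) (q := 0.8017) (a0 := 1.6039) (L := 1.70) (by nlinarith) (by norm_num) (by norm_num) (ha2.trans (by norm_num)) (by norm_num) (by norm_num) (by norm_num) (by norm_num)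
    · have : √((4:ℕ):ℝ) ≤ 2 := by rw [Real.sqrt_le_iff]; norm_num
      push_cast at *
      refine bound (e := 0.3334) (q := 0.8259) (a0 := 1.8859) (L := 1.96) (by nlinarith) (by norm_num) (by norm_num) (ha2.trans (by norm_num)) (by norm_num) (by norm_num) (by norm_num) (by norm_num)
    · push_cast at *
      refine bound (e := 0.35) (q := 0.8327) (a0 := 2.1323) (L := 2.2) (by linarith) (by norm_num) (by norm_num) (ha2.trans (by norm_num)) (by norm_num) (by norm_num) (by norm_num) (by norm_num)
    · push_cast at *
      refine bound (e := 0.35) (q := 0.8327) (a0 := 2.3537) (L := 2.41) (by linarith) (by norm_num) (by norm_num) (ha2.trans (by norm_num)) (by norm_num) (by norm_num) (by norm_num) (by norm_num)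
  · have hn7' : (7:ℝ) ≤ n := by exact_mod_cast hn7
    have hs7 : 2.6 ≤ √(n:ℝ) := Real.le_sqrt_of_sq_le (by norm_num; linarith)
    refine bound (e := 0.35) (q := 0.8327) (a0 := √(n:ℝ)) (L := 0.98 * √(n:ℝ)) (by linarith) (by norm_num) (by norm_num) (ha2.trans ?_) (by positivity) (by positivity) ?_ (by linarith)
    · rw [hs, ← le_sub_iff_add_le, div_le_iff₀ (by positivity)]
      nlinarith
    · rw [mul_pow, hs]; norm_num; linarith

section
variable {m n : ℕ} {p : ℝ}

/-- complementary coordinate -/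
noncomputable def ww (p : ℝ) {m : ℕ} (b : Eu m) : ℝ := √(‖b‖^2 - nn p b^2)

lemma ww_sq (hm : 0 < m) (hp1 : 1 ≤ p) (hp2 : p ≤ 2) (b : Eu m) : nn p b^2 + ww p b^2 = ‖b‖^2 := by
  unfold ww
  rw [Real.sq_sqrt (sub_nonneg.2 (pow_le_pow_left₀ (nn_nonneg b) (nn_le_norm hm hp1 hp2 b) 2))]
  ring

lemma pl_lip (hm : 0 < m) (hp1 : 1 ≤ p) (hp2 : p ≤ 2) {α γ : ℝ} (h : α^2 + γ^2 = 1) : 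
    LipschitzWith 1 (fun b : Eu m => α * nn p b + γ * ww p b) :=
  planar_lip nn_nonneg (nn_le_norm hm hp1 hp2) (nn_dual hp1) h

lemma ww_smul (hp : 1 ≤ p) (c : ℝ) (b : Eu m) (hc : 0 ≤ c) : ww p (c • b) = c * ww p b := by
  unfold ww
  rw [nn_smul hp c b hc, norm_smul, Real.norm_of_nonneg hc, mul_pow, mul_pow, ← mul_sub, Real.sqrt_mul (by positivity), Real.sqrt_sq hc]

lemma norm_even (y z : Eu m) (h : ∀ i, |y i| = |z i|) : ‖y‖ = ‖z‖ := by
  rw [EuclideanSpace.norm_eq, EuclideanSpace.norm_eq]; simp only [Real.norm_eq_abs, h]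

lemma norm_perm (e : Equiv.Perm (Fin m)) (y z : Eu m) (h : ∀ i, z i = y (e i)) : ‖z‖ = ‖y‖ := by
  rw [EuclideanSpace.norm_eq, EuclideanSpace.norm_eq]
  simp only [h]
  rw [Equiv.sum_comp e (fun i => ‖y i‖^2)]

lemma EN_comb {N : ℕ} (f g : Eu m → ℝ) (α γ : ℝ) : EN N (fun y => α * f y + γ * g y) = α * EN N f + γ * EN N g := by
  unfold EN
  rw [Finset.expect_add_distrib, ← Finset.mul_expect, ← Finset.mul_expect]

set_option maxHeartbeats 1000000 in
/-- all the probabilistic input of regime 1 at once -/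
lemma prob_input (hm : 0 < m) (hn : 0 < n) (hp1 : 1 ≤ p) (hp2 : p ≤ 2) : ∃ N : ℕ, ∃ A B ρ a : ℝ, 
    0 < A ∧ 0 ≤ B ∧ 0 < ρ ∧ 0 ≤ a ∧ A^2 + B^2 = ρ^2 ∧ B^2 ≤ 0.5708 * A^2 ∧ 0.636 ≤ A^2 ∧ 
    m - 1.252 ≤ m * ρ^2 ∧ a^2 ≤ 2 * n^2 / (2 * n + 1) + 0.001 ∧ a ≤ √(n:ℝ) ∧
    EN N (nn p : Eu m → ℝ) = A * √(m:ℝ) ∧ EN N (ww p : Eu m → ℝ) = B * √(m:ℝ) ∧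
    EN N (fun y : Eu m => |(A / ρ) * ww p y - (B / ρ) * nn p y|) ≤ 0.501 ∧ 
    ∀ Ψ : Eu m → ℝ, LipschitzWith 1 Ψ → a + 0.001 ≤ EN N Ψ → ∃ G : Eu n →ₗ[ℝ] Eu m, ∀ x, ‖x‖ = 1 → 0 < Ψ (G x) := by
  have hm' : (0:ℝ) < m := by exact_mod_cast hm
  have hk : (0:ℝ) < 0.001 := by norm_num
  obtain ⟨N0, hN0⟩ := eventually_atTop.1 ((exists_map (m := m) hn hk).and ((var_bd m hk).and ((quarter_bd hm hk).and (EN_norm_le n hk))))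
  obtain ⟨hG, hvar, hqu, hnl⟩ := hN0 (2 * N0 + 1) (by omega)
  have hcoord := fun i => expect_abs_coord_ge (m := m) (k := N0) i
  have hN : 0 < 2 * N0 + 1 := by omega
  set N := 2 * N0 + 1
  have hsm := Real.sq_sqrt hm'.le
  have hsm0 : 0 < √(m:ℝ) := by positivity
  set q := √(m:ℝ) with hqd
  clear hN0
  obtain ⟨A, hA⟩ : ∃ A, A = EN N (nn p : Eu m → ℝ) / q := ⟨_, rfl⟩
  obtain ⟨B, hB⟩ : ∃ B, B = EN N (ww p : Eu m → ℝ) / q := ⟨_, rfl⟩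
  have hAe : EN N (nn p : Eu m → ℝ) = A * q := by rw [hA]; field_simp
  have hBe : EN N (ww p : Eu m → ℝ) = B * q := by rw [hB]; field_simp
  have hA1 : √(2/π) ≤ A := by
    rw [hA, le_div_iff₀ hsm0]
    calc √(2/π) * q = (1/q) * ∑ i : Fin m, √(2/π) := by simp; field_simp; linarith
      _ ≤ (1/q) * ∑ i : Fin m, 𝔼 ω : Fin N × Fin m → Bool, |hv ω i| := by
          gcongr with i
          exact Real.sqrt_le_iff.2 ⟨Finset.expect_nonneg fun _ _ => abs_nonneg _, hcoord i⟩
      _ = EN N (fun y : Eu m => (1/q) * ∑ i, |y i|) := by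
          unfold EN; rw [← Finset.expect_sum_comm, Finset.mul_expect]
      _ ≤ _ := Finset.expect_le_expect fun ω _ => l1_le_nn hm hp1 _
  have hApos : 0 < A := lt_of_lt_of_le (by positivity) hA1
  have hA2 : 2/π ≤ A^2 := (Real.sqrt_le_iff.1 hA1 |>.2)
  have hB0 : 0 ≤ B := by
   rw [hB]; exact div_nonneg (Finset.expect_nonneg fun _ _ => Real.sqrt_nonneg _) hsm0.le
  have hnsq := EN_norm_sq (m := m) hN
  have hAB : A^2 + B^2 ≤ 1 := by
    have h1 := EN_sq_le (N := N) (nn p : Eu m → ℝ)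
    have h2 := EN_sq_le (N := N) (ww p : Eu m → ℝ)
    have h3 := EN_comb (N := N) (fun y : Eu m => nn p y^2) (fun y => ww p y^2) 1 1
    simp only [one_mul, ww_sq hm hp1 hp2] at h3
    rw [hAe] at h1
    rw [hBe] at h2
    have e1 : EN N (fun y : Eu m => nn p y^2) + EN N (fun y : Eu m => ww p y^2) = m := h3.symm.trans hnsq
    have : (A^2 + B^2) * m ≤ 1 * m := by
      calc (A^2 + B^2) * m = (A * q)^2 + (B * q)^2 := by rw [mul_pow, mul_pow, hsm]; ring
        _ ≤ _ := by linarith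
    exact le_of_mul_le_mul_right this hm'
  set ρ := √(A^2 + B^2) with hρ
  have hρ2 : ρ^2 = A^2 + B^2 := Real.sq_sqrt (by positivity)
  have hρ0 : 0 < ρ := by positivity
  have hu : (A/ρ)^2 + (B/ρ)^2 = 1 := by rw [div_pow, div_pow, ← add_div, hρ2, div_self (by positivity)]
  set Y : Eu m → ℝ := fun y => (-(B/ρ)) * nn p y + (A/ρ) * ww p y with hY
  set Z : Eu m → ℝ := fun y => (A/ρ) * nn p y + (B/ρ) * ww p y with hZ
  have hYl : LipschitzWith 1 Y := pl_lip hm hp1 hp2 (by rw [neg_sq]; linarith)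
  have hZl : LipschitzWith 1 Z := pl_lip hm hp1 hp2 hu
  have hEY : EN N Y = 0 := by rw [hY, EN_comb, hAe, hBe]; ring
  have hEZ : EN N Z = ρ * q := by 
    rw [hZ, EN_comb, hAe, hBe]; field_simp; rw [hρ2]
  have hY2 : EN N (fun y => Y y^2) ≤ 1/4 + 0.001 := by
    refine hqu Y hYl ?_ ?_ ?_ hEY
    · intro c b hc; simp only [hY, nn_smul hp1 c b hc, ww_smul hp1 c b hc]; ring
    · intro y z h; simp only [hY, ww, nn_even y z h, norm_even y z h]
    · intro e y z h; simp only [hY, ww, nn_perm e y z h, norm_perm e y z h]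
  have hZ2 := hvar Z hZl
  have hYZ : EN N (fun y => Y y^2) + EN N (fun y => Z y^2) = m := by
    have h3 := EN_comb (N := N) (fun y : Eu m => Y y^2) (fun y => Z y^2) 1 1
    have : ∀ y, Y y^2 + Z y^2 = ‖y‖^2 := fun y => by
      simp only [hY, hZ]
      rw [← ww_sq hm hp1 hp2 y]
      linear_combination (nn p y^2 + ww p y^2) * hu
    simp only [one_mul, this] at h3
    rw [← h3, hnsq]
  refine ⟨N, A, B, ρ, EN N (fun y : Eu n => ‖y‖), hApos, hB0, hρ0, Finset.expect_nonneg fun _ _ => norm_nonneg _, hρ2.symm, ?_, ?_, ?_, hnl, ?_, hAe, hBe, ?_, hG⟩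
  · have h1 := Real.pi_lt_d4
    rw [div_le_iff₀ Real.pi_pos] at hA2
    nlinarith [sq_nonneg A]
  · refine le_trans ?_ hA2
    rw [le_div_iff₀ Real.pi_pos]
    linarith [Real.pi_lt_d4]
  · rw [hEZ] at hZ2
    have e1 : (ρ * q)^2 = m * ρ^2 := by rw [mul_pow, hsm]; ring
    rw [e1] at hZ2
    linarith
  · refine Real.le_sqrt_of_sq_le ?_
    rw [← EN_norm_sq hN]; exact EN_sq_le _
  · have h1 := EN_sq_le (N := N) (fun y => |Y y|)
    simp only [sq_abs] at h1
    have h2 : EN N (fun y => |Y y|) ≤ 0.501 := by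
      refine abs_le_of_sq_le_sq' ?_ (by norm_num) |>.2
      refine h1.trans (hY2.trans (by norm_num))
    refine le_trans (le_of_eq ?_) h2
    congr 1; funext y
    simp only [hY]; congr 1; ring

lemma two_sided {A B ε P u w R : ℝ} (hA : 0 < A) (hB : 0 < B) (h0 : 0 < ε) (h1 : ε < 1) (hc : ε * A^2 ≤ B^2) (hP : 0 < P)
    (hP2 : P^2 = (B^2 + ε^2 * A^2) * (A^2 + B^2)) (hu : 0 ≤ u) (hw : 0 ≤ w) (hR : 0 ≤ R) (hs : u^2 + w^2 = R^2)
    (g1 : (B^2 - ε * A^2) * u < (1 + ε) * (A * B) * w) (g2 : (1 - ε) * (A * B) * w < (ε * A^2 + B^2) * u) :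
    0 < R ∧ (1 - ε) * (A * B / P) * R ≤ u ∧ u ≤ (1 + ε) * (A * B / P) * R := by
  refine ⟨?_, ?_, ?_⟩
  · rcases eq_or_lt_of_le hR with h' | h'
    · rw [← h'] at hs
      have hu0 : u = 0 := pow_eq_zero_iff (two_ne_zero) |>.1 (by nlinarith [sq_nonneg u, sq_nonneg w])
      have hw0 : w = 0 := pow_eq_zero_iff (two_ne_zero) |>.1 (by nlinarith [sq_nonneg u, sq_nonneg w])
      rw [hu0, hw0] at g1
      simp at g1
    · exact h'
  · rw [← mul_div_assoc, div_mul_eq_mul_div, div_le_iff₀ hP]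
    refine abs_le_of_sq_le_sq' ?_ (by positivity) |>.2
    have h5 := pow_le_pow_left₀ (mul_nonneg (mul_nonneg (by linarith) (by positivity)) hw) g2.le 2
    rw [mul_pow u, hP2, mul_pow _ R, ← hs]
    linarith
  · rw [← mul_div_assoc, div_mul_eq_mul_div, le_div_iff₀ hP]
    refine abs_le_of_sq_le_sq' ?_ (by positivity) |>.2
    have h5 := pow_le_pow_left₀ (mul_nonneg (by linarith) hu) g1.le 2
    rw [mul_pow u, hP2, mul_pow _ R, ← hs]
    linarith

set_option maxHeartbeats 1000000 in
lemma regime1 (hn : 1 < n) (hm : 0 < m) (hp1 : 1 ≤ p) (hp2 : p ≤ 2) {ε : ℝ} (h0 : 0 < ε) (hε : ε ≤ 35/100) 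
    (hnm : n ≤ ε^2 * m) (h : 1 + ε < (1 - ε) * √(n:ℝ)) :
    ∃ f : (Fin n → ℝ) →ₗ[ℝ] (Fin m → ℝ), ∀ x : Fin n → ℝ,
      (1 - ε) * Real.sqrt (∑ i, x i ^ 2) ≤ lpNorm p (f x) ∧
      lpNorm p (f x) ≤ (1 + ε) * Real.sqrt (∑ i, x i ^ 2) := by
  have hm' : (0:ℝ) < m := by exact_mod_cast hm
  have hn' : (1:ℝ) ≤ n := by exact_mod_cast hn.le
  obtain ⟨N, A, B, ρ, a, hA, hB, hρ, ha, hAB, hBA, hA2, hρm, ha2, han, hEn, hEw, hEY, hG⟩ := prob_input (p := p) (n := n) hm (by omega) hp1 hp2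
  have hqn : √(n:ℝ) ≤ ε * √(m:ℝ) := by
    rw [Real.sqrt_le_iff]
    refine ⟨by positivity, ?_⟩
    rw [mul_pow, Real.sq_sqrt hm'.le]; exact hnm
  have hn1 : 1 ≤ √(n:ℝ) := Real.one_le_sqrt.2 hn'
  have hsq := ww_sq (p := p) hm hp1 hp2
  have hnn := nn_nonneg (p := p) (m := m)
  have hww : ∀ b : Eu m, 0 ≤ ww p b := fun b => Real.sqrt_nonneg _
  rcases lt_or_ge (B^2) (ε * A^2) with hc | hc
  · -- one-sided case
    have hr := Real.sq_sqrt h0.le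
    have hr0 : 0 < √ε := by positivity
    set r := √ε
    have hu : (2 * r/(1+ε))^2 + (-((1-ε)/(1+ε)))^2 = 1 := by
      rw [neg_sq, div_pow, div_pow, ← add_div, mul_pow, hr, div_eq_one_iff_eq (by positivity)]; ring
    obtain ⟨G, hG⟩ := hG _ (pl_lip (p := p) hm hp1 hp2 hu) (by
      rw [EN_comb, hEn, hEw]
      have hBr : B ≤ r * A := by
        refine abs_le_of_sq_le_sq' ?_ (by positivity) |>.2
        rw [mul_pow, hr]; exact hc.le
      have e1 : r * A ≤ 2 * r / (1+ε) * A - (1 - ε)/(1+ε) * B := by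
        have : 2 * r / (1+ε) * A - (1 - ε)/(1+ε) * (r * A) = r * A := by field_simp; ring
        have h2 : (1 - ε)/(1+ε) * B ≤ (1 - ε)/(1+ε) * (r * A) := by
          refine mul_le_mul_of_nonneg_left hBr (div_nonneg (by linarith) (by linarith))
        linarith
      have hA79 : 0.79 ≤ A := by
        refine abs_le_of_sq_le_sq' ?_ hA.le |>.2
        exact le_trans (by norm_num) hA2
      have hr6 : r ≤ 0.6 := Real.sqrt_le_iff.2 ⟨by norm_num, hε.trans (by norm_num)⟩
      have e2 : r * A * √(m:ℝ) ≤ (2 * r / (1+ε) * A - (1 - ε)/(1+ε) * B) * √(m:ℝ) := by gcongr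
      have e3 : (1.1:ℝ) * ε ≤ r * A := by
        rw [← hr]
        have : 0 ≤ r * (A - 1.1 * r) := mul_nonneg hr0.le (by linarith)
        linarith [this]
      have e4 : (1.1:ℝ) * ε * √(m:ℝ) ≤ r * A * √(m:ℝ) := by gcongr
      linarith)
    refine reduce' hm hp1 (K := 1/(1+ε)) (by positivity) G fun x hx => ?_
    have hgx := hG x hx
    have hs := hsq (G x)
    have h1 := hnn (G x)
    have h2 := hww (G x)
    have h3 := nn_le_norm hm hp1 hp2 (G x)
    set u := nn p (G x)
    set w := ww p (G x)
    set R := ‖G x‖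
    have hlt : (1 - ε) * w < 2 * r * u := by
      have : 0 < (2 * r * u - (1 - ε) * w) / (1+ε) := by
        calc (0:ℝ) < _ := hgx
          _ = _ := by ring
      have := (div_pos_iff_of_pos_right (by linarith : 0 < 1 + ε)).1 this
      linarith
    have hR : 0 ≤ R := norm_nonneg _
    refine ⟨?_, ?_, ?_⟩
    · rcases eq_or_lt_of_le hR with h' | h'
      · rw [← h'] at h3
        have hu0 : u = 0 := le_antisymm h3 h1
        rw [hu0] at hlt
        nlinarith
      · exact h'
    · rw [mul_one_div, div_mul_eq_mul_div, div_le_iff₀ (by linarith)]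
      refine abs_le_of_sq_le_sq' ?_ (by positivity) |>.2
      have h5 : ((1 - ε) * w)^2 ≤ (2 * r * u)^2 := pow_le_pow_left₀ (mul_nonneg (by linarith) h2) hlt.le 2
      have h6 : (2 * r * u)^2 = 4 * ε * u^2 := by rw [mul_pow, mul_pow, hr]; ring
      rw [h6] at h5
      rw [mul_pow, ← hs]
      nlinarith
    · rw [mul_one_div_cancel (by linarith), one_mul]
      exact h3
  · -- two-sided case
    have hB' : 0 < B := by
      rcases eq_or_lt_of_le hB with h' | h'
      · rw [← h'] at hc; nlinarith [mul_pos h0 (pow_pos hA 2)]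
      · exact h'
    set D := √(B^2 + ε^2 * A^2) with hD
    have hD2 : D^2 = B^2 + ε^2 * A^2 := Real.sq_sqrt (by positivity)
    have hD0 : 0 < D := by positivity
    -- the two linear forms
    set c1 := (ε * A^2 - B^2) / (D * ρ) with hc1
    set d1 := (ε * A * B + A * B) / (D * ρ) with hd1
    set c2 := (ε * A^2 + B^2) / (D * ρ) with hc2
    set d2 := (ε * A * B - A * B) / (D * ρ) with hd2
    have hDρ : (D * ρ)^2 = (B^2 + ε^2 * A^2) * (A^2 + B^2) := by rw [mul_pow, hD2, hAB]
    have u1 : c1^2 + d1^2 = 1 := by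
      rw [hc1, hd1, div_pow, div_pow, ← add_div, div_eq_one_iff_eq (by positivity), hDρ]; ring
    have u2 : c2^2 + d2^2 = 1 := by
      rw [hc2, hd2, div_pow, div_pow, ← add_div, div_eq_one_iff_eq (by positivity), hDρ]; ring
    have hlip : LipschitzWith 1 (fun b : Eu m => min (c1 * nn p b + d1 * ww p b) (c2 * nn p b + d2 * ww p b)) := by
      simpa using (pl_lip (p := p) hm hp1 hp2 u1).min (pl_lip (p := p) hm hp1 hp2 u2)
    have hmin : ∀ b : Eu m, min (c1 * nn p b + d1 * ww p b) (c2 * nn p b + d2 * ww p b) = 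
        ((ε * A / D) * (A / ρ) * nn p b + (ε * A / D) * (B/ρ) * ww p b) - (B/D) * |(A / ρ) * ww p b - (B / ρ) * nn p b| := by
      intro b
      have e1 : c1 * nn p b + d1 * ww p b = ((ε * A / D) * (A / ρ) * nn p b + (ε * A / D) * (B/ρ) * ww p b) + (B/D) * ((A / ρ) * ww p b - (B / ρ) * nn p b) := by
        rw [hc1, hd1]; field_simp; ring
      have e2 : c2 * nn p b + d2 * ww p b = ((ε * A / D) * (A / ρ) * nn p b + (ε * A / D) * (B/ρ) * ww p b) - (B/D) * ((A / ρ) * ww p b - (B / ρ) * nn p b) := by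
        rw [hc2, hd2]; field_simp; ring
      have hBD : 0 ≤ B/D := by positivity
      rw [e1, e2]
      rcases le_total 0 ((A / ρ) * ww p b - (B / ρ) * nn p b) with h' | h'
      · rw [abs_of_nonneg h', min_eq_right]; nlinarith [mul_nonneg hBD h']
      · rw [abs_of_nonpos h', min_eq_left]
        · ring
        · nlinarith [mul_nonneg hBD (neg_nonneg.2 h')]
    have hE : EN N (fun b : Eu m => min (c1 * nn p b + d1 * ww p b) (c2 * nn p b + d2 * ww p b)) = 
        (ε * A / D) * ρ * √(m:ℝ) - (B/D) * EN N (fun y : Eu m => |(A / ρ) * ww p y - (B / ρ) * nn p y|) := by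
      simp only [hmin]
      have h1 := EN_comb (N := N) (nn p : Eu m → ℝ) (ww p) ((ε * A / D) * (A / ρ)) ((ε * A / D) * (B/ρ))
      rw [hEn, hEw] at h1
      unfold EN at h1 ⊢
      rw [Finset.expect_sub_distrib, h1, Finset.mul_expect]
      congr 1
      field_simp
      rw [← hAB]
    have hbig : a + 0.001 ≤ EN N (fun b : Eu m => min (c1 * nn p b + d1 * ww p b) (c2 * nn p b + d2 * ww p b)) := by
      rw [hE]
      have hρn : n - 1.252 * ε^2 ≤ n * ρ^2 := by
        have hρ1 : m * (1 - ρ^2) ≤ 1.252 := by linarith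
        rcases le_total (1 - ρ^2) 0 with h' | h'
        · nlinarith
        · nlinarith [mul_le_mul_of_nonneg_right hnm h']
      have := num (x := B/A) hn (by positivity) (by rw [div_pow, div_le_iff₀ (by positivity)]; exact hBA) h0 hε h hρ.le hρn ha ha2
      have hDA : A * √((B/A)^2 + ε^2) = D := by
        rw [hD, ← Real.sqrt_sq hA.le, ← Real.sqrt_mul (by positivity), Real.sqrt_sq hA.le]
        congr 1; field_simp
      have h2 := mul_le_mul_of_nonneg_left this hA.le
      have h3 : A * (B / A * 0.501 + √((B/A)^2 + ε^2) * (a + 0.001)) = B * 0.501 + D * (a + 0.001) := by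
        rw [← hDA]; field_simp
      rw [h3] at h2
      have h4 : A * (√(n:ℝ) * ρ) ≤ A * ((ε * √(m:ℝ)) * ρ) := by gcongr
      have h5 : B / D * EN N (fun y : Eu m => |(A / ρ) * ww p y - (B / ρ) * nn p y|) ≤ B/D * 0.501 := by gcongr
      have h6 : a + 0.001 ≤ ε * A / D * ρ * √(m:ℝ) - B/D * 0.501 := by
        have : ε * A / D * ρ * √(m:ℝ) - B/D * 0.501 = (A * ((ε * √(m:ℝ)) * ρ) - B * 0.501) / D := by ring
        rw [this, le_div_iff₀ hD0]; linarith
      linarith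
    obtain ⟨G, hG⟩ := hG _ hlip hbig
    refine reduce' hm hp1 (K := A * B / (D * ρ)) (by positivity) G fun x hx => ?_
    have hgx := hG x hx
    have hs := hsq (G x)
    have h1 := hnn (G x)
    have h2 := hww (G x)
    set u := nn p (G x)
    set w := ww p (G x)
    set R := ‖G x‖
    have hR : 0 ≤ R := norm_nonneg _
    obtain ⟨g1, g2⟩ := lt_min_iff.1 hgx
    have hP : 0 < D * ρ := by positivity
    have g1' : (B^2 - ε * A^2) * u < (1 + ε) * (A * B) * w := by
      have : 0 < ((1 + ε) * (A * B) * w - (B^2 - ε * A^2) * u) / (D * ρ) := by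
        calc (0:ℝ) < _ := g1
          _ = _ := by rw [hc1, hd1]; ring
      have := (div_pos_iff_of_pos_right hP).1 this
      linarith
    have g2' : (1 - ε) * (A * B) * w < (ε * A^2 + B^2) * u := by
      have : 0 < ((ε * A^2 + B^2) * u - (1 - ε) * (A * B) * w) / (D * ρ) := by
        calc (0:ℝ) < _ := g2
          _ = _ := by rw [hc2, hd2]; ring
      have := (div_pos_iff_of_pos_right hP).1 this
      linarith
    exact two_sided hA hB' h0 (by linarith) hc hP hDρ h1 h2 hR hs g1' g2'
end

/-- For any `ε ∈ (0,1)`, `1 ≤ p ≤ 2`, and positive integers `n, m` with `m ≥ n/ε²`,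
there exists a linear map `f : ℝ^n → ℝ^m` such that for every `x ∈ ℝ^n`,
`(1−ε)‖x‖₂ ≤ ‖f(x)‖_p ≤ (1+ε)‖x‖₂`. -/
theorem flm_embedding (ε p : ℝ) (hε : ε ∈ Set.Ioo (0 : ℝ) 1) (hp1 : 1 ≤ p) (hp2 : p ≤ 2)
    (n m : ℕ) (hn : 0 < n) (hm : 0 < m) (hnm : (n : ℝ) / ε ^ 2 ≤ (m : ℝ)) :
    ∃ f : (Fin n → ℝ) →ₗ[ℝ] (Fin m → ℝ), ∀ x : Fin n → ℝ,
      (1 - ε) * Real.sqrt (∑ i, x i ^ 2) ≤ lpNorm p (f x) ∧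
      lpNorm p (f x) ≤ (1 + ε) * Real.sqrt (∑ i, x i ^ 2) := by
  obtain ⟨h0, h1⟩ := hε
  have hnm' : (n:ℝ) ≤ ε^2 * m := by
    rw [div_le_iff₀ (by positivity)] at hnm; linarith
  have hle : n ≤ m := by
    have hm' : (0:ℝ) < m := by exact_mod_cast hm
    have h2 : ε^2 ≤ 1 := pow_le_one₀ h0.le h1.le
    have : (n:ℝ) ≤ m := hnm'.trans (mul_le_of_le_one_left hm'.le h2)
    exact_mod_cast this
  rcases le_or_gt ((1 - ε) * √(n:ℝ)) (1 + ε) with h | h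
  · exact regime0 hp1 hp2 h1 hle h
  · have hn1 : 1 < n := by
      by_contra hcon
      have : n = 1 := by omega
      rw [this] at h
      simp at h
      linarith
    rcases le_total ε (35/100) with hs | hs
    · exact regime1 hn1 hm hp1 hp2 h0 hs hnm' h
    · exact regime2 hn hm hp1 hp2 hs h1 hnm' h
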